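/- arXiv:1310.8605 — 2 statements merged into one kernel-verified Lean document; each statement's English description precedes it below -/
import Mathlib

section
/- Let Γ be a finite simple graph and suppose the group G is isomorphic to a virtual retract of the right-angled Artin group A(Γ) (that is, G belongs to the class VR). Then the outer automorphism group Out(G) is residually finite. -/
/-- A group `K` is residually finite if every nontrivial element survives in some
finite quotient. -/
def ResiduallyFinite (K : Type*) [Group K] : Prop :=
  ∀ k : K, k ≠ 1 → ∃ (F : Type) (_ : Group F) (_ : Finite F) (f : K →* F), f k ≠ 1

/-- The inner automorphisms form a normal subgroup of `MulAut G`. -/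
instance conjRangeNormal (G : Type*) [Group G] :
    ((MulAut.conj : G →* MulAut G).range).Normal := by
  constructor
  intro x hx α
  obtain ⟨g, rfl⟩ := hx
  refine ⟨α g, ?_⟩
  ext h
  simp [MulAut.conj_apply, MulAut.mul_apply]

/-- The outer automorphism group of `G`: the quotient of `MulAut G` by the
inner automorphisms. -/
abbrev OuterAut (G : Type*) [Group G] :=
  MulAut G ⧸ (MulAut.conj : G →* MulAut G).range

/-- The set of defining relators of the right-angled Artin group on `Γ`. -/
abbrev raagRels {V : Type*} (Γ : SimpleGraph V) : Set (FreeGroup V) :=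
  {r | ∃ u v : V, Γ.Adj u v ∧
    r = FreeGroup.of u * FreeGroup.of v * (FreeGroup.of u)⁻¹ * (FreeGroup.of v)⁻¹}

/-- The right-angled Artin group associated to a simple graph `Γ`. -/
abbrev RAAG {V : Type*} (Γ : SimpleGraph V) := PresentedGroup (raagRels Γ)

/-- A subgroup `H ≤ G` is a virtual retract of `G` if there is a finite-index subgroup
`K` of `G` with `H ≤ K` and a retraction `K →* H` restricting to the identity on `H`. -/
def IsVirtualRetract {G : Type*} [Group G] (H : Subgroup G) : Prop :=
  ∃ (K : Subgroup G) (hK : H ≤ K), K.index ≠ 0 ∧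
    ∃ r : K →* H, ∀ h : H, r ⟨(h : G), hK h.2⟩ = h

namespace RightAngled

/-- The Coxeter matrix of the right-angled Coxeter group in which adjacent vertices commute. -/
noncomputable def coxMatrix {I : Type*} (Gr : SimpleGraph I) : CoxeterMatrix I := by
  classical
  exact
  { M := Matrix.of fun i j => if i = j then 1 else if Gr.Adj i j then 2 else 0
    isSymm := by
      ext i j
      simp [Matrix.transpose_apply, eq_comm, Gr.adj_comm]
    diagonal := by simp
    off_diagonal := by
      intro i j h
      simp only [Matrix.of_apply, if_neg h]
      split_ifs <;> simp }

section

variable {I W : Type*} [Group W] {Gr : SimpleGraph I} (cs : CoxeterSystem (coxMatrix Gr) W)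

theorem coxMatrix_self (i : I) : coxMatrix Gr i i = 1 := (coxMatrix Gr).diagonal i

theorem coxMatrix_adj {i j : I} (h : Gr.Adj i j) : coxMatrix Gr i j = 2 := by
  classical
  change (if i = j then 1 else if Gr.Adj i j then 2 else 0) = 2
  simp [h.ne, h]

theorem coxMatrix_not_adj {i j : I} (h : i ≠ j) (h' : ¬ Gr.Adj i j) : coxMatrix Gr i j = 0 := by
  classical
  change (if i = j then 1 else if Gr.Adj i j then 2 else 0) = 0
  simp [h, h']

theorem simple_comm {i j : I} (h : Gr.Adj i j) :
    cs.simple i * cs.simple j = cs.simple j * cs.simple i := by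
  have := cs.simple_mul_simple_pow i j
  rw [coxMatrix_adj h, pow_two, mul_eq_one_iff_eq_inv, mul_inv_rev, cs.inv_simple,
    cs.inv_simple] at this
  exact this

theorem isLiftable_of_involutions {G : Type*} [Monoid G] {f : I → G} (h2 : ∀ i, f i * f i = 1)
    (hc : ∀ i j, Gr.Adj i j → f i * f j = f j * f i) : (coxMatrix Gr).IsLiftable f := by
  intro i j
  by_cases h : i = j
  · subst h; rw [coxMatrix_self, pow_one, h2]
  by_cases h' : Gr.Adj i j
  · rw [coxMatrix_adj h', pow_two]
    nth_rewrite 2 [hc i j h']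
    rw [mul_assoc, ← mul_assoc (f j), h2, one_mul, h2]
  · rw [coxMatrix_not_adj h h', pow_zero]

/-- A homomorphism out of a right-angled Coxeter group, from involutions which commute along
edges. -/
noncomputable def liftInv {G : Type*} [Monoid G] (f : I → G) (h2 : ∀ i, f i * f i = 1)
    (hc : ∀ i j, Gr.Adj i j → f i * f j = f j * f i) : W →* G :=
  cs.lift ⟨f, isLiftable_of_involutions h2 hc⟩

@[simp]
theorem liftInv_simple {G : Type*} [Monoid G] (f : I → G) (h2 : ∀ i, f i * f i = 1)
    (hc : ∀ i j, Gr.Adj i j → f i * f j = f j * f i) (i : I) :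
    liftInv cs f h2 hc (cs.simple i) = f i :=
  cs.lift_apply_simple _ i

open Classical in
/-- The action of a simple reflection on signed elements; it records inversions. -/
noncomputable def signedAct (i : I) : Function.End (W × ZMod 2) :=
  fun p => (cs.simple i * p.1 * cs.simple i, p.2 + if p.1 = cs.simple i then 1 else 0)

theorem signedAct_sq (i : I) : signedAct cs i * signedAct cs i = 1 := by
  classical
  funext p
  obtain ⟨t, ε⟩ := p
  have h1 : cs.simple i * (cs.simple i * t * cs.simple i) * cs.simple i = t := by
    simp [mul_assoc]
  have h2 : cs.simple i * t * cs.simple i = cs.simple i ↔ t = cs.simple i := by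
    constructor
    · intro h
      rw [h] at h1
      simpa using h1.symm
    · rintro rfl; simp
  have h3 : (1 : ZMod 2) + 1 = 0 := by decide
  change (_, _) = (_, _)
  simp only [signedAct, h1, h2]
  split_ifs <;> simp [add_assoc, h3]

theorem signedAct_comm (i j : I) (hij : Gr.Adj i j) :
    signedAct cs i * signedAct cs j = signedAct cs j * signedAct cs i := by
  classical
  have hc := simple_comm cs hij
  have key : ∀ a b : I, cs.simple a * cs.simple b = cs.simple b * cs.simple a → ∀ t,
      (cs.simple a * t * cs.simple a = cs.simple b ↔ t = cs.simple b) := by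
    intro a b h t
    constructor
    · intro h'
      have : t = cs.simple a * (cs.simple a * t * cs.simple a) * cs.simple a := by
        simp [mul_assoc]
      rw [this, h', h, mul_assoc]; simp
    · rintro rfl; rw [h]; simp
  funext p
  obtain ⟨t, ε⟩ := p
  change (_, _) = (_, _)
  simp only [signedAct, key j i hc.symm, key i j hc, Prod.mk.injEq]
  constructor
  · calc _ = cs.simple i * cs.simple j * t * (cs.simple j * cs.simple i) := by
          simp only [mul_assoc]
      _ = cs.simple j * cs.simple i * t * (cs.simple i * cs.simple j) := by rw [hc]
      _ = _ := by simp only [mul_assoc]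
  · ring

/-- The action of the group on signed elements. -/
noncomputable def signedHom : W →* Function.End (W × ZMod 2) :=
  liftInv cs (signedAct cs) (signedAct_sq cs) (signedAct_comm cs)

open Classical in
theorem signedHom_wordProd (ω : List I) (t : W) (ε : ZMod 2) :
    signedHom cs (cs.wordProd ω) (t, ε) =
      (cs.wordProd ω * t * (cs.wordProd ω)⁻¹, ε + ((cs.rightInvSeq ω).count t : ZMod 2)) := by
  induction ω with
  | nil => simp [CoxeterSystem.rightInvSeq]; rfl
  | cons i ω ih =>
    rw [cs.wordProd_cons, map_mul]
    change signedHom cs (cs.simple i) (signedHom cs (cs.wordProd ω) (t, ε)) = _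
    rw [ih, signedHom, liftInv_simple]
    have : cs.wordProd ω * t * (cs.wordProd ω)⁻¹ = cs.simple i ↔
        (cs.wordProd ω)⁻¹ * cs.simple i * cs.wordProd ω = t := by
      constructor
      · intro h; rw [← h]; group
      · intro h; rw [← h]; group
    simp only [signedAct, CoxeterSystem.rightInvSeq, List.count_cons, this, Prod.mk.injEq]
    refine ⟨by simp [mul_assoc], ?_⟩
    by_cases h : (cs.wordProd ω)⁻¹ * cs.simple i * cs.wordProd ω = t
    · simp [h]; ring
    · simp [h]

theorem mul_eq_wordProd_eraseIdx_of_mem {ω : List I} {t : W} (h : t ∈ cs.rightInvSeq ω) :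
    ∃ j < ω.length, cs.wordProd ω * t = cs.wordProd (ω.eraseIdx j) := by
  obtain ⟨j, hj, rfl⟩ := List.mem_iff_getElem.1 h
  refine ⟨j, by simpa using hj, ?_⟩
  rw [← cs.wordProd_mul_getD_rightInvSeq, List.getD_eq_getElem _ _ hj]

/-- The exchange property. -/
theorem exchange {ω : List I} {i : I} (h : cs.IsRightDescent (cs.wordProd ω) i) :
    ∃ j < ω.length, cs.wordProd ω * cs.simple i = cs.wordProd (ω.eraseIdx j) := by
  classical
  by_cases hi : cs.simple i ∈ cs.rightInvSeq ω
  · exact mul_eq_wordProd_eraseIdx_of_mem cs hi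
  exfalso
  obtain ⟨ω', hω', he⟩ := cs.exists_isReduced (cs.wordProd ω * cs.simple i)
  have h1 : signedHom cs (cs.wordProd ω * cs.simple i) (cs.simple i, 0) =
      signedHom cs (cs.wordProd ω) (cs.simple i, 1) := by
    rw [map_mul]
    change signedHom cs (cs.wordProd ω) (signedHom cs (cs.simple i) (cs.simple i, 0)) = _
    rw [signedHom, liftInv_simple]
    simp [signedAct]
  rw [he, signedHom_wordProd, signedHom_wordProd, List.count_eq_zero_of_not_mem hi] at h1
  have h2 := congrArg Prod.snd h1
  have h3 : cs.simple i ∈ cs.rightInvSeq ω' := by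
    by_contra h'
    simp [List.count_eq_zero_of_not_mem h'] at h2
  obtain ⟨j, hj, h4⟩ := mul_eq_wordProd_eraseIdx_of_mem cs h3
  rw [← he, cs.simple_mul_simple_cancel_right] at h4
  have h5 := cs.length_wordProd_le (ω'.eraseIdx j)
  rw [← h4, List.length_eraseIdx_of_lt hj] at h5
  have h6 := hω'.eq
  rw [← he] at h6
  unfold CoxeterSystem.IsRightDescent at h
  omega

/-- The alternating product `s t s t ⋯` with `k` factors. -/
def altProd (a b : W) : ℕ → W
  | 0 => 1
  | k + 1 => a * altProd b a k

open Classical in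
/-- An action on the integers through an infinite dihedral group. -/
noncomputable def dihedralAct (s t : I) (i : I) : Function.End ℤ :=
  fun n => if i = s then -1 - n else if i = t then 1 - n else n

theorem dihedralAct_sq (s t : I) (i : I) : dihedralAct s t i * dihedralAct s t i = 1 := by
  funext n
  change dihedralAct s t i (dihedralAct s t i n) = n
  unfold dihedralAct
  split_ifs <;> ring

theorem dihedralAct_comm {s t : I} (hst : ¬ Gr.Adj s t) (i j : I) (hij : Gr.Adj i j) :
    dihedralAct s t i * dihedralAct s t j = dihedralAct s t j * dihedralAct s t i := by
  have hts : ¬ Gr.Adj t s := fun h => hst h.symm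
  funext n
  change dihedralAct s t i (dihedralAct s t j n) = dihedralAct s t j (dihedralAct s t i n)
  unfold dihedralAct
  split_ifs <;> subst_vars <;> first | rfl | exact absurd hij ‹_›

/-- The homomorphism to the infinite dihedral group determined by non-adjacent vertices. -/
noncomputable def dihedralHom {s t : I} (hst : ¬ Gr.Adj s t) : W →* Function.End ℤ :=
  liftInv cs (dihedralAct s t) (dihedralAct_sq s t) (dihedralAct_comm hst)

theorem natAbs_dihedralHom_le {s t : I} (hst : ¬ Gr.Adj s t) (ω : List I) :
    (dihedralHom cs hst (cs.wordProd ω) (0 : ℤ) : ℤ).natAbs ≤ ω.length := by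
  induction ω with
  | nil => simp [Function.End.one_def]
  | cons i ω ih =>
    rw [cs.wordProd_cons, map_mul]
    change (dihedralHom cs hst (cs.simple i) (dihedralHom cs hst (cs.wordProd ω) 0) : ℤ).natAbs ≤ _
    generalize (dihedralHom cs hst (cs.wordProd ω) (0 : ℤ) : ℤ) = n at *
    rw [dihedralHom, liftInv_simple, List.length_cons]
    unfold dihedralAct
    split_ifs <;> omega

theorem natAbs_dihedralHom_altProd {s t : I} (hne : s ≠ t) (hst : ¬ Gr.Adj s t) (k : ℕ) :
    (∀ n : ℤ, n ≤ 0 → (dihedralHom cs hst (altProd (cs.simple t) (cs.simple s) k)⁻¹ n : ℤ).natAbs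
      = n.natAbs + k) ∧
    (∀ n : ℤ, 0 ≤ n → (dihedralHom cs hst (altProd (cs.simple s) (cs.simple t) k)⁻¹ n : ℤ).natAbs
      = n.natAbs + k) := by
  induction k with
  | zero => simp [altProd, Function.End.one_def]
  | succ k ih =>
    constructor
    · intro n hn
      rw [altProd, mul_inv_rev, cs.inv_simple, map_mul]
      change (dihedralHom cs hst (altProd _ _ k)⁻¹ (dihedralHom cs hst (cs.simple t) n)).natAbs = _
      have : dihedralHom cs hst (cs.simple t) n = 1 - n := by
        rw [dihedralHom, liftInv_simple]; simp [dihedralAct, hne.symm]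
      rw [this, ih.2 _ (by omega)]; omega
    · intro n hn
      rw [altProd, mul_inv_rev, cs.inv_simple, map_mul]
      change (dihedralHom cs hst (altProd _ _ k)⁻¹ (dihedralHom cs hst (cs.simple s) n)).natAbs = _
      have : dihedralHom cs hst (cs.simple s) n = -1 - n := by
        rw [dihedralHom, liftInv_simple]; simp [dihedralAct]
      rw [this, ih.1 _ (by omega)]; omega

theorem exists_word_inv_altProd (s t : I) (k : ℕ) : ∃ ω : List I, ω.length = k ∧
    cs.wordProd ω = (altProd (cs.simple s) (cs.simple t) k)⁻¹ := by
  induction k generalizing s t with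
  | zero => exact ⟨[], rfl, by simp [altProd]⟩
  | succ k ih =>
    obtain ⟨ω, h1, h2⟩ := ih t s
    refine ⟨ω ++ [s], by simp [h1], ?_⟩
    rw [cs.wordProd_append, h2, altProd]; simp

theorem exchange_altProd_step {s t : I} (w : W) (hs : cs.IsRightDescent w s) (k : ℕ)
    (hθ : ∀ ω : List I, cs.wordProd ω = (altProd (cs.simple s) (cs.simple t) (k + 1))⁻¹ →
      k + 1 ≤ ω.length)
    (h : ∃ ω : List I, ω.length + k = cs.length w ∧
      w * altProd (cs.simple t) (cs.simple s) k = cs.wordProd ω) :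
    ∃ ω : List I, ω.length + (k + 1) = cs.length w ∧
      w * altProd (cs.simple s) (cs.simple t) (k + 1) = cs.wordProd ω := by
  obtain ⟨ω, h1, h2⟩ := h
  obtain ⟨α, h3, h4⟩ := exists_word_inv_altProd cs t s k
  have hw : w = cs.wordProd (ω ++ α) := by
    rw [cs.wordProd_append, ← h2, h4]; simp
  have hs' := hs
  rw [hw] at hs'
  obtain ⟨j, hj, h5⟩ := exchange cs hs'
  rw [← hw] at h5
  by_cases hjω : j < ω.length
  · refine ⟨ω.eraseIdx j, ?_, ?_⟩
    · rw [List.length_eraseIdx_of_lt hjω]; omega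
    · rw [List.eraseIdx_append_of_lt_length hjω, cs.wordProd_append, h4] at h5
      rw [altProd, ← mul_assoc, h5]; simp
  · exfalso
    rw [List.eraseIdx_append_of_length_le (not_lt.1 hjω), cs.wordProd_append, ← h2] at h5
    have h6 := hθ (α.eraseIdx (j - ω.length)) (by
      rw [altProd, mul_inv_rev, cs.inv_simple, eq_inv_mul_iff_mul_eq]
      rw [mul_assoc, mul_left_cancel_iff] at h5
      exact h5.symm)
    rw [List.length_append] at hj
    rw [List.length_eraseIdx_of_lt (by omega)] at h6
    omega

/-- Distinct right descents of an element commute. -/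
theorem adj_of_isRightDescent {w : W} {s t : I} (hne : s ≠ t) (hs : cs.IsRightDescent w s)
    (ht : cs.IsRightDescent w t) : Gr.Adj s t := by
  by_contra hst
  have key : ∀ k : ℕ,
      (∃ ω : List I, ω.length + k = cs.length w ∧
        w * altProd (cs.simple t) (cs.simple s) k = cs.wordProd ω) ∧
      (∃ ω : List I, ω.length + k = cs.length w ∧
        w * altProd (cs.simple s) (cs.simple t) k = cs.wordProd ω) := by
    intro k
    induction k with
    | zero =>
      obtain ⟨ω, h1, h2⟩ := cs.exists_isReduced w
      have : ω.length = cs.length w := by rw [h2]; exact h1.eq.symm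
      exact ⟨⟨ω, by simpa using this, by simpa [altProd] using h2⟩,
        ⟨ω, by simpa using this, by simpa [altProd] using h2⟩⟩
    | succ k ih =>
      have hd := natAbs_dihedralHom_altProd cs hne hst (k + 1)
      refine ⟨exchange_altProd_step cs w ht k ?_ ih.2, exchange_altProd_step cs w hs k ?_ ih.1⟩
      · intro ω hω
        have h1 := natAbs_dihedralHom_le cs hst ω
        have h2 := hd.1 0 le_rfl
        rw [hω, h2] at h1
        simpa using h1
      · intro ω hω
        have h1 := natAbs_dihedralHom_le cs hst ω
        have h2 := hd.2 0 le_rfl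
        rw [hω, h2] at h1
        simpa using h1
  obtain ⟨ω, h1, -⟩ := (key (cs.length w + 1)).1
  omega

end

section

variable {I W : Type*} [Group W] {Gr : SimpleGraph I} (cs : CoxeterSystem (coxMatrix Gr) W)

/-- The standard parabolic subgroup generated by a set of simple reflections. -/
def par (S : Set I) : Subgroup W := Subgroup.closure (cs.simple '' S)

open Classical in
/-- The retraction onto a standard parabolic subgroup. -/
noncomputable def retr (S : Set I) : W →* W :=
  liftInv cs (fun i => if i ∈ S then cs.simple i else 1)
    (fun i => by split_ifs <;> simp)
    (fun i j h => by split_ifs <;> simp [simple_comm cs h])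

open Classical in
theorem retr_simple (S : Set I) (i : I) :
    retr cs S (cs.simple i) = if i ∈ S then cs.simple i else 1 := by
  simp [retr]

theorem retr_simple_of_mem {S : Set I} {i : I} (h : i ∈ S) :
    retr cs S (cs.simple i) = cs.simple i := by simp [retr_simple, h]

theorem retr_simple_of_notMem {S : Set I} {i : I} (h : i ∉ S) :
    retr cs S (cs.simple i) = 1 := by simp [retr_simple, h]

theorem simple_mem_par {S : Set I} {i : I} (h : i ∈ S) : cs.simple i ∈ par cs S :=
  Subgroup.subset_closure ⟨i, h, rfl⟩

theorem par_mono {S T : Set I} (h : S ⊆ T) : par cs S ≤ par cs T :=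
  Subgroup.closure_mono (Set.image_mono h)

theorem wordProd_mem_par {S : Set I} {ω : List I} (h : ∀ i ∈ ω, i ∈ S) :
    cs.wordProd ω ∈ par cs S := by
  induction ω with
  | nil => simp [one_mem]
  | cons i ω ih =>
    rw [cs.wordProd_cons]
    exact mul_mem (simple_mem_par cs (h i (by simp))) (ih fun j hj => h j (by simp [hj]))

open Classical in
theorem retr_wordProd (S : Set I) (ω : List I) :
    retr cs S (cs.wordProd ω) = cs.wordProd (ω.filter (· ∈ S)) := by
  induction ω with
  | nil => simp
  | cons i ω ih =>
    rw [cs.wordProd_cons, map_mul, ih, retr_simple, List.filter_cons]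
    by_cases h : i ∈ S <;> simp [h, cs.wordProd_cons]

theorem retr_mem_par (S : Set I) (x : W) : retr cs S x ∈ par cs S := by
  classical
  obtain ⟨ω, rfl⟩ := cs.wordProd_surjective x
  rw [retr_wordProd]
  exact wordProd_mem_par cs (by simp)

theorem retr_of_mem {S : Set I} {x : W} (h : x ∈ par cs S) : retr cs S x = x := by
  have : par cs S ≤ (retr cs S).eqLocus (MonoidHom.id W) := by
    rw [par, Subgroup.closure_le]
    rintro _ ⟨i, hi, rfl⟩
    exact retr_simple_of_mem cs hi
  exact this h

theorem mem_par_iff {S : Set I} {x : W} : x ∈ par cs S ↔ retr cs S x = x :=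
  ⟨retr_of_mem cs, fun h => h ▸ retr_mem_par cs S x⟩

theorem retr_retr (S T : Set I) (x : W) : retr cs S (retr cs T x) = retr cs (S ∩ T) x := by
  have : (retr cs S).comp (retr cs T) = retr cs (S ∩ T) := by
    apply cs.ext_simple
    intro i
    simp only [MonoidHom.comp_apply, retr_simple, Set.mem_inter_iff]
    by_cases h : i ∈ T <;> by_cases h' : i ∈ S <;> simp [h, h', retr_simple]
  exact DFunLike.congr_fun this x

theorem par_inf (S T : Set I) : par cs S ⊓ par cs T = par cs (S ∩ T) := by
  apply le_antisymm
  · rintro x ⟨h1, h2⟩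
    rw [mem_par_iff, ← retr_retr, retr_of_mem cs h2, retr_of_mem cs h1]
  · exact le_inf (par_mono cs Set.inter_subset_left) (par_mono cs Set.inter_subset_right)

theorem retr_mem_par_of_mem {S T : Set I} {x : W} (h : x ∈ par cs T) :
    retr cs S x ∈ par cs (S ∩ T) := by
  rw [← retr_of_mem cs h, retr_retr]
  exact retr_mem_par cs _ x

theorem retr_empty (x : W) : retr cs ∅ x = 1 := by
  classical
  obtain ⟨ω, rfl⟩ := cs.wordProd_surjective x
  simp [retr_wordProd]

theorem retr_univ (x : W) : retr cs Set.univ x = x := by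
  classical
  obtain ⟨ω, rfl⟩ := cs.wordProd_surjective x
  simp [retr_wordProd]

theorem simple_ne_one (i : I) : cs.simple i ≠ 1 := by
  rw [Ne, ← cs.length_eq_zero_iff, cs.length_simple]; simp

theorem simple_ne {i j : I} (h : i ≠ j) : cs.simple i ≠ cs.simple j := by
  intro h'
  have := congrArg (retr cs {i}) h'
  rw [retr_simple_of_mem cs (Set.mem_singleton i), retr_simple_of_notMem cs (by simpa using h.symm)] at this
  exact simple_ne_one cs i this

theorem mem_of_mem_word {S : Set I} {ω : List I} (h : cs.IsReduced ω)
    (h' : cs.wordProd ω ∈ par cs S) {i : I} (hi : i ∈ ω) : i ∈ S := by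
  classical
  have h1 := retr_of_mem cs h'
  rw [retr_wordProd] at h1
  have h2 := cs.length_wordProd_le (ω.filter (· ∈ S))
  rw [h1, h.eq] at h2
  have h3 : ω.filter (· ∈ S) = ω := List.filter_sublist.eq_of_length_le h2
  rw [List.filter_eq_self] at h3
  simpa using h3 i hi

theorem commute_of_mem_par {S T : Set I} (h : ∀ s ∈ S, ∀ t ∈ T, Gr.Adj s t) {x y : W}
    (hx : x ∈ par cs S) (hy : y ∈ par cs T) : Commute x y := by
  have h1 : ∀ s ∈ S, ∀ y ∈ par cs T, Commute (cs.simple s) y := by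
    intro s hs y hy
    have : par cs T ≤ Subgroup.centralizer {cs.simple s} := by
      rw [par, Subgroup.closure_le]
      rintro _ ⟨t, ht, rfl⟩
      simp only [SetLike.mem_coe, Subgroup.mem_centralizer_singleton_iff]
      exact simple_comm cs (h s hs t ht).symm
    have := Subgroup.mem_centralizer_singleton_iff.1 (this hy)
    exact this.symm
  have : par cs S ≤ Subgroup.centralizer {y} := by
    rw [par, Subgroup.closure_le]
    rintro _ ⟨t, ht, rfl⟩
    simp only [SetLike.mem_coe, Subgroup.mem_centralizer_singleton_iff]
    exact h1 t ht y hy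
  exact Subgroup.mem_centralizer_singleton_iff.1 (this hx)

/-- The support of an element: the letters of any reduced word. -/
def supp (x : W) : Set I := {i | ∀ S, x ∈ par cs S → i ∈ S}

theorem supp_wordProd {ω : List I} (h : cs.IsReduced ω) :
    supp cs (cs.wordProd ω) = {i | i ∈ ω} := by
  ext i
  exact ⟨fun hi => hi _ (wordProd_mem_par cs fun j hj => hj),
    fun hi S hS => mem_of_mem_word cs h hS hi⟩

theorem mem_par_iff_supp_subset {S : Set I} {x : W} : x ∈ par cs S ↔ supp cs x ⊆ S := by
  constructor
  · intro h i hi; exact hi S h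
  · intro h
    obtain ⟨ω, hω, rfl⟩ := cs.exists_isReduced x
    rw [supp_wordProd cs hω] at h
    exact wordProd_mem_par cs fun j hj => h hj

theorem mem_par_supp (x : W) : x ∈ par cs (supp cs x) := (mem_par_iff_supp_subset cs).2 le_rfl

theorem mem_par_univ (x : W) : x ∈ par cs Set.univ :=
  (mem_par_iff_supp_subset cs).2 (Set.subset_univ _)

theorem supp_eq_empty_iff {x : W} : supp cs x = ∅ ↔ x = 1 := by
  rw [← Set.subset_empty_iff, ← mem_par_iff_supp_subset, par, Set.image_empty,
    Subgroup.closure_empty, Subgroup.mem_bot]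

theorem supp_mul_subset (x y : W) : supp cs (x * y) ⊆ supp cs x ∪ supp cs y := by
  rw [← mem_par_iff_supp_subset]
  exact mul_mem (par_mono cs Set.subset_union_left (mem_par_supp cs x))
    (par_mono cs Set.subset_union_right (mem_par_supp cs y))

theorem supp_inv (x : W) : supp cs x⁻¹ = supp cs x := by
  ext i; simp [supp]

theorem mem_supp_of_isRightDescent {w : W} {i : I} (h : cs.IsRightDescent w i) :
    i ∈ supp cs w := by
  obtain ⟨ω, hω, h1⟩ := cs.exists_isReduced (w * cs.simple i)
  have h2 : w = cs.wordProd (ω ++ [i]) := by rw [cs.wordProd_append, ← h1]; simp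
  have h3 : cs.IsReduced (ω ++ [i]) := by
    have h4 := cs.isRightDescent_iff.1 h
    unfold CoxeterSystem.IsReduced
    rw [← h2, List.length_append, ← h4, h1, hω.eq]; simp
  rw [h2, supp_wordProd cs h3]; simp

/-- Distinct right descents do not interfere. -/
theorem isRightDescent_mul_simple {w : W} {s t : I} (hne : s ≠ t) (hs : cs.IsRightDescent w s)
    (ht : cs.IsRightDescent w t) : cs.IsRightDescent (w * cs.simple s) t := by
  have hadj := adj_of_isRightDescent cs hne hs ht
  obtain ⟨ω, hω, h1⟩ := cs.exists_isReduced (w * cs.simple s)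
  have h2 : w = cs.wordProd (ω ++ [s]) := by rw [cs.wordProd_append, ← h1]; simp
  have ht' := ht
  rw [h2] at ht'
  obtain ⟨j, hj, h3⟩ := exchange cs ht'
  rw [← h2] at h3
  by_cases hjω : j < ω.length
  · rw [List.eraseIdx_append_of_lt_length hjω, cs.wordProd_append] at h3
    have h4 : w * cs.simple s * cs.simple t = cs.wordProd (ω.eraseIdx j) := by
      rw [mul_assoc, simple_comm cs hadj, ← mul_assoc, h3]; simp
    have h5 := cs.length_wordProd_le (ω.eraseIdx j)
    rw [← h4, List.length_eraseIdx_of_lt hjω] at h5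
    have h6 := hω.eq
    rw [← h1] at h6
    unfold CoxeterSystem.IsRightDescent
    omega
  · exfalso
    simp only [List.length_append, List.length_singleton] at hj
    rw [List.eraseIdx_append_of_length_le (not_lt.1 hjω)] at h3
    have : j - ω.length = 0 := by omega
    rw [this] at h3
    simp only [List.eraseIdx_zero, List.tail_cons, List.append_nil, ← h1] at h3
    exact simple_ne cs hne.symm (mul_left_cancel h3)

theorem isRightDescent_mul_simple_iff {w : W} {s t : I} (hst : Gr.Adj s t) :
    cs.IsRightDescent (w * cs.simple s) t ↔ cs.IsRightDescent w t := by
  have key : ∀ w : W, cs.IsRightDescent w t → cs.IsRightDescent (w * cs.simple s) t := by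
    intro w ht
    by_cases hs : cs.IsRightDescent w s
    · exact isRightDescent_mul_simple cs hst.ne hs ht
    · rw [cs.not_isRightDescent_iff] at hs
      have h1 := cs.isRightDescent_iff.1 ht
      have h2 := cs.length_mul_le (w * cs.simple t) (cs.simple s)
      unfold CoxeterSystem.IsRightDescent
      rw [mul_assoc, simple_comm cs hst, ← mul_assoc]
      rw [cs.length_simple] at h2
      omega
  refine ⟨fun h => ?_, key w⟩
  simpa using key _ h

theorem isLeftDescent_simple_mul_iff {w : W} {s t : I} (hst : Gr.Adj s t) :
    cs.IsLeftDescent (cs.simple s * w) t ↔ cs.IsLeftDescent w t := by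
  rw [← cs.isRightDescent_inv_iff, ← cs.isRightDescent_inv_iff, mul_inv_rev, cs.inv_simple,
    isRightDescent_mul_simple_iff cs hst]

theorem IsReduced.isRightDescent {ω : List I} {a : I} (h : cs.IsReduced (ω ++ [a])) :
    cs.IsRightDescent (cs.wordProd (ω ++ [a])) a := by
  unfold CoxeterSystem.IsRightDescent
  rw [h.eq, cs.wordProd_append]
  simp only [cs.wordProd_singleton, cs.simple_mul_simple_cancel_right, List.length_append]
  have := cs.length_wordProd_le ω
  simp only [List.length_singleton]
  omega

theorem descent_of_product {v : W} {ω : List I} {r : I}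
    (hl : cs.length (v * cs.wordProd ω) = cs.length v + ω.length)
    (h : cs.IsRightDescent (v * cs.wordProd ω) r) (h' : ¬ cs.IsRightDescent (cs.wordProd ω) r) :
    (∀ a ∈ ω, Gr.Adj r a) ∧ cs.IsRightDescent v r := by
  induction ω using List.reverseRecOn with
  | nil => simpa using h
  | append_singleton ω a ih =>
    have hb := cs.length_mul_le v (cs.wordProd (ω ++ [a]))
    have hr : cs.IsReduced (ω ++ [a]) := by
      have := cs.length_wordProd_le (ω ++ [a])
      unfold CoxeterSystem.IsReduced
      omega
    have ha := IsReduced.isRightDescent cs hr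
    have hra : r ≠ a := by rintro rfl; exact h' ha
    have h1 : v * cs.wordProd (ω ++ [a]) = v * cs.wordProd ω * cs.simple a := by
      rw [cs.wordProd_append, mul_assoc]; simp
    have h2 : cs.length (v * cs.wordProd ω) = cs.length v + ω.length := by
      have h3 := cs.length_mul_le v (cs.wordProd ω)
      have h4 := cs.length_wordProd_le ω
      have h5 := cs.length_mul_le (v * cs.wordProd ω) (cs.simple a)
      rw [cs.length_simple, ← h1, hl] at h5
      simp only [List.length_append, List.length_singleton] at h5
      omega
    have h3 : cs.IsRightDescent (v * cs.wordProd (ω ++ [a])) a := by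
      unfold CoxeterSystem.IsRightDescent
      rw [hl, h1, cs.simple_mul_simple_cancel_right, h2, List.length_append]
      simp
    have hadj := adj_of_isRightDescent cs hra h h3
    have h4 : cs.wordProd (ω ++ [a]) = cs.wordProd ω * cs.simple a := by simp [cs.wordProd_append]
    rw [h4, isRightDescent_mul_simple_iff cs hadj.symm] at h'
    rw [h1, isRightDescent_mul_simple_iff cs hadj.symm] at h
    obtain ⟨h5, h6⟩ := ih h2 h h'
    refine ⟨?_, h6⟩
    intro b hb
    rcases List.mem_append.1 hb with hb | hb
    · exact h5 b hb
    · rw [List.mem_singleton.1 hb]; exact hadj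

theorem descent_of_product' {v u : W} {r : I}
    (hl : cs.length (v * u) = cs.length v + cs.length u)
    (h : cs.IsRightDescent (v * u) r) (h' : ¬ cs.IsRightDescent u r) :
    (∀ a ∈ supp cs u, Gr.Adj r a) ∧ cs.IsRightDescent v r := by
  obtain ⟨ω, hω, rfl⟩ := cs.exists_isReduced u
  rw [supp_wordProd cs hω]
  exact descent_of_product cs (by rw [hl, hω.eq]) h h'

theorem simple_commute_of_adj_supp {u : W} {r : I} (h : ∀ a ∈ supp cs u, Gr.Adj r a) :
    Commute (cs.simple r) u :=
  commute_of_mem_par cs (S := {r}) (T := supp cs u) (by simpa using h)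
    (simple_mem_par cs rfl) (mem_par_supp cs u)

/-- Lengths add up when no letter cancels. -/
theorem length_mul_of_disjoint {x y : W}
    (h : ∀ s, cs.IsRightDescent x s → ¬ cs.IsLeftDescent y s) :
    cs.length (x * y) = cs.length x + cs.length y := by
  obtain ⟨ω, hω, rfl⟩ := cs.exists_isReduced y
  induction ω using List.reverseRecOn with
  | nil => simp
  | append_singleton ω b ih =>
    have hω' : cs.IsReduced ω := by
      have := hω.take ω.length
      simpa using this
    have h4 : cs.wordProd (ω ++ [b]) = cs.wordProd ω * cs.simple b := by simp [cs.wordProd_append]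
    have hlen : cs.length (cs.wordProd (ω ++ [b])) = cs.length (cs.wordProd ω) + 1 := by
      rw [hω.eq, hω'.eq]; simp
    have ih' := ih hω' (by
      intro s hs hs'
      refine h s hs ?_
      unfold CoxeterSystem.IsLeftDescent at hs' ⊢
      rw [hlen, h4, ← mul_assoc]
      have := cs.length_mul_le (cs.simple s * cs.wordProd ω) (cs.simple b)
      rw [cs.length_simple] at this
      omega)
    by_cases hb : cs.IsRightDescent (x * cs.wordProd ω) b
    · exfalso
      have hb' : ¬ cs.IsRightDescent (cs.wordProd ω) b := by
        rw [cs.not_isRightDescent_iff, ← h4, hlen]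
      obtain ⟨h5, h6⟩ := descent_of_product' cs ih' hb hb'
      refine h b h6 ?_
      have := simple_commute_of_adj_supp cs h5
      unfold CoxeterSystem.IsLeftDescent
      rw [hlen, h4, ← this.eq]
      simp
    · rw [cs.not_isRightDescent_iff] at hb
      rw [hlen, h4, ← mul_assoc, hb, ih']; ring

end

section

variable {I W : Type*} [Group W] {Gr : SimpleGraph I} (cs : CoxeterSystem (coxMatrix Gr) W)

theorem supp_mul_of_length {x y : W} (h : cs.length (x * y) = cs.length x + cs.length y) :
    supp cs (x * y) = supp cs x ∪ supp cs y := by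
  obtain ⟨α, hα, rfl⟩ := cs.exists_isReduced x
  obtain ⟨β, hβ, rfl⟩ := cs.exists_isReduced y
  have : cs.IsReduced (α ++ β) := by
    unfold CoxeterSystem.IsReduced
    rw [cs.wordProd_append, h, hα.eq, hβ.eq, List.length_append]
  rw [← cs.wordProd_append, supp_wordProd cs this, supp_wordProd cs hα, supp_wordProd cs hβ]
  ext i; simp

theorem supp_simple_subset (i : I) : supp cs (cs.simple i) ⊆ {i} :=
  (mem_par_iff_supp_subset cs).1 (simple_mem_par cs rfl)

theorem supp_pow_subset (f : W) (n : ℕ) : supp cs (f ^ n) ⊆ supp cs f :=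
  (mem_par_iff_supp_subset cs).1 (pow_mem (mem_par_supp cs f) n)

/-- Elements without isolated letters in the support which cannot be shortened by conjugating with
a simple reflection. -/
structure CycMin (f : W) : Prop where
  exists_not_adj : ∀ s ∈ supp cs f, ∃ t ∈ supp cs f, t ≠ s ∧ ¬ Gr.Adj s t
  length_le : ∀ s, cs.length f ≤ cs.length (cs.simple s * f * cs.simple s)

variable {cs} {f : W}

theorem CycMin.not_isLeftDescent (hf : CycMin cs f) {s : I} (hs : cs.IsRightDescent f s) :
    ¬ cs.IsLeftDescent f s := by
  intro hs'
  have h1 := cs.isLeftDescent_iff.1 hs'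
  have h2 : cs.simple s * (cs.simple s * f) = f := by simp
  by_cases h3 : cs.IsRightDescent (cs.simple s * f) s
  · have := hf.length_le s
    unfold CoxeterSystem.IsRightDescent at h3
    omega
  · have h4 := descent_of_product' cs (v := cs.simple s) (u := cs.simple s * f) (r := s)
      (by rw [h2, cs.length_simple]; omega) (by rwa [h2]) h3
    obtain ⟨t, ht, hne, hadj⟩ := hf.exists_not_adj s (mem_supp_of_isRightDescent cs hs)
    rw [← h2] at ht
    rcases supp_mul_subset cs _ _ ht with h5 | h5
    · exact hne (supp_simple_subset cs s h5)
    · exact hadj (h4.1 t h5)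

theorem isRightDescent_of_mul {v : W} {r : I}
    (hl : cs.length (v * f) = cs.length v + cs.length f) (hv : supp cs v ⊆ supp cs f)
    (h : cs.IsRightDescent (v * f) r) : cs.IsRightDescent f r := by
  by_contra h'
  obtain ⟨h1, h2⟩ := descent_of_product' cs hl h h'
  exact Gr.irrefl (h1 r (hv (mem_supp_of_isRightDescent cs h2)))

theorem CycMin.length_pow_aux (hf : CycMin cs f) (n : ℕ) :
    cs.length (f ^ n) = n * cs.length f ∧
      ∀ r, cs.IsRightDescent (f ^ n) r → cs.IsRightDescent f r := by
  induction n with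
  | zero => simpa using fun r h => absurd h (cs.not_isRightDescent_one r)
  | succ n ih =>
    have h1 : cs.length (f ^ n * f) = cs.length (f ^ n) + cs.length f :=
      length_mul_of_disjoint cs fun s hs => hf.not_isLeftDescent (ih.2 s hs)
    rw [pow_succ]
    refine ⟨by rw [h1, ih.1]; ring, fun r hr => ?_⟩
    exact isRightDescent_of_mul h1 (supp_pow_subset cs f n) hr

theorem CycMin.length_pow (hf : CycMin cs f) (n : ℕ) : cs.length (f ^ n) = n * cs.length f :=
  (hf.length_pow_aux n).1

theorem CycMin.length_zpow (hf : CycMin cs f) (a : ℤ) :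
    cs.length (f ^ a) = a.natAbs * cs.length f := by
  rcases Int.natAbs_eq a with h | h
  · nth_rewrite 1 [h]
    rw [zpow_natCast, hf.length_pow]
  · nth_rewrite 1 [h]
    rw [zpow_neg, cs.length_inv, zpow_natCast, hf.length_pow]

theorem CycMin.supp_pow (hf : CycMin cs f) {n : ℕ} (hn : n ≠ 0) : supp cs (f ^ n) = supp cs f := by
  obtain ⟨n, rfl⟩ := Nat.exists_eq_succ_of_ne_zero hn
  apply (supp_pow_subset cs f _).antisymm
  rw [Nat.succ_eq_add_one, pow_succ, supp_mul_of_length]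
  · exact Set.subset_union_right
  · rw [← pow_succ, hf.length_pow, hf.length_pow]; ring

theorem CycMin.supp_zpow (hf : CycMin cs f) {a : ℤ} (ha : a ≠ 0) :
    supp cs (f ^ a) = supp cs f := by
  rcases Int.natAbs_eq a with h | h
  · rw [h, zpow_natCast, hf.supp_pow (by omega)]
  · rw [h, zpow_neg, supp_inv, zpow_natCast, hf.supp_pow (by omega)]

/-- Translation lengths are not decreased by conjugation. -/
theorem CycMin.length_conj_zpow (hf : CycMin cs f) (z : W) (a : ℤ) :
    a.natAbs * cs.length f ≤ cs.length (z * f ^ a * z⁻¹) := by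
  have h1 : ∀ n : ℕ, n * (a.natAbs * cs.length f) ≤
      n * cs.length (z * f ^ a * z⁻¹) + 2 * cs.length z := by
    intro n
    have h2 : cs.length ((z * f ^ a * z⁻¹) ^ n) ≤ n * cs.length (z * f ^ a * z⁻¹) := by
      induction n with
      | zero => simp
      | succ n ih =>
        rw [pow_succ]
        have := cs.length_mul_le ((z * f ^ a * z⁻¹) ^ n) (z * f ^ a * z⁻¹)
        linarith
    have h3 : f ^ (a * n) = z⁻¹ * (z * f ^ a * z⁻¹) ^ n * z := by
      rw [conj_pow, zpow_mul, zpow_natCast]; group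
    have h4 := hf.length_zpow (a * n)
    rw [h3, Int.natAbs_mul, Int.natAbs_natCast] at h4
    have h5 := cs.length_mul_le (z⁻¹ * (z * f ^ a * z⁻¹) ^ n) z
    have h6 := cs.length_mul_le z⁻¹ ((z * f ^ a * z⁻¹) ^ n)
    rw [cs.length_inv] at h6
    calc n * (a.natAbs * cs.length f) = a.natAbs * n * cs.length f := by ring
      _ ≤ _ := by rw [← h4]; linarith
  by_contra! h
  have := h1 (2 * cs.length z + 1)
  nlinarith

end

section

variable {I W : Type*} [Group W] {Gr : SimpleGraph I} (cs : CoxeterSystem (coxMatrix Gr) W)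

theorem retr_mul_retr_compl {S T : Set I} (h : ∀ s ∈ S ∩ T, ∀ t ∈ T \ S, Gr.Adj s t) {x : W}
    (hx : x ∈ par cs T) : retr cs S x * retr cs Sᶜ x = x := by
  obtain ⟨ω, hω, rfl⟩ := cs.exists_isReduced x
  have hT : ∀ i ∈ ω, i ∈ T := fun i hi => mem_of_mem_word cs hω hx hi
  clear hω hx
  induction ω with
  | nil => simp
  | cons i ω ih =>
    have ih' := ih fun j hj => hT j (by simp [hj])
    rw [cs.wordProd_cons, map_mul, map_mul]
    by_cases hi : i ∈ S
    · rw [retr_simple_of_mem cs hi, retr_simple_of_notMem cs (by simpa using hi), one_mul,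
        mul_assoc, ih']
    · rw [retr_simple_of_notMem cs hi, retr_simple_of_mem cs (S := Sᶜ) (by simpa using hi), one_mul,
        ← mul_assoc]
      have hc : Commute (retr cs S (cs.wordProd ω)) (cs.simple i) := by
        refine commute_of_mem_par cs (S := S ∩ T) (T := {i}) ?_
          (retr_mem_par_of_mem cs (wordProd_mem_par cs fun j hj => hT j (by simp [hj])))
          (simple_mem_par cs rfl)
        intro s hs t ht
        rw [Set.mem_singleton_iff.1 ht]
        exact h s hs i ⟨hT i (by simp), hi⟩
      rw [hc.eq, mul_assoc, ih']

/-- A colouring of the letters such that letters of `T` of different colours commute. -/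
def Sep {β : Type*} (Gr : SimpleGraph I) (cl : I → β) (T : Set I) : Prop :=
  ∀ s ∈ T, ∀ t ∈ T, cl s ≠ cl t → Gr.Adj s t

/-- The component of an element of the given colour. -/
noncomputable abbrev comp {β : Type*} (cl : I → β) (b : β) : W →* W := retr cs (cl ⁻¹' {b})

variable {β : Type*} {cl : I → β} {T : Set I}

variable {cs} in
theorem Sep.comp_mul_retr_compl (hT : Sep Gr cl T) {x : W} (hx : x ∈ par cs T) (b : β) :
    comp cs cl b x * retr cs (cl ⁻¹' {b})ᶜ x = x := by
  refine retr_mul_retr_compl cs ?_ hx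
  rintro s ⟨hs, hs'⟩ t ⟨ht, ht'⟩
  refine hT s hs' t ht ?_
  simp only [Set.mem_preimage, Set.mem_singleton_iff] at hs ht'
  rw [hs]; exact fun h => ht' h.symm

variable {cs} in
theorem Sep.length_le_sum_aux (hT : Sep Gr cl T) (B : Finset β) :
    ∀ x ∈ par cs (T ∩ cl ⁻¹' B), cs.length x ≤ ∑ b ∈ B, cs.length (comp cs cl b x) := by
  classical
  induction B using Finset.induction_on with
  | empty =>
    intro x hx
    simp only [Finset.coe_empty, Set.preimage_empty, Set.inter_empty] at hx
    rw [← retr_of_mem cs hx, retr_empty]; simp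
  | insert b B hb ih =>
    intro x hx
    rw [Finset.sum_insert hb]
    have h1 := hT.comp_mul_retr_compl (par_mono cs Set.inter_subset_left hx) b
    have h2 := cs.length_mul_le (comp cs cl b x) (retr cs (cl ⁻¹' {b})ᶜ x)
    rw [h1] at h2
    have h3 := ih (retr cs (cl ⁻¹' {b})ᶜ x) (by
      refine par_mono cs ?_ (retr_mem_par_of_mem cs hx)
      rintro i ⟨h4, h5, h6⟩
      refine ⟨h5, ?_⟩
      simpa [show cl i ≠ b from h4] using h6)
    have h4 : ∀ b' ∈ B, comp cs cl b' (retr cs (cl ⁻¹' {b})ᶜ x) = comp cs cl b' x := by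
      intro b' hb'
      rw [retr_retr]
      congr 2
      ext i
      simp only [Set.mem_inter_iff, Set.mem_preimage, Set.mem_singleton_iff, Set.mem_compl_iff,
        and_iff_left_iff_imp]
      rintro h5 rfl
      exact hb (h5 ▸ hb')
    rw [Finset.sum_congr rfl fun b' hb' => by rw [h4 b' hb']] at h3
    omega

theorem sum_filter_length_le [Fintype β] [DecidableEq β] (ω : List I) :
    ∑ b, (ω.filter (fun i => cl i = b)).length = ω.length := by
  induction ω with
  | nil => simp
  | cons i ω ih =>
    simp only [List.filter_cons, List.length_cons, ← ih]
    have : ∀ b, (if decide (cl i = b) = true then i :: List.filter (fun i => decide (cl i = b)) ω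
        else List.filter (fun i => decide (cl i = b)) ω).length =
        (List.filter (fun i => decide (cl i = b)) ω).length + if cl i = b then 1 else 0 := by
      intro b; by_cases h : cl i = b <;> simp [h]
    rw [Finset.sum_congr rfl fun b _ => this b, Finset.sum_add_distrib]
    simp

theorem sum_length_comp_le [Fintype β] (cl : I → β) (x : W) :
    ∑ b, cs.length (comp cs cl b x) ≤ cs.length x := by
  classical
  obtain ⟨ω, hω, rfl⟩ := cs.exists_isReduced x
  rw [hω.eq, ← sum_filter_length_le (cl := cl) ω]
  refine Finset.sum_le_sum fun b _ => ?_
  rw [retr_wordProd]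
  refine (cs.length_wordProd_le _).trans (le_of_eq ?_)
  congr 1

variable {cs} in
theorem Sep.length_eq_sum [Fintype β] (hT : Sep Gr cl T) {x : W} (hx : x ∈ par cs T) :
    cs.length x = ∑ b, cs.length (comp cs cl b x) :=
  le_antisymm (hT.length_le_sum_aux Finset.univ x (by simpa using hx)) (sum_length_comp_le cs cl x)

variable {cs} in
theorem Sep.ext [Fintype β] (hT : Sep Gr cl T) {x y : W} (hx : x ∈ par cs T) (hy : y ∈ par cs T)
    (h : ∀ b, comp cs cl b x = comp cs cl b y) : x = y := by
  rw [← inv_mul_eq_one, ← cs.length_eq_zero_iff,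
    hT.length_eq_sum (mul_mem (inv_mem hx) hy)]
  refine Finset.sum_eq_zero fun b _ => ?_
  rw [map_mul, map_inv, h b]; simp

end

section

variable {I W : Type*} [Group W] {Gr : SimpleGraph I} (cs : CoxeterSystem (coxMatrix Gr) W)

/-- `u` is a suffix of `w`, i.e. the end of a reduced word of `w`. -/
def Suf (w u : W) : Prop := cs.length (w * u⁻¹) + cs.length u = cs.length w

variable {cs}

theorem suf_mul_iff {x u : W} :
    Suf cs (x * u) u ↔ cs.length (x * u) = cs.length x + cs.length u := by
  simp [Suf, eq_comm]

theorem suf_simple_mul_simple_mul_iff {w u : W} {s t : I} (h : Gr.Adj s t) (hu : Suf cs w u) :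
    Suf cs w (cs.simple s * (cs.simple t * u)) ↔
      Suf cs w (cs.simple s * u) ∧ Suf cs w (cs.simple t * u) := by
  obtain ⟨v, rfl⟩ : ∃ v, w = v * u := ⟨w * u⁻¹, by simp⟩
  rw [suf_mul_iff] at hu
  have e1 : v * u * (cs.simple s * u)⁻¹ = v * cs.simple s := by simp
  have e2 : v * u * (cs.simple t * u)⁻¹ = v * cs.simple t := by simp
  have e3 : v * u * (cs.simple s * (cs.simple t * u))⁻¹ = v * cs.simple t * cs.simple s := by
    simp [mul_assoc]
  unfold Suf
  rw [e1, e2, e3]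
  have a1 := isRightDescent_mul_simple_iff cs (w := v) h.symm
  have a2 := isLeftDescent_simple_mul_iff cs (w := u) h.symm
  have b1 := cs.length_mul_simple v s
  have b2 := cs.length_mul_simple v t
  have b3 := cs.length_mul_simple (v * cs.simple t) s
  have b4 := cs.length_simple_mul u s
  have b5 := cs.length_simple_mul u t
  have b6 := cs.length_simple_mul (cs.simple t * u) s
  have c1 := cs.length_mul_le (v * cs.simple s) (cs.simple s * u)
  have c2 := cs.length_mul_le (v * cs.simple t) (cs.simple t * u)
  rw [mul_assoc, cs.simple_mul_simple_cancel_left] at c1 c2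
  unfold CoxeterSystem.IsRightDescent at a1
  unfold CoxeterSystem.IsLeftDescent at a2
  omega

theorem Suf.supp_subset {w u : W} (h : Suf cs w u) : supp cs u ⊆ supp cs w := by
  obtain ⟨v, rfl⟩ : ∃ v, w = v * u := ⟨w * u⁻¹, by simp⟩
  rw [suf_mul_iff] at h
  rw [supp_mul_of_length cs h]
  exact Set.subset_union_right

theorem Suf.mul_left {w u x : W} (h : Suf cs w u)
    (hl : cs.length (x * w) = cs.length x + cs.length w) : Suf cs (x * w) u := by
  unfold Suf at *
  have h1 := cs.length_mul_le (x * w * u⁻¹) u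
  have h2 := cs.length_mul_le x (w * u⁻¹)
  simp only [mul_assoc] at *
  simp only [inv_mul_cancel, mul_one] at h1
  omega

theorem Suf.mul_right {w u x : W} (h : Suf cs w u)
    (hl : cs.length (w * x) = cs.length w + cs.length x) : Suf cs (w * x) (u * x) := by
  unfold Suf at *
  have h1 := cs.length_mul_le u x
  have h2 := cs.length_mul_le (w * u⁻¹) (u * x)
  have e : w * x * (u * x)⁻¹ = w * u⁻¹ := by group
  have e2 : w * u⁻¹ * (u * x) = w * x := by group
  rw [e]
  rw [e2] at h2
  omega

variable (cs)

/-- One pass of stripping the letters of a word from the right of a factor of a product. -/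
theorem exists_pass (ω : List I) : ∀ z x u : W, x * u = z * cs.wordProd ω →
    cs.length (x * u) = cs.length x + cs.length u →
    cs.length (z * cs.wordProd ω) = cs.length z + ω.length →
    ∃ x' u' : W, x' * u' = z ∧ cs.length z = cs.length x' + cs.length u' ∧
      cs.length u ≤ cs.length u' + ω.length ∧ supp cs u' ⊆ supp cs u ∧
      (∀ r ∈ ω, r ∉ supp cs u → ∀ a ∈ supp cs u', Gr.Adj r a) ∧
      ((u = u' * cs.wordProd ω ∧ cs.length u = cs.length u' + ω.length) ∨
        ∃ r ∈ ω, ∀ a ∈ supp cs u', Gr.Adj r a) := by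
  induction ω using List.reverseRecOn with
  | nil =>
    intro z x u h1 h2 h3
    simp only [cs.wordProd_nil, mul_one] at h1
    exact ⟨x, u, h1, by rw [← h1, h2], by simp, le_rfl, by simp, by simp⟩
  | append_singleton ω r ih =>
    intro z x u h1 h2 h3
    have e : z * cs.wordProd (ω ++ [r]) = z * cs.wordProd ω * cs.simple r := by
      simp [cs.wordProd_append, mul_assoc]
    have h4 : cs.length (z * cs.wordProd ω) = cs.length z + ω.length := by
      have a1 := cs.length_mul_le z (cs.wordProd ω)
      have a2 := cs.length_wordProd_le ω
      have a3 := cs.length_mul_le (z * cs.wordProd ω) (cs.simple r)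
      rw [← e, h3, cs.length_simple] at a3
      simp only [List.length_append, List.length_singleton] at a3
      omega
    simp only [List.length_append, List.length_singleton] at h3
    have hr : cs.IsRightDescent (x * u) r := by
      unfold CoxeterSystem.IsRightDescent
      rw [h1, h3, e, cs.simple_mul_simple_cancel_right]
      omega
    rw [e] at h1 h3
    by_cases hu : cs.IsRightDescent u r
    · have hu1 := cs.isRightDescent_iff.1 hu
      have h5 : x * (u * cs.simple r) = z * cs.wordProd ω := by
        rw [← mul_assoc, h1, cs.simple_mul_simple_cancel_right]
      have h6 : cs.length (x * (u * cs.simple r)) = cs.length x + cs.length (u * cs.simple r) := by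
        rw [h5]
        rw [h1] at h2
        omega
      obtain ⟨x', u', k1, k2, k3, k4, k5, k6⟩ := ih z x _ h5 h6 h4
      have hsub : supp cs (u * cs.simple r) ⊆ supp cs u := by
        refine (supp_mul_subset cs _ _).trans (Set.union_subset le_rfl ?_)
        exact (supp_simple_subset cs r).trans
          (Set.singleton_subset_iff.2 (mem_supp_of_isRightDescent cs hu))
      refine ⟨x', u', k1, k2, by simp; omega, k4.trans hsub, ?_, ?_⟩
      · intro a ha ha'
        rcases List.mem_append.1 ha with ha | ha
        · exact k5 a ha fun h => ha' (hsub h)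
        · rw [List.mem_singleton.1 ha] at ha'
          exact absurd (mem_supp_of_isRightDescent cs hu) ha'
      · rcases k6 with ⟨k6, k7⟩ | ⟨a, ha, k6⟩
        · left
          refine ⟨?_, by simp; omega⟩
          rw [cs.wordProd_append, ← mul_assoc, ← k6]; simp
        · exact Or.inr ⟨a, by simp [ha], k6⟩
    · obtain ⟨h5, h6⟩ := descent_of_product' cs h2 hr hu
      have hc := simple_commute_of_adj_supp cs h5
      have h7 : x * cs.simple r * u = z * cs.wordProd ω := by
        rw [mul_assoc, hc.eq, ← mul_assoc, h1, cs.simple_mul_simple_cancel_right]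
      have h8 := cs.isRightDescent_iff.1 h6
      obtain ⟨x', u', k1, k2, k3, k4, k5, k6⟩ := ih z _ _ h7 (by
        rw [h7]; rw [h1] at h2; omega) h4
      refine ⟨x', u', k1, k2, by simp; omega, k4, ?_, Or.inr ⟨r, by simp, fun a ha => h5 a (k4 ha)⟩⟩
      intro a ha ha'
      rcases List.mem_append.1 ha with ha | ha
      · exact k5 a ha ha'
      · rw [List.mem_singleton.1 ha]
        exact fun b hb => h5 b (k4 hb)

/-- The graph of non-commuting letters in a set. -/
def nonAdj (Gr : SimpleGraph I) (T : Set I) : SimpleGraph I where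
  Adj s t := s ≠ t ∧ ¬ Gr.Adj s t ∧ s ∈ T ∧ t ∈ T
  symm := ⟨fun _ _ ⟨h1, h2, h3, h4⟩ => ⟨h1.symm, fun h => h2 h.symm, h4, h3⟩⟩
  loopless := ⟨fun _ h => h.1 rfl⟩

variable {cs}

theorem exists_nonAdj_of_ssubset {P S : Set I}
    (hP : ∀ s ∈ P, ∀ t ∈ P, (nonAdj Gr P).Reachable s t) (hS : S ⊆ P) (hne : S ≠ P)
    (hS0 : S.Nonempty) : ∃ r ∈ P \ S, ∃ a ∈ S, ¬ Gr.Adj r a := by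
  by_contra! h
  obtain ⟨s, hs⟩ := hS0
  apply hne
  apply hS.antisymm
  intro t ht
  obtain ⟨p⟩ := hP s (hS hs) t ht
  clear ht
  induction p with
  | nil => exact hs
  | cons hadj p ih =>
    refine ih ?_
    by_contra h'
    exact hadj.2.1 (h _ ⟨hadj.2.2.2, h'⟩ _ hs).symm

theorem CycMin.length_mul_pow {f : W} (hf : CycMin cs f) (m : ℕ) :
    cs.length (f ^ m * f) = cs.length (f ^ m) + cs.length f := by
  rw [← pow_succ, hf.length_pow, hf.length_pow]; ring

theorem length_le_of_supp_ne [Finite I] {f : W} (hf : CycMin cs f)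
    (hP : ∀ s ∈ supp cs f, ∀ t ∈ supp cs f, (nonAdj Gr (supp cs f)).Reachable s t) (n : ℕ) :
    ∀ (u x : W) (m : ℕ), x * u = f ^ m → cs.length (x * u) = cs.length x + cs.length u →
      supp cs u ⊆ supp cs f → supp cs u ≠ supp cs f → (supp cs u).ncard ≤ n →
      cs.length u ≤ n * cs.length f := by
  induction n with
  | zero =>
    intro u x m h1 h2 h3 h4 h5
    rw [Nat.le_zero, Set.ncard_eq_zero, supp_eq_empty_iff] at h5
    simp [h5]
  | succ n ih =>
    intro u x m h1 h2 h3 h4 h5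
    by_cases hu : u = 1
    · simp [hu]
    obtain ⟨ω, hω, hf'⟩ := cs.exists_isReduced f
    have hl := hω.eq
    rw [← hf'] at hl
    obtain _ | m := m
    · exfalso
      rw [pow_zero] at h1
      rw [h1] at h2
      apply hu
      rw [← cs.length_eq_zero_iff]
      rw [cs.length_one] at h2
      omega
    obtain ⟨r, hr, a, ha, hra⟩ := exists_nonAdj_of_ssubset hP h3 h4
      (Set.nonempty_iff_ne_empty.2 fun h => hu ((supp_eq_empty_iff cs).1 h))
    rw [pow_succ] at h1
    nth_rewrite 2 [hf'] at h1
    obtain ⟨x', u', k1, k2, k3, k4, k5, -⟩ := exists_pass cs ω (f ^ m) x u h1 h2 (by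
      rw [← hf', hf.length_mul_pow, hl])
    have hr' : r ∈ ω := by
      have := hr.1
      rw [hf', supp_wordProd cs hω] at this
      exact this
    have hau : a ∉ supp cs u' := fun h => hra (k5 r hr' hr.2 a h)
    have hlt : (supp cs u').ncard < (supp cs u).ncard :=
      Set.ncard_lt_ncard ((Set.ssubset_iff_of_subset k4).2 ⟨a, ha, hau⟩) (Set.toFinite _)
    have := ih u' x' m k1 (by rw [k1, k2]) (k4.trans h3)
      (fun h => hau (h ▸ h3 ha)) (by omega)
    rw [add_mul, hl] at *
    omega

variable (cs) in
/-- The elements which become suffixes of a power of `f` after multiplication with a power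
of `f`. -/
def Stable (f y : W) : Prop := ∃ (n : ℤ) (m : ℕ), Suf cs (f ^ m) (y * f ^ n)

theorem CycMin.suf_add {f y : W} (hf : CycMin cs f) {n : ℤ} {m : ℕ}
    (h : Suf cs (f ^ m) (y * f ^ n)) (j k : ℕ) :
    Suf cs (f ^ (m + j + k)) (y * f ^ (n + k)) := by
  have h1 : Suf cs (f ^ (m + j)) (y * f ^ n) := by
    rw [add_comm, pow_add]
    refine h.mul_left ?_
    rw [← pow_add, hf.length_pow, hf.length_pow, hf.length_pow]; ring
  rw [pow_add _ (m + j), zpow_add, ← mul_assoc, zpow_natCast]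
  refine h1.mul_right ?_
  rw [← pow_add, hf.length_pow, hf.length_pow, hf.length_pow]; ring

theorem CycMin.suf_of_le {f y : W} (hf : CycMin cs f) {n : ℤ} {m : ℕ}
    (h : Suf cs (f ^ m) (y * f ^ n)) {n' : ℤ} {m' : ℕ} (hn : n ≤ n') (hm : m + (n' - n) ≤ m') :
    Suf cs (f ^ m') (y * f ^ n') := by
  have := hf.suf_add h (m' - m - (n' - n).toNat) (n' - n).toNat
  convert this using 2
  · omega
  · congr 1; omega

theorem CycMin.stable_simple_mul_simple_mul_iff {f y : W} (hf : CycMin cs f) {s t : I}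
    (h : Gr.Adj s t) (hy : Stable cs f y) :
    Stable cs f (cs.simple s * (cs.simple t * y)) ↔
      Stable cs f (cs.simple s * y) ∧ Stable cs f (cs.simple t * y) := by
  obtain ⟨n, m, h0⟩ := hy
  constructor
  · rintro ⟨n1, m1, h1⟩
    have a0 := hf.suf_of_le h0 (n' := max n n1) (m' := m + m1 + (max n n1 - min n n1).toNat)
      (le_max_left _ _) (by omega)
    have a1 := hf.suf_of_le h1 (n' := max n n1) (m' := m + m1 + (max n n1 - min n n1).toNat)
      (le_max_right _ _) (by omega)
    simp only [mul_assoc] at a1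
    have := (suf_simple_mul_simple_mul_iff h a0).1 a1
    simp only [← mul_assoc] at this
    exact ⟨⟨_, _, this.1⟩, ⟨_, _, this.2⟩⟩
  · rintro ⟨⟨n1, m1, h1⟩, ⟨n2, m2, h2⟩⟩
    have a0 := hf.suf_of_le h0 (n' := max n (max n1 n2))
      (m' := m + m1 + m2 + (max n (max n1 n2) - min n (min n1 n2)).toNat) (by omega) (by omega)
    have a1 := hf.suf_of_le h1 (n' := max n (max n1 n2))
      (m' := m + m1 + m2 + (max n (max n1 n2) - min n (min n1 n2)).toNat) (by omega) (by omega)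
    have a2 := hf.suf_of_le h2 (n' := max n (max n1 n2))
      (m' := m + m1 + m2 + (max n (max n1 n2) - min n (min n1 n2)).toNat) (by omega) (by omega)
    rw [mul_assoc] at a1 a2
    have := (suf_simple_mul_simple_mul_iff h a0).2 ⟨a1, a2⟩
    exact ⟨_, _, by simpa only [mul_assoc] using this⟩

theorem Stable.mul_zpow {f y : W} (h : Stable cs f y) (a : ℤ) : Stable cs f (y * f ^ a) := by
  obtain ⟨n, m, h⟩ := h
  refine ⟨n - a, m, ?_⟩
  rwa [mul_assoc, ← zpow_add, add_sub_cancel]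

theorem stable_of_suf {f y : W} (h : Suf cs f y) : Stable cs f y := ⟨0, 1, by simpa using h⟩

theorem stable_one {f : W} : Stable cs f 1 := ⟨0, 0, by simp [Suf]⟩

/-- Stable elements have bounded length modulo powers of `f`. -/
theorem CycMin.exists_length_le_of_stable [Finite I] {f : W} (hf : CycMin cs f)
    (hP : ∀ s ∈ supp cs f, ∀ t ∈ supp cs f, (nonAdj Gr (supp cs f)).Reachable s t) {y : W}
    (hy : Stable cs f y) : ∃ n : ℤ, cs.length (y * f ^ n) ≤ ((supp cs f).ncard + 1) * cs.length f := by
  classical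
  obtain ⟨k, hk, hk'⟩ : ∃ k, (∃ (n : ℤ) (m : ℕ), Suf cs (f ^ m) (y * f ^ n) ∧
      cs.length (y * f ^ n) = k) ∧ ∀ (n : ℤ) (m : ℕ), Suf cs (f ^ m) (y * f ^ n) →
        k ≤ cs.length (y * f ^ n) := by
    have : ∃ k, ∃ (n : ℤ) (m : ℕ), Suf cs (f ^ m) (y * f ^ n) ∧ cs.length (y * f ^ n) = k := by
      obtain ⟨n, m, h⟩ := hy
      exact ⟨_, n, m, h, rfl⟩
    exact ⟨Nat.find this, Nat.find_spec this, fun n m h => Nat.find_min' this ⟨n, m, h, rfl⟩⟩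
  obtain ⟨n, m, hnm, rfl⟩ := hk
  refine ⟨n, ?_⟩
  obtain ⟨ω, hω, hf'⟩ := cs.exists_isReduced f
  have hl := hω.eq
  rw [← hf'] at hl
  obtain ⟨u, hu⟩ : ∃ u, u = y * f ^ n := ⟨_, rfl⟩
  rw [← hu] at hnm hk' ⊢
  by_cases hu1 : u = 1
  · simp [hu1]
  have hsub := hnm.supp_subset.trans (supp_pow_subset cs f m)
  obtain _ | m := m
  · rw [pow_zero] at hnm
    have := hnm.supp_subset
    rw [(supp_eq_empty_iff cs).2 rfl, Set.subset_empty_iff, supp_eq_empty_iff] at this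
    exact absurd this hu1
  obtain ⟨x, hx⟩ : ∃ x, f ^ (m + 1) = x * u := ⟨f ^ (m + 1) * u⁻¹, by simp⟩
  have h2 : cs.length (x * u) = cs.length x + cs.length u := by
    rw [hx, suf_mul_iff] at hnm; exact hnm
  have h1 := hx.symm
  rw [pow_succ] at h1
  nth_rewrite 2 [hf'] at h1
  obtain ⟨x', u', k1, k2, k3, k4, -, k6⟩ := exists_pass cs ω (f ^ m) x u h1 h2 (by
      rw [← hf', hf.length_mul_pow, hl])
  rcases k6 with ⟨k6, k7⟩ | ⟨r, hr, k6⟩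
  · have h5 : u' = y * f ^ (n - 1) := by
      rw [zpow_sub_one, ← mul_assoc, ← hu, k6, ← hf']; simp
    have h6 := hk' (n - 1) m (by rw [← h5, ← k1, suf_mul_iff, k1, k2])
    rw [← h5] at h6
    have hω0 : ω.length = 0 := by omega
    rw [List.length_eq_zero_iff] at hω0
    rw [hω0, cs.wordProd_nil] at hf'
    rw [hf', one_pow] at hnm
    have := hnm.supp_subset
    rw [(supp_eq_empty_iff cs).2 rfl, Set.subset_empty_iff, supp_eq_empty_iff] at this
    exact absurd this hu1
  · have hru : r ∉ supp cs u' := fun h => Gr.irrefl (k6 r h)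
    have hrf : r ∈ supp cs f := by rw [hf', supp_wordProd cs hω]; exact hr
    have h5 := length_le_of_supp_ne hf hP (supp cs f).ncard u' x' m k1 (by rw [k1, k2])
      (k4.trans hsub) (fun h => hru (h ▸ hrf))
      (Set.ncard_le_ncard (k4.trans hsub) (Set.toFinite _))
    rw [add_mul, one_mul]
    omega

end

section

variable {I W : Type*} [Group W] {Gr : SimpleGraph I} (cs : CoxeterSystem (coxMatrix Gr) W)

theorem finite_length_le [Finite I] (D : ℕ) : {w : W | cs.length w ≤ D}.Finite := by
  refine ((List.finite_length_le I D).image cs.wordProd).subset ?_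
  intro w hw
  obtain ⟨ω, hω, rfl⟩ := cs.exists_isReduced w
  exact ⟨ω, by simpa [hω.eq] using hw, rfl⟩

/-- Elements of minimal length in their conjugacy class without isolated letters. -/
structure MinElt (g : W) : Prop where
  length_le : ∀ z, cs.length g ≤ cs.length (z * g * z⁻¹)
  exists_not_adj : ∀ s ∈ supp cs g, ∃ t ∈ supp cs g, t ≠ s ∧ ¬ Gr.Adj s t

/-- The irreducible components of the support of an element. -/
abbrev Col (g : W) := (nonAdj Gr (supp cs g)).ConnectedComponent

/-- The component of a letter. -/
abbrev col (g : W) : I → Col cs g := (nonAdj Gr (supp cs g)).connectedComponentMk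

theorem sep_col (g : W) : Sep Gr (col cs g) (supp cs g) := by
  intro s hs t ht hne
  by_contra h
  refine hne (SimpleGraph.ConnectedComponent.sound (SimpleGraph.Adj.reachable ?_))
  exact ⟨fun h => hne (by rw [h]), h, hs, ht⟩

noncomputable instance [Finite I] (g : W) : Fintype (Col cs g) :=
  have : Finite (Col cs g) := Quot.finite _
  Fintype.ofFinite _

/-- The component of an element along a component of its support. -/
noncomputable abbrev factor (g : W) (b : Col cs g) : W := comp cs (col cs g) b g

theorem supp_factor (g : W) (b : Col cs g) :
    supp cs (factor cs g b) = supp cs g ∩ col cs g ⁻¹' {b} := by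
  apply Set.Subset.antisymm
  · rw [← mem_par_iff_supp_subset, Set.inter_comm]
    exact retr_mem_par_of_mem cs (mem_par_supp cs g)
  · rintro s ⟨hs, hs'⟩
    have h := supp_mul_subset cs (factor cs g b) (retr cs (col cs g ⁻¹' {b})ᶜ g)
    rw [(sep_col cs g).comp_mul_retr_compl (mem_par_supp cs g) b] at h
    rcases h hs with h | h
    · exact h
    · exact absurd hs' ((mem_par_iff_supp_subset cs).1 (retr_mem_par cs _ g) h)

theorem reachable_nonAdj_supp_factor {g : W} {b : Col cs g} :
    ∀ s ∈ supp cs (factor cs g b), ∀ t ∈ supp cs (factor cs g b),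
      (nonAdj Gr (supp cs (factor cs g b))).Reachable s t := by
  rw [supp_factor]
  rintro s ⟨hs, hs'⟩ t ⟨ht, ht'⟩
  obtain ⟨p⟩ := SimpleGraph.ConnectedComponent.exact (hs'.trans ht'.symm : col cs g s = col cs g t)
  induction p with
  | nil => exact SimpleGraph.Reachable.refl _
  | @cons u v w hadj p ih =>
    have hv : col cs g v = b := by
      rw [← (hs' : col cs g u = b)]
      exact SimpleGraph.ConnectedComponent.sound hadj.symm.reachable
    refine SimpleGraph.Reachable.trans (SimpleGraph.Adj.reachable ?_) (ih hadj.2.2.2 hv ht ht')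
    exact ⟨hadj.1, hadj.2.1, ⟨hs, hs'⟩, ⟨hadj.2.2.2, hv⟩⟩

variable {cs} {g : W}

theorem MinElt.cycMin_factor [Finite I] (hg : MinElt cs g) (b : Col cs g) :
    CycMin cs (factor cs g b) where
  exists_not_adj := by
    intro s hs
    rw [supp_factor] at hs ⊢
    obtain ⟨t, ht, hne, hadj⟩ := hg.exists_not_adj s hs.1
    refine ⟨t, ⟨ht, ?_⟩, hne, hadj⟩
    rw [Set.mem_preimage, Set.mem_singleton_iff, ← (hs.2 : col cs g s = b)]
    exact SimpleGraph.ConnectedComponent.sound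
      (SimpleGraph.Adj.reachable ⟨hne, fun h => hadj h.symm, ht, hs.1⟩)
  length_le := by
    classical
    intro s
    by_cases hs : s ∈ supp cs (factor cs g b)
    · have hs1 := hs
      rw [supp_factor] at hs1
      obtain ⟨hs1, hs2⟩ := hs1
      have hs2 : s ∈ col cs g ⁻¹' {b} := hs2
      have h1 := hg.length_le (cs.simple s)
      rw [cs.inv_simple] at h1
      have hm : cs.simple s * g * cs.simple s ∈ par cs (supp cs g) :=
        mul_mem (mul_mem (simple_mem_par cs hs1) (mem_par_supp cs g)) (simple_mem_par cs hs1)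
      rw [(sep_col cs g).length_eq_sum (mem_par_supp cs g), (sep_col cs g).length_eq_sum hm,
        ← Finset.add_sum_erase _ _ (Finset.mem_univ b),
        ← Finset.add_sum_erase _ _ (Finset.mem_univ b)] at h1
      have h2 : ∀ b' ∈ Finset.univ.erase b,
          cs.length (comp cs (col cs g) b' (cs.simple s * g * cs.simple s)) =
          cs.length (comp cs (col cs g) b' g) := by
        intro b' hb'
        have : s ∉ col cs g ⁻¹' {b'} := fun h => (Finset.ne_of_mem_erase hb') (h.symm.trans hs2)
        rw [map_mul, map_mul, retr_simple_of_notMem cs this, one_mul, mul_one]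
      rw [Finset.sum_congr rfl h2, map_mul, map_mul, retr_simple_of_mem cs hs2] at h1
      exact Nat.le_of_add_le_add_right h1
    · have h1 := sum_length_comp_le cs (cl := fun i : I => decide (i ∈ supp cs (factor cs g b)))
        (cs.simple s * factor cs g b * cs.simple s)
      have h2 : ((fun i : I => decide (i ∈ supp cs (factor cs g b))) ⁻¹' {true}) =
          supp cs (factor cs g b) := by ext; simp
      simp only [Fintype.sum_bool] at h1
      rw [comp, h2, map_mul, map_mul, retr_simple_of_notMem cs hs,
        retr_of_mem cs (mem_par_supp cs _), one_mul, mul_one] at h1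
      omega

variable (cs) in
/-- The set of elements whose components are all stable. -/
def Core (g y : W) : Prop :=
  y ∈ par cs (supp cs g) ∧ ∀ b, Stable cs (factor cs g b) (comp cs (col cs g) b y)

variable (cs) in
/-- The elements all of whose components are powers of the `n`th powers of the factors. -/
noncomputable def axis (g : W) (n : ℕ) : Subgroup W :=
  par cs (supp cs g) ⊓
    ⨅ b : Col cs g, (Subgroup.zpowers (factor cs g b ^ n)).comap (comp cs (col cs g) b)

theorem mem_axis_iff {n : ℕ} {x : W} : x ∈ axis cs g n ↔ x ∈ par cs (supp cs g) ∧
    ∀ b, ∃ a : ℤ, comp cs (col cs g) b x = factor cs g b ^ (n * a) := by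
  simp only [axis, Subgroup.mem_inf, Subgroup.mem_iInf, Subgroup.mem_comap,
    Subgroup.mem_zpowers_iff, zpow_mul, zpow_natCast, eq_comm]

variable (cs g) in
theorem self_mem_axis_one : g ∈ axis cs g 1 :=
  mem_axis_iff.2 ⟨mem_par_supp cs g, fun _ => ⟨1, by simp⟩⟩

theorem Core.mul_axis {y x : W} {n : ℕ} (hy : Core cs g y) (hx : x ∈ axis cs g n) :
    Core cs g (y * x) := by
  rw [mem_axis_iff] at hx
  refine ⟨mul_mem hy.1 hx.1, fun b => ?_⟩
  obtain ⟨a, ha⟩ := hx.2 b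
  rw [map_mul, ha]
  exact (hy.2 b).mul_zpow _

theorem core_mul_axis_iff {y x : W} {n : ℕ} (hx : x ∈ axis cs g n) :
    Core cs g (y * x) ↔ Core cs g y := by
  refine ⟨fun h => ?_, fun h => h.mul_axis hx⟩
  simpa using h.mul_axis (inv_mem hx)

variable (cs g) in
theorem core_one : Core cs g 1 := ⟨one_mem _, fun b => by rw [map_one]; exact stable_one⟩

theorem core_of_suf [Finite I] {v : W} (hv : Suf cs g v) : Core cs g v := by
  have hvp : v ∈ par cs (supp cs g) := (mem_par_iff_supp_subset cs).2 hv.supp_subset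
  refine ⟨hvp, fun b => stable_of_suf ?_⟩
  unfold Suf at hv
  have h1 : cs.length g = ∑ b, cs.length (factor cs g b) :=
    (sep_col cs g).length_eq_sum (mem_par_supp cs g)
  have h2 := sum_length_comp_le cs (col cs g) (g * v⁻¹)
  have h3 := sum_length_comp_le cs (col cs g) v
  have h4 : ∀ b, cs.length (factor cs g b) ≤
      cs.length (comp cs (col cs g) b (g * v⁻¹)) + cs.length (comp cs (col cs g) b v) := by
    intro b
    have := cs.length_mul_le (comp cs (col cs g) b (g * v⁻¹)) (comp cs (col cs g) b v)
    rwa [← map_mul, inv_mul_cancel_right] at this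
  have h5 : ∑ b, (cs.length (comp cs (col cs g) b (g * v⁻¹)) + cs.length (comp cs (col cs g) b v)) ≤
      ∑ b, cs.length (factor cs g b) := by
    rw [Finset.sum_add_distrib]; omega
  have h6 := (Finset.sum_eq_sum_iff_of_le fun b _ => h4 b).1
    (le_antisymm (Finset.sum_le_sum fun b _ => h4 b) h5) b (Finset.mem_univ b)
  unfold Suf
  rw [h6, map_mul, map_inv]

theorem comp_simple_mul_of_eq {s : I} {b : Col cs g} (h : col cs g s = b) (y : W) :
    comp cs (col cs g) b (cs.simple s * y) = cs.simple s * comp cs (col cs g) b y := by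
  rw [map_mul, retr_simple_of_mem cs (show s ∈ col cs g ⁻¹' {b} from h)]

theorem comp_simple_mul_of_ne {s : I} {b : Col cs g} (h : col cs g s ≠ b) (y : W) :
    comp cs (col cs g) b (cs.simple s * y) = comp cs (col cs g) b y := by
  rw [map_mul, retr_simple_of_notMem cs (show s ∉ col cs g ⁻¹' {b} from h), one_mul]

theorem MinElt.core_simple_mul_simple_mul_iff [Finite I] (hg : MinElt cs g) {s t : I}
    (h : Gr.Adj s t) {y : W} (hy : Core cs g y) :
    Core cs g (cs.simple s * (cs.simple t * y)) ↔
      Core cs g (cs.simple s * y) ∧ Core cs g (cs.simple t * y) := by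
  have hmem : ∀ i : I, ∀ z, z ∈ par cs (supp cs g) →
      (cs.simple i * z ∈ par cs (supp cs g) ↔ cs.simple i ∈ par cs (supp cs g)) :=
    fun i z hz => Subgroup.mul_mem_cancel_right _ hz
  have hmem2 : cs.simple s * (cs.simple t * y) ∈ par cs (supp cs g) ↔
      cs.simple s ∈ par cs (supp cs g) ∧ cs.simple t ∈ par cs (supp cs g) := by
    rw [← mul_assoc, Subgroup.mul_mem_cancel_right _ hy.1]
    refine ⟨fun h' => ?_, fun h' => mul_mem h'.1 h'.2⟩
    have h1 := retr_of_mem cs h'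
    by_contra hcon
    have h2 : ¬ (s ∈ supp cs g ∧ t ∈ supp cs g) :=
      fun h3 => hcon ⟨simple_mem_par cs h3.1, simple_mem_par cs h3.2⟩
    rw [map_mul, retr_simple, retr_simple] at h1
    split_ifs at h1 with h3 h4 h4
    · exact h2 ⟨h3, h4⟩
    · rw [mul_one, left_eq_mul] at h1; exact simple_ne_one cs t h1
    · rw [one_mul, right_eq_mul] at h1; exact simple_ne_one cs s h1
    · rw [one_mul, eq_comm, mul_eq_one_iff_eq_inv, cs.inv_simple] at h1
      exact simple_ne cs h.ne h1
  unfold Core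
  rw [hmem2, hmem s y hy.1, hmem t y hy.1]
  constructor
  · rintro ⟨⟨h1, h2⟩, h3⟩
    refine ⟨⟨h1, fun b => ?_⟩, ⟨h2, fun b => ?_⟩⟩
    all_goals
      have h4 := h3 b
      have h5 := hy.2 b
      by_cases hs : col cs g s = b <;> by_cases ht : col cs g t = b <;>
      simp only [comp_simple_mul_of_eq, comp_simple_mul_of_ne, hs, ht, ne_eq, not_false_iff] at h4 ⊢
      all_goals first
        | assumption
        | exact (((hg.cycMin_factor b).stable_simple_mul_simple_mul_iff h h5).1 h4).1
        | exact (((hg.cycMin_factor b).stable_simple_mul_simple_mul_iff h h5).1 h4).2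
  · rintro ⟨⟨h1, h3⟩, ⟨h2, h4⟩⟩
    refine ⟨⟨h1, h2⟩, fun b => ?_⟩
    have h3 := h3 b
    have h4 := h4 b
    have h5 := hy.2 b
    by_cases hs : col cs g s = b <;> by_cases ht : col cs g t = b <;>
    simp only [comp_simple_mul_of_eq, comp_simple_mul_of_ne, hs, ht, ne_eq, not_false_iff]
      at h3 h4 ⊢
    all_goals first
      | assumption
      | exact ((hg.cycMin_factor b).stable_simple_mul_simple_mul_iff h h5).2 ⟨h3, h4⟩

variable (cs) in
/-- The class of an element modulo the axis. -/
noncomputable def axisClass (g : W) (n : ℕ) (y : W) :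
    ∀ b : Col cs g, W ⧸ Subgroup.zpowers (factor cs g b ^ n) :=
  fun b => (comp cs (col cs g) b y : W)

theorem inv_mul_mem_axis {n : ℕ} {y y' : W} (hy : y ∈ par cs (supp cs g))
    (hy' : y' ∈ par cs (supp cs g)) (h : axisClass cs g n y = axisClass cs g n y') :
    y⁻¹ * y' ∈ axis cs g n := by
  rw [axis, Subgroup.mem_inf]
  refine ⟨mul_mem (inv_mem hy) hy', ?_⟩
  simp only [Subgroup.mem_iInf, Subgroup.mem_comap]
  intro b
  rw [map_mul, map_inv]
  exact QuotientGroup.eq.1 (congrFun h b)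

theorem MinElt.finite_axisClass [Finite I] (hg : MinElt cs g) {n : ℕ} (hn : n ≠ 0) :
    (axisClass cs g n '' {y | Core cs g y}).Finite := by
  have key : ∀ b : Col cs g, ((fun y : W => ((comp cs (col cs g) b y : W) :
      W ⧸ Subgroup.zpowers (factor cs g b ^ n))) '' {y | Core cs g y}).Finite := by
    intro b
    let D := ((supp cs (factor cs g b)).ncard + 1) * cs.length (factor cs g b)
    refine (((finite_length_le cs D).prod (Set.finite_Iio n)).image
      (fun p : W × ℕ => ((p.1 * factor cs g b ^ p.2 : W) :
        W ⧸ Subgroup.zpowers (factor cs g b ^ n)))).subset ?_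
    rintro _ ⟨y, hy, rfl⟩
    obtain ⟨m, hm⟩ := (hg.cycMin_factor b).exists_length_le_of_stable
      (reachable_nonAdj_supp_factor cs) (hy.2 b)
    have hn' : (n : ℤ) ≠ 0 := by exact_mod_cast hn
    refine ⟨(comp cs (col cs g) b y * factor cs g b ^ m, ((-m) % n).toNat), ⟨hm, ?_⟩, ?_⟩
    · have h1 := Int.emod_lt_of_pos (-m) (by omega : (0 : ℤ) < n)
      have h2 := Int.emod_nonneg (-m) hn'
      simp only [Set.mem_Iio]
      omega
    · rw [QuotientGroup.eq]
      refine ⟨-m / n, ?_⟩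
      have h2 : (((-m) % n).toNat : ℤ) = (-m) % n := Int.toNat_of_nonneg (Int.emod_nonneg (-m) hn')
      simp only
      rw [← zpow_natCast _ ((-m) % n).toNat, h2, ← zpow_natCast, ← zpow_mul, mul_assoc, ← zpow_add]
      rw [mul_inv_rev, inv_mul_cancel_right, ← zpow_neg]
      congr 1
      have := Int.mul_ediv_add_emod (-m) n
      linarith
  refine (Set.Finite.pi key).subset ?_
  rintro _ ⟨y, hy, rfl⟩ b -
  exact ⟨y, hy, rfl⟩

end

section

variable {I W : Type*} [Group W] {Gr : SimpleGraph I} (cs : CoxeterSystem (coxMatrix Gr) W)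

/-- The star of a vertex. -/
def star (Gr : SimpleGraph I) (s : I) : Set I := {t | t = s ∨ Gr.Adj s t}

theorem commute_of_mem_par_star {s : I} {x : W} (hx : x ∈ par cs (star Gr s)) :
    Commute (cs.simple s) x := by
  have : par cs (star Gr s) ≤ Subgroup.centralizer {cs.simple s} := by
    rw [par, Subgroup.closure_le]
    rintro _ ⟨t, rfl | ht, rfl⟩
    · simp [Subgroup.mem_centralizer_singleton_iff]
    · simp only [SetLike.mem_coe, Subgroup.mem_centralizer_singleton_iff]
      exact (simple_comm cs ht).symm
  exact (Subgroup.mem_centralizer_singleton_iff.1 (this hx)).symm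

theorem commute_of_mem_par_iInter_star {h x : W}
    (hx : x ∈ par cs {t | ∀ s ∈ supp cs h, t ∈ star Gr s}) : Commute h x := by
  have : par cs (supp cs h) ≤ Subgroup.centralizer {x} := by
    rw [par, Subgroup.closure_le]
    rintro _ ⟨s, hs, rfl⟩
    simp only [SetLike.mem_coe, Subgroup.mem_centralizer_singleton_iff]
    exact commute_of_mem_par_star cs (par_mono cs
      (show {t | ∀ s ∈ supp cs h, t ∈ star Gr s} ⊆ star Gr s from fun t ht => ht s hs) hx)
  exact Subgroup.mem_centralizer_singleton_iff.1 (this (mem_par_supp cs h))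

variable (K : Subgroup W) [K.Normal]

/-- The image of a standard parabolic subgroup in a quotient. -/
abbrev qpar (S : Set I) : Subgroup (W ⧸ K) := (par cs S).map (QuotientGroup.mk' K)

variable {K} in
theorem qpar_inf_le (hK : ∀ S, ∀ x ∈ K, retr cs S x ∈ K) (S T : Set I) :
    qpar cs K S ⊓ qpar cs K T ≤ qpar cs K (S ∩ T) := by
  rintro q ⟨⟨x, hx, rfl⟩, ⟨y, hy, hxy⟩⟩
  refine ⟨retr cs S y, retr_mem_par_of_mem cs hy, ?_⟩
  rw [QuotientGroup.mk'_apply, QuotientGroup.mk'_apply, QuotientGroup.eq] at hxy ⊢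
  have := hK S _ hxy
  rwa [map_mul, map_inv, retr_of_mem cs hx] at this

variable {K} in
theorem mem_qpar_iInter (hK : ∀ S, ∀ x ∈ K, retr cs S x ∈ K) {δ : W ⧸ K} (ω : List I)
    (F : I → Set I) (h : ∀ s ∈ ω, δ ∈ qpar cs K (F s)) :
    δ ∈ qpar cs K {t | ∀ s ∈ ω, t ∈ F s} := by
  induction ω with
  | nil =>
    obtain ⟨x, rfl⟩ := QuotientGroup.mk_surjective δ
    exact ⟨x, by simpa using mem_par_univ cs x, rfl⟩
  | cons i ω ih =>
    have := qpar_inf_le cs hK _ _ ⟨h i (by simp), ih fun s hs => h s (by simp [hs])⟩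
    convert this using 2
    ext t
    simp

open Classical in
/-- The action of a simple reflection on pairs of an element and a coset: it moves the element
inside the core of `g` as long as the coset is in the star, and the coset otherwise. -/
noncomputable def coreAct (g : W) (s : I) : Function.End (W × (W ⧸ K)) := fun p =>
  if p.2 ∈ qpar cs K (star Gr s) ∧ Core cs g p.1 ∧ Core cs g (cs.simple s * p.1) then
    (cs.simple s * p.1, p.2) else (p.1, p.2 * (cs.simple s : W))

theorem mul_simple_mem_qpar_iff {s t : I} (h : t ∈ star Gr s) (δ : W ⧸ K) :
    δ * (cs.simple t : W) ∈ qpar cs K (star Gr s) ↔ δ ∈ qpar cs K (star Gr s) :=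
  Subgroup.mul_mem_cancel_right _ ⟨_, simple_mem_par cs h, rfl⟩

theorem coreAct_sq (g : W) (s : I) : coreAct cs K g s * coreAct cs K g s = 1 := by
  funext ⟨y, δ⟩
  change coreAct cs K g s (coreAct cs K g s (y, δ)) = (y, δ)
  by_cases h : δ ∈ qpar cs K (star Gr s) ∧ Core cs g y ∧ Core cs g (cs.simple s * y)
  · simp [coreAct, h]
  · have h' : ¬ (δ * (cs.simple s : W) ∈ qpar cs K (star Gr s) ∧ Core cs g y ∧
        Core cs g (cs.simple s * y)) := by
      rwa [mul_simple_mem_qpar_iff cs K (Or.inl rfl)]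
    have e : coreAct cs K g s (y, δ) = (y, δ * (cs.simple s : W)) := if_neg h
    have e' : coreAct cs K g s (y, δ * (cs.simple s : W)) =
      (y, δ * (cs.simple s : W) * (cs.simple s : W)) := if_neg h'
    rw [e, e', mul_assoc, ← QuotientGroup.mk_mul, cs.simple_mul_simple_self]
    simp

variable {g : W}

theorem MinElt.coreAct_comm [Finite I] (hg : MinElt cs g) (s t : I) (h : Gr.Adj s t) :
    coreAct cs K g s * coreAct cs K g t = coreAct cs K g t * coreAct cs K g s := by
  classical
  funext ⟨y, δ⟩
  change coreAct cs K g s (coreAct cs K g t (y, δ)) = coreAct cs K g t (coreAct cs K g s (y, δ))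
  have a1 := mul_simple_mem_qpar_iff cs K (Or.inr h : t ∈ star Gr s) δ
  have a2 := mul_simple_mem_qpar_iff cs K (Or.inr h.symm : s ∈ star Gr t) δ
  have a3 := fun hy => hg.core_simple_mul_simple_mul_iff h (y := y) hy
  have a4 : cs.simple t * (cs.simple s * y) = cs.simple s * (cs.simple t * y) := by
    rw [← mul_assoc, ← simple_comm cs h, mul_assoc]
  have a5 : (cs.simple t : W ⧸ K) * (cs.simple s : W) = (cs.simple s : W) * (cs.simple t : W) := by
    rw [← QuotientGroup.mk_mul, ← QuotientGroup.mk_mul, simple_comm cs h]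
  by_cases h1 : δ ∈ qpar cs K (star Gr s) <;> by_cases h2 : δ ∈ qpar cs K (star Gr t) <;>
  by_cases h3 : Core cs g y <;> by_cases h4 : Core cs g (cs.simple s * y) <;>
  by_cases h5 : Core cs g (cs.simple t * y) <;>
  simp [coreAct, h1, h2, h3, h4, h5, a1, a2, a3, a4, a5, mul_assoc]

/-- The action of the group on pairs of an element and a coset. -/
noncomputable def coreHom [Finite I] (hg : MinElt cs g) : W →* Function.End (W × (W ⧸ K)) :=
  liftInv cs (coreAct cs K g) (coreAct_sq cs K g) (hg.coreAct_comm cs K)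

variable [Finite I] (hg : MinElt cs g)

theorem coreHom_simple_mul (s : I) (w : W) (p : W × (W ⧸ K)) :
    coreHom cs K hg (cs.simple s * w) p = coreAct cs K g s (coreHom cs K hg w p) := by
  rw [map_mul]
  change coreHom cs K hg (cs.simple s) _ = _
  rw [coreHom, liftInv_simple]

theorem coreHom_one (p : W × (W ⧸ K)) : coreHom cs K hg 1 p = p := by rw [map_one]; rfl

theorem coreHom_mul (v w : W) (p : W × (W ⧸ K)) :
    coreHom cs K hg (v * w) p = coreHom cs K hg v (coreHom cs K hg w p) := by rw [map_mul]; rfl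

theorem coreHom_mul_axis {n : ℕ} {x : W} (hx : x ∈ axis cs g n) (w : W) (p : W × (W ⧸ K)) :
    coreHom cs K hg w (p.1 * x, p.2) =
      ((coreHom cs K hg w p).1 * x, (coreHom cs K hg w p).2) := by
  induction w using cs.simple_induction_left with
  | one => simp [coreHom_one]
  | mul_simple_left w s ih =>
    rw [coreHom_simple_mul, coreHom_simple_mul, ih]
    generalize coreHom cs K hg w p = q
    obtain ⟨y, δ⟩ := q
    have h1 : cs.simple s * (y * x) = cs.simple s * y * x := (mul_assoc ..).symm
    unfold coreAct
    have h2 : Core cs g (cs.simple s * (y * x)) ↔ Core cs g (cs.simple s * y) := by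
      rw [h1, core_mul_axis_iff hx]
    have h3 := core_mul_axis_iff hx (y := y)
    split_ifs with h4 h5 h5
    · rw [h1]
    · exact absurd (by rwa [h2, h3] at h4) h5
    · exact absurd (by rwa [← h2, ← h3] at h5) h4
    · rfl

theorem core_coreHom {p : W × (W ⧸ K)} (hp : Core cs g p.1) (w : W) :
    Core cs g (coreHom cs K hg w p).1 := by
  induction w using cs.simple_induction_left with
  | one => simpa [coreHom_one] using hp
  | mul_simple_left w s ih =>
    rw [coreHom_simple_mul]
    unfold coreAct
    split_ifs with h
    · exact h.2.2
    · exact ih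

theorem coreHom_invariant (w : W) (p : W × (W ⧸ K)) :
    (coreHom cs K hg w p).2⁻¹ * ((coreHom cs K hg w p).1 : W) = (w : W ⧸ K) * p.2⁻¹ * (p.1 : W) := by
  induction w using cs.simple_induction_left with
  | one => simp [coreHom_one]
  | mul_simple_left w s ih =>
    rw [coreHom_simple_mul, QuotientGroup.mk_mul, mul_assoc, mul_assoc, ← mul_assoc (w : W ⧸ K),
      ← ih]
    generalize coreHom cs K hg w p = q
    obtain ⟨y, δ⟩ := q
    unfold coreAct
    split_ifs with h
    · obtain ⟨⟨x, hx, rfl⟩, -⟩ := h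
      have := commute_of_mem_par_star cs hx
      simp only [QuotientGroup.mk'_apply, ← QuotientGroup.mk_inv, ← QuotientGroup.mk_mul,
        ← mul_assoc, this.inv_right.eq]
    · simp only [mul_inv_rev, ← QuotientGroup.mk_inv, cs.inv_simple, mul_assoc]

theorem coreHom_self_aux (ω : List I) (hω : cs.IsReduced ω) (h : Suf cs g (cs.wordProd ω)) :
    coreHom cs K hg (cs.wordProd ω) (1, 1) = (cs.wordProd ω, 1) := by
  induction ω with
  | nil => simp [coreHom_one]
  | cons i ω ih =>
    have hω' : cs.IsReduced ω := by simpa using hω.drop 1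
    have h' : Suf cs g (cs.wordProd ω) := by
      unfold Suf at h ⊢
      rw [hω.eq, cs.wordProd_cons, mul_inv_rev, cs.inv_simple, ← mul_assoc] at h
      rw [hω'.eq]
      have h1 := cs.length_mul_le (g * (cs.wordProd ω)⁻¹ * cs.simple i) (cs.simple i)
      rw [cs.simple_mul_simple_cancel_right, cs.length_simple] at h1
      have h2 := cs.length_mul_le (g * (cs.wordProd ω)⁻¹) (cs.wordProd ω)
      rw [inv_mul_cancel_right, hω'.eq] at h2
      simp only [List.length_cons] at h
      omega
    rw [cs.wordProd_cons, coreHom_simple_mul, ih hω' h']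
    refine if_pos ⟨one_mem _, core_of_suf h', ?_⟩
    rw [← cs.wordProd_cons]
    exact core_of_suf h

theorem coreHom_self : coreHom cs K hg g (1, 1) = (g, 1) := by
  obtain ⟨ω, hω, h⟩ := cs.exists_isReduced g
  have := coreHom_self_aux cs K hg ω hω (by rw [← h]; simp [Suf])
  rwa [← h] at this

theorem coreHom_wordProd (ω : List I) (p : W × (W ⧸ K)) :
    ∃ ω' : List I, ω'.length ≤ ω.length ∧
      (coreHom cs K hg (cs.wordProd ω) p).1 = cs.wordProd ω' * p.1 ∧
      (ω'.length = ω.length → ω' = ω ∧ (coreHom cs K hg (cs.wordProd ω) p).2 = p.2 ∧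
        ∀ s ∈ ω, p.2 ∈ qpar cs K (star Gr s)) := by
  induction ω with
  | nil => exact ⟨[], by simp, by simp [coreHom_one], by simp [coreHom_one]⟩
  | cons i ω ih =>
    obtain ⟨ω', h1, h2, h3⟩ := ih
    rw [cs.wordProd_cons, coreHom_simple_mul]
    unfold coreAct
    split_ifs with h
    · refine ⟨i :: ω', by simpa using h1, by simp [h2, cs.wordProd_cons, mul_assoc], ?_⟩
      intro h4
      obtain ⟨h5, h6, h7⟩ := h3 (by simpa using h4)
      refine ⟨by rw [h5], h6, ?_⟩
      intro s hs
      rcases List.mem_cons.1 hs with rfl | hs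
      · rw [← h6]; exact h.1
      · exact h7 s hs
    · refine ⟨ω', by simp; omega, h2, fun h4 => ?_⟩
      simp at h4; omega

/-- The elements acting on the base point like an element of the axis. -/
noncomputable def coreStab : Subgroup W where
  carrier := {w | ∃ x ∈ axis cs g 3, coreHom cs K hg w (1, 1) = (x, 1)}
  one_mem' := ⟨1, one_mem _, coreHom_one cs K hg _⟩
  mul_mem' := by
    rintro v w ⟨x, hx, hv⟩ ⟨x', hx', hw⟩
    refine ⟨x * x', mul_mem hx hx', ?_⟩
    have := coreHom_mul_axis cs K hg hx' v (1, 1)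
    rw [one_mul] at this
    rw [coreHom_mul, hw, this, hv]
  inv_mem' := by
    rintro w ⟨x, hx, hw⟩
    refine ⟨x⁻¹, inv_mem hx, ?_⟩
    have h1 : coreHom cs K hg w⁻¹ (x, 1) = (1, 1) := by
      rw [← hw, ← coreHom_mul, inv_mul_cancel, coreHom_one]
    have h2 := coreHom_mul_axis cs K hg (inv_mem hx) w⁻¹ (x, 1)
    rwa [mul_inv_cancel, h1, one_mul] at h2

theorem finiteIndex_of_finite_range {G α : Type*} [Group G] (S : Subgroup G) (f : G → α)
    (hf : (Set.range f).Finite) (h : ∀ a b, f a = f b → a⁻¹ * b ∈ S) : S.FiniteIndex := by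
  have : Finite (Set.range f) := hf
  have : Finite (G ⧸ S) := by
    refine Finite.of_injective (fun q : G ⧸ S => (⟨f q.out, q.out, rfl⟩ : Set.range f)) ?_
    intro q q' hq
    have := h _ _ (Subtype.ext_iff.1 hq)
    rw [← QuotientGroup.out_eq' q, ← QuotientGroup.out_eq' q']
    exact QuotientGroup.eq.2 this
  exact Subgroup.finiteIndex_of_finite_quotient

theorem finiteIndex_coreStab [K.FiniteIndex] : (coreStab cs K hg).FiniteIndex := by
  refine finiteIndex_of_finite_range _
    (fun w => (axisClass cs g 3 (coreHom cs K hg w (1, 1)).1, (coreHom cs K hg w (1, 1)).2)) ?_ ?_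
  · refine ((hg.finite_axisClass (n := 3) (by simp)).prod
      (Set.finite_univ (α := W ⧸ K))).subset ?_
    rintro _ ⟨w, rfl⟩
    exact ⟨⟨_, core_coreHom cs K hg (core_one cs g) w, rfl⟩, trivial⟩
  · intro a b hab
    simp only [Prod.mk.injEq] at hab
    have h1 := inv_mul_mem_axis (core_coreHom cs K hg (p := (1, 1)) (core_one cs g) a).1
      (core_coreHom cs K hg (p := (1, 1)) (core_one cs g) b).1 hab.1
    refine ⟨_, h1, ?_⟩
    have h2 := coreHom_mul_axis cs K hg h1 a⁻¹ (coreHom cs K hg a (1, 1))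
    rw [mul_inv_cancel_left, hab.2, ← coreHom_mul, ← coreHom_mul, inv_mul_cancel,
      coreHom_one] at h2
    simpa using h2

theorem exists_core_of_mem_coreStab (hK : ∀ S, ∀ x ∈ K, retr cs S x ∈ K) {h k : W}
    (hl : cs.length h ≤ cs.length g) (hk : (h * k)⁻¹ * (k * g) ∈ coreStab cs K hg) :
    ∃ y c : W, Core cs g y ∧ h * y = y * g ∧ c ∈ par cs {t | ∀ s ∈ supp cs h, t ∈ star Gr s} ∧
      (y : W ⧸ K) = c * k := by
  obtain ⟨x, hx, hσ⟩ := hk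
  obtain ⟨y, hy⟩ : ∃ y, y = (coreHom cs K hg k (1, 1)).1 := ⟨_, rfl⟩
  obtain ⟨δ, hδ⟩ : ∃ δ, δ = (coreHom cs K hg k (1, 1)).2 := ⟨_, rfl⟩
  have hC : Core cs g y := by rw [hy]; exact core_coreHom cs K hg (core_one cs g) k
  have e1 : coreHom cs K hg (k * g) (1, 1) = (y * g, δ) := by
    have := coreHom_mul_axis cs K hg (self_mem_axis_one cs g) k (1, 1)
    rw [one_mul, ← hy, ← hδ] at this
    rw [coreHom_mul, coreHom_self, this]
  have e2 : coreHom cs K hg (k * g) (1, 1) =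
      ((coreHom cs K hg h (y, δ)).1 * x, (coreHom cs K hg h (y, δ)).2) := by
    have h1 : k * g = h * k * ((h * k)⁻¹ * (k * g)) := by group
    have := coreHom_mul_axis cs K hg hx (h * k) (1, 1)
    have h2 : coreHom cs K hg (h * k) (1, 1) = coreHom cs K hg h (y, δ) := by
      rw [coreHom_mul, hy, hδ]
    rw [one_mul, h2] at this
    rw [h1, coreHom_mul, hσ, this]
  rw [e1] at e2
  obtain ⟨e3, e4⟩ := Prod.mk.inj e2
  obtain ⟨ω, hω, hh⟩ := cs.exists_isReduced h
  obtain ⟨ω', d1, d2, d3⟩ := coreHom_wordProd cs K hg ω (y, δ)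
  rw [← hh] at d2 d3
  have hωl := hω.eq
  rw [← hh] at hωl
  simp only [] at d2 d3
  rw [d2] at e3
  have hxi := mem_axis_iff.1 hx
  choose a ha using hxi.2
  have e5 : cs.wordProd ω' = y * (g * x⁻¹) * y⁻¹ := by
    rw [eq_mul_inv_iff_mul_eq, ← mul_assoc, eq_mul_inv_iff_mul_eq, ← e3]
  have f1 : ∀ b, comp cs (col cs g) b (cs.wordProd ω') = comp cs (col cs g) b y *
      factor cs g b ^ (1 - 3 * a b) * (comp cs (col cs g) b y)⁻¹ := by
    intro b
    rw [e5, map_mul, map_mul, map_mul, map_inv, map_inv, ha b, zpow_sub, zpow_one]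
    norm_cast
  have f2 : ∀ b, cs.length (factor cs g b) ≤ cs.length (comp cs (col cs g) b (cs.wordProd ω')) := by
    intro b
    rw [f1 b]
    refine le_trans ?_ ((hg.cycMin_factor b).length_conj_zpow _ _)
    exact Nat.le_mul_of_pos_left _ (by omega)
  have hgl : cs.length g = ∑ b, cs.length (factor cs g b) :=
    (sep_col cs g).length_eq_sum (mem_par_supp cs g)
  have f3 := sum_length_comp_le cs (col cs g) (cs.wordProd ω')
  have f4 := Finset.sum_le_sum fun b (_ : b ∈ Finset.univ) => f2 b
  have f5 := cs.length_wordProd_le ω'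
  obtain ⟨d4, d5, d6⟩ := d3 (by omega)
  rw [d4, ← hh] at e3
  have f6 := (Finset.sum_eq_sum_iff_of_le (s := Finset.univ) fun b _ => f2 b).1 (by omega)
  have hx1 : x = 1 := by
    refine (sep_col cs g).ext hxi.1 (one_mem _) fun b => ?_
    rw [ha b, map_one]
    have f7 := f6 b (Finset.mem_univ b)
    have f8 := (hg.cycMin_factor b).length_conj_zpow (comp cs (col cs g) b y) (1 - 3 * a b)
    rw [← f1 b, ← f7] at f8
    by_cases hb : a b = 0
    · simp [hb]
    · have f9 : 2 ≤ (1 - 3 * a b).natAbs := by omega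
      have f10 : cs.length (factor cs g b) = 0 := by nlinarith
      rw [cs.length_eq_zero_iff] at f10
      rw [f10, one_zpow]
  rw [hx1, mul_one] at e3
  have hsupp : supp cs h = {i | i ∈ ω} := by rw [hh, supp_wordProd cs hω]
  obtain ⟨c, hc, hcδ⟩ := mem_qpar_iInter cs hK ω (star Gr) d6
  refine ⟨y, c, hC, e3.symm, by rw [hsupp]; exact hc, ?_⟩
  have inv := coreHom_invariant cs K hg k (1, 1)
  rw [← hy, ← hδ, ← hcδ] at inv
  simp only [inv_one, mul_one, QuotientGroup.mk_one] at inv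
  rw [← inv]
  simp

end

section

variable {I W : Type*} [Group W] {Gr : SimpleGraph I} (cs : CoxeterSystem (coxMatrix Gr) W)

/-- The elements in which every simple reflection has even exponent sum. -/
noncomputable def even : Subgroup W := ⨅ s, (retr cs {s}).ker

theorem mem_even_iff {x : W} : x ∈ even cs ↔ ∀ s, retr cs {s} x = 1 := by
  simp [even, Subgroup.mem_iInf, MonoidHom.mem_ker]

instance : (even cs).Normal := Subgroup.normal_iInf_normal fun _ => inferInstance

instance [Finite I] : (even cs).FiniteIndex := by
  refine Subgroup.finiteIndex_iInf fun s => ?_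
  have h : (retr cs {s}).range ≤ par cs {s} := by
    rintro _ ⟨x, rfl⟩
    exact retr_mem_par cs _ x
  have h2 : Finite (par cs {s}) := by
    rw [par, Set.image_singleton, ← Subgroup.zpowers_eq_closure]
    refine (finite_zpowers (a := cs.simple s)).2 (isOfFinOrder_iff_pow_eq_one.2 ⟨2, by simp, ?_⟩)
    rw [pow_two, cs.simple_mul_simple_self]
  have h3 : Finite (retr cs {s}).range := Finite.of_injective _ (Subgroup.inclusion_injective h)
  exact Subgroup.finiteIndex_ker _

theorem MinElt.of_even {g : W} (hg : g ∈ even cs)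
    (hl : ∀ z, cs.length g ≤ cs.length (z * g * z⁻¹)) : MinElt cs g where
  length_le := hl
  exists_not_adj := by
    intro s hs
    by_contra! hcon
    have h := retr_mul_retr_compl cs (S := {s}) (T := supp cs g)
      (by
        rintro _ ⟨rfl, -⟩ t ⟨ht, hne⟩
        exact hcon t ht hne) (mem_par_supp cs g)
    rw [(mem_even_iff cs).1 hg s, one_mul] at h
    have := (mem_par_iff_supp_subset cs).1 ((mem_par_iff cs).2 h) hs
    simp at this

theorem exists_conj_length_le (g : W) : ∃ z, ∀ y,
    cs.length (z * g * z⁻¹) ≤ cs.length (y * (z * g * z⁻¹) * y⁻¹) := by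
  obtain ⟨z, -, hz⟩ := WellFounded.has_min (measure fun z => cs.length (z * g * z⁻¹)).wf
    Set.univ ⟨1, trivial⟩
  refine ⟨z, fun y => ?_⟩
  have := hz (y * z) trivial
  simp only [InvImage, not_lt, WellFoundedRelation.rel, mul_inv_rev] at this
  simpa [mul_assoc] using this

theorem exists_conj_minElt {g : W} (hg : g ∈ even cs) : ∃ z, MinElt cs (z * g * z⁻¹) := by
  obtain ⟨z, hz⟩ := exists_conj_length_le cs g
  exact ⟨z, MinElt.of_even cs (Subgroup.Normal.conj_mem inferInstance g hg z) hz⟩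

/-- Elements that are conjugate modulo a suitable finite index subgroup are conjugate, by an
element in a prescribed class. -/
def ConjSep (K : Subgroup W) (g h : W) : Prop :=
  ∃ P : Subgroup W, P.Normal ∧ P.FiniteIndex ∧
    ∀ k, (h * k)⁻¹ * (k * g) ∈ P → ∃ a, a * k⁻¹ ∈ K ∧ a * g = h * a

variable {cs}

theorem ConjSep.symm {K : Subgroup W} [K.Normal] {g h : W} (H : ConjSep K h g) :
    ConjSep K g h := by
  obtain ⟨P, hP, hfi, H⟩ := H
  refine ⟨P, hP, hfi, fun k hk => ?_⟩
  obtain ⟨a, ha, hag⟩ := H k⁻¹ (by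
    have h1 := inv_mem (hP.conj_mem _ hk k)
    have h2 : (k * ((h * k)⁻¹ * (k * g)) * k⁻¹)⁻¹ = (g * k⁻¹)⁻¹ * (k⁻¹ * h) := by group
    rwa [h2] at h1)
  refine ⟨a⁻¹, ?_, ?_⟩
  · have h1 := inv_mem (Subgroup.Normal.conj_mem inferInstance _ ha k)
    have h2 : (k * (a * k⁻¹⁻¹) * k⁻¹)⁻¹ = a⁻¹ * k⁻¹ := by group
    rwa [h2] at h1
  · rw [inv_mul_eq_iff_eq_mul, ← mul_assoc, hag, mul_inv_cancel_right]

theorem ConjSep.conj {K : Subgroup W} [K.Normal] {g h : W} (z x : W)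
    (H : ConjSep K (z * g * z⁻¹) (x * h * x⁻¹)) : ConjSep K g h := by
  obtain ⟨P, hP, hfi, H⟩ := H
  refine ⟨P, hP, hfi, fun k hk => ?_⟩
  obtain ⟨a, ha, hag⟩ := H (x * k * z⁻¹) (by
    have h1 := hP.conj_mem _ hk z
    have h2 : z * ((h * k)⁻¹ * (k * g)) * z⁻¹ =
      (x * h * x⁻¹ * (x * k * z⁻¹))⁻¹ * (x * k * z⁻¹ * (z * g * z⁻¹)) := by group
    rwa [h2] at h1)
  refine ⟨x⁻¹ * a * z, ?_, ?_⟩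
  · have h1 := Subgroup.Normal.conj_mem inferInstance _ ha x⁻¹
    have h2 : x⁻¹ * (a * (x * k * z⁻¹)⁻¹) * x⁻¹⁻¹ = x⁻¹ * a * z * k⁻¹ := by group
    rwa [h2] at h1
  · have h1 : x⁻¹ * a * z * g = x⁻¹ * (a * (z * g * z⁻¹)) * z := by group
    rw [h1, hag]; group

variable (cs) in
theorem conjSep_of_even [Finite I] {K : Subgroup W} [K.Normal] [K.FiniteIndex]
    (hK : ∀ S, ∀ x ∈ K, retr cs S x ∈ K) {g h : W} (hg : g ∈ even cs) (hh : h ∈ even cs) :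
    ConjSep K g h := by
  obtain ⟨z, hz⟩ := exists_conj_minElt cs hg
  obtain ⟨x, hx⟩ := exists_conj_minElt cs hh
  have key : ∀ {g h : W}, MinElt cs g → cs.length h ≤ cs.length g → ConjSep K g h := by
    intro g h hg hl
    have := finiteIndex_coreStab cs K hg
    refine ⟨(coreStab cs K hg).normalCore, inferInstance, inferInstance, fun k hk => ?_⟩
    obtain ⟨y, c, -, hy, hc, hyc⟩ := exists_core_of_mem_coreStab cs K hg hK hl
      (Subgroup.normalCore_le _ hk)
    have hcomm := (commute_of_mem_par_iInter_star cs hc).inv_right.eq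
    refine ⟨c⁻¹ * y, ?_, ?_⟩
    · rw [← QuotientGroup.eq_one_iff]
      simp [hyc]
    · rw [mul_assoc, ← hy, ← mul_assoc, ← hcomm, mul_assoc]
  rcases le_total (cs.length (x * h * x⁻¹)) (cs.length (z * g * z⁻¹)) with hl | hl
  · exact (key hz hl).conj z x
  · exact (key hx hl).symm.conj z x

variable (cs) in
theorem exists_retr_invariant [Finite I] (K : Subgroup W) [K.FiniteIndex] :
    ∃ K' ≤ K, K'.Normal ∧ K'.FiniteIndex ∧ ∀ S, ∀ x ∈ K', retr cs S x ∈ K' := by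
  refine ⟨⨅ S, K.normalCore.comap (retr cs S), ?_, Subgroup.normal_iInf_normal fun _ => inferInstance,
    Subgroup.finiteIndex_iInf fun S => ?_, ?_⟩
  · intro x hx
    have := Subgroup.mem_iInf.1 hx Set.univ
    rw [Subgroup.mem_comap, retr_univ] at this
    exact Subgroup.normalCore_le _ this
  · refine ⟨?_⟩
    rw [Subgroup.index_comap]
    exact (Subgroup.instFiniteIndex_subgroupOf K.normalCore _).index_ne_zero
  · intro S x hx
    rw [Subgroup.mem_iInf] at hx ⊢
    intro T
    rw [Subgroup.mem_comap, retr_retr]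
    exact hx _

/-- The letters commuting with the support of an element and not belonging to it. -/
def link (cs : CoxeterSystem (coxMatrix Gr) W) (g : W) : Set I :=
  {t | t ∉ supp cs g ∧ ∀ s ∈ supp cs g, Gr.Adj s t}

theorem disjoint_link (g : W) : supp cs g ∩ link cs g = ∅ := by
  ext t
  simp only [Set.mem_inter_iff, Set.mem_empty_iff_false, iff_false, not_and]
  exact fun h h' => h'.1 h

theorem MinElt.exists_of_commute [Finite I] {g : W} (hg : MinElt cs g) {c : W}
    (hc : Commute g c) :
    ∃ l y, c = l * y ∧ l ∈ par cs (link cs g) ∧ Core cs g y ∧ Commute g y := by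
  obtain ⟨y, d, hy, hgy, hd, hyc⟩ := exists_core_of_mem_coreStab cs ⊥ hg (h := g) (k := c)
    (by intro S x hx; rw [Subgroup.mem_bot] at hx ⊢; rw [hx, map_one]) le_rfl
    (by rw [hc.eq, inv_mul_cancel]; exact one_mem _)
  refine ⟨d⁻¹, y, ?_, ?_, hy, hgy⟩
  · rw [← QuotientGroup.mk_mul, QuotientGroup.eq, Subgroup.mem_bot, inv_mul_eq_one] at hyc
    rw [hyc, inv_mul_cancel_left]
  · refine par_mono cs ?_ (inv_mem hd)
    intro t ht
    have h1 : t ∉ supp cs g := by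
      intro h
      obtain ⟨s, hs, hne, hadj⟩ := hg.exists_not_adj t h
      rcases ht s hs with h2 | h2
      · exact hne h2.symm
      · exact hadj h2.symm
    exact ⟨h1, fun s hs => (ht s hs).resolve_left fun h => h1 (h ▸ hs)⟩

theorem MinElt.exists_pow_mem_axis [Finite I] {g : W} (hg : MinElt cs g) {y : W}
    (hy : y ∈ par cs (supp cs g)) (hgy : Commute g y) : ∃ k, k ≠ 0 ∧ y ^ k ∈ axis cs g 1 := by
  have hcore : ∀ i : ℕ, Core cs g (y ^ i) := by
    intro i
    obtain ⟨l, y', h1, h2, h3, -⟩ := hg.exists_of_commute (hgy.pow_right i)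
    have h4 : l ∈ par cs (supp cs g) ⊓ par cs (link cs g) := by
      refine ⟨?_, h2⟩
      have := pow_mem hy i
      rw [h1] at this
      exact (Subgroup.mul_mem_cancel_right _ h3.1).1 this
    rw [par_inf, disjoint_link, mem_par_iff, retr_empty] at h4
    rwa [h1, ← h4, one_mul]
  have hfin := hg.finite_axisClass (n := 1) one_ne_zero
  obtain ⟨i, -, j, -, hne, hij⟩ := Set.infinite_univ.exists_ne_map_eq_of_mapsTo
    (f := fun i : ℕ => axisClass cs g 1 (y ^ i))
    (t := axisClass cs g 1 '' {y | Core cs g y}) (fun i _ => ⟨_, hcore i, rfl⟩) hfin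
  wlog hlt : i < j generalizing i j
  · exact this j i hne.symm hij.symm (by omega)
  refine ⟨j - i, by omega, ?_⟩
  have := inv_mul_mem_axis (pow_mem hy i) (pow_mem hy j) hij
  have h1 : y ^ j = y ^ i * y ^ (j - i) := by rw [← pow_add]; congr 1; omega
  rwa [h1, inv_mul_cancel_left] at this

end

section

variable {I W : Type*} [Group W] {Gr : SimpleGraph I} {cs : CoxeterSystem (coxMatrix Gr) W}

theorem length_retr_le (S : Set I) (x : W) : cs.length (retr cs S x) ≤ cs.length x := by
  classical
  have h := sum_length_comp_le cs (cl := fun i : I => decide (i ∈ S)) x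
  have h2 : ((fun i : I => decide (i ∈ S)) ⁻¹' {true}) = S := by ext; simp
  rw [Fintype.sum_bool, comp, h2] at h
  omega

theorem length_retr_add_length_retr_le {S T : Set I} (h : S ∩ T = ∅) (x : W) :
    cs.length (retr cs S x) + cs.length (retr cs T x) ≤ cs.length x := by
  classical
  have h1 := sum_length_comp_le cs (cl := fun i : I => decide (i ∈ S)) x
  have h2 : ((fun i : I => decide (i ∈ S)) ⁻¹' {true}) = S := by ext; simp
  have h3 : T ∩ ((fun i : I => decide (i ∈ S)) ⁻¹' {false}) = T := by
    ext i
    simp only [Set.mem_inter_iff, Set.mem_preimage, Set.mem_singleton_iff, decide_eq_false_iff_not,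
      and_iff_left_iff_imp]
    exact fun hT hS => (h ▸ (⟨hS, hT⟩ : i ∈ S ∩ T) : i ∈ (∅ : Set I))
  have h4 := length_retr_le (cs := cs) T (comp cs (fun i : I => decide (i ∈ S)) false x)
  rw [comp, retr_retr, h3] at h4
  rw [Fintype.sum_bool, comp, h2] at h1
  exact (Nat.add_le_add_left h4 _).trans h1

theorem retr_eq_one_of_disjoint {S T : Set I} (h : S ∩ T = ∅) {x : W} (hx : x ∈ par cs T) :
    retr cs S x = 1 := by
  rw [← retr_of_mem cs hx, retr_retr, h, retr_empty]

theorem supp_retr_subset (S : Set I) (x : W) : supp cs (retr cs S x) ⊆ supp cs x :=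
  fun _ hi => ((mem_par_iff_supp_subset cs).1 (retr_mem_par_of_mem cs (mem_par_supp cs x)) hi).2

theorem MinElt.length_le_of_exponents [Finite I] {g x : W} (hg : MinElt cs g)
    (hx : x ∈ par cs (supp cs g)) {a : Col cs g → ℤ}
    (ha : ∀ b, comp cs (col cs g) b x = factor cs g b ^ a b) (z : W) :
    cs.length x ≤ cs.length (z * x * z⁻¹) := by
  refine le_trans ?_ (sum_length_comp_le cs (col cs g) _)
  rw [(sep_col cs g).length_eq_sum hx]
  refine Finset.sum_le_sum fun b _ => ?_
  rw [map_mul, map_mul, map_inv, ha, (hg.cycMin_factor b).length_zpow]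
  exact (hg.cycMin_factor b).length_conj_zpow _ _

/-- The product of an element with nonzero exponents and a nontrivial element of the link has
conjugates of minimal length with strictly larger support. -/
theorem MinElt.exists_larger [Finite I] {g x l : W} (hg : MinElt cs g)
    (hx : x ∈ par cs (supp cs g)) {a : Col cs g → ℤ}
    (ha : ∀ b, comp cs (col cs g) b x = factor cs g b ^ a b) (ha0 : ∀ b, a b ≠ 0)
    (hl : l ∈ par cs (link cs g)) (hl1 : l ≠ 1) (he : x * l ∈ even cs) :
    ∃ z, MinElt cs (z * (x * l) * z⁻¹) ∧ supp cs g ⊂ supp cs (z * (x * l) * z⁻¹) := by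
  have hTL : supp cs g ∩ link cs g = ∅ := disjoint_link g
  have hLT : link cs g ∩ supp cs g = ∅ := by rw [Set.inter_comm, hTL]
  obtain ⟨v, -, hv⟩ := WellFounded.has_min
    (measure fun v => cs.length (retr cs (link cs g) v * l * (retr cs (link cs g) v)⁻¹)).wf
    Set.univ ⟨1, trivial⟩
  simp only [InvImage, not_lt, WellFoundedRelation.rel] at hv
  have hz : retr cs (link cs g) v ∈ par cs (link cs g) := retr_mem_par cs _ _
  generalize hzv : retr cs (link cs g) v = z at hv hz
  have hcomm : Commute x z := commute_of_mem_par cs (fun s hs t ht => ht.2 s hs) hx hz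
  have hw : z * (x * l) * z⁻¹ = x * (z * l * z⁻¹) := by
    rw [← mul_assoc, ← hcomm.eq]; group
  have hl0 : z * l * z⁻¹ ∈ par cs (link cs g) := mul_mem (mul_mem hz hl) (inv_mem hz)
  have hl01 : z * l * z⁻¹ ≠ 1 := by simpa using hl1
  have hmin : ∀ y ∈ par cs (link cs g),
      cs.length (z * l * z⁻¹) ≤ cs.length (y * (z * l * z⁻¹) * y⁻¹) := by
    intro y hy
    have := hv (y * v) trivial
    rw [map_mul, hzv, retr_of_mem cs hy] at this
    simpa [mul_assoc] using this
  refine ⟨z, MinElt.of_even cs (Subgroup.Normal.conj_mem inferInstance _ he z) fun y => ?_, ?_⟩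
  · rw [hw]
    refine (cs.length_mul_le _ _).trans
      (le_trans (Nat.add_le_add ?_ ?_) (length_retr_add_length_retr_le hTL _))
    · rw [map_mul, map_mul, map_mul, retr_eq_one_of_disjoint hTL hl0, retr_of_mem cs hx, mul_one,
        map_inv]
      exact hg.length_le_of_exponents hx ha _
    · rw [map_mul, map_mul, map_mul, retr_eq_one_of_disjoint hLT hx, retr_of_mem cs hl0, one_mul,
        map_inv]
      exact hmin _ (retr_mem_par cs _ _)
  · rw [hw]
    have h1 : ∀ b, comp cs (col cs g) b x = retr cs (supp cs g ∩ col cs g ⁻¹' {b}) (x * (z * l * z⁻¹)) := by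
      intro b
      rw [map_mul, retr_eq_one_of_disjoint (T := link cs g) _ hl0, mul_one, Set.inter_comm,
        ← retr_retr, retr_of_mem cs hx]
      rw [Set.inter_right_comm, hTL, Set.empty_inter]
    have h2 : retr cs (link cs g) (x * (z * l * z⁻¹)) = z * l * z⁻¹ := by
      rw [map_mul, retr_eq_one_of_disjoint hLT hx, one_mul, retr_of_mem cs hl0]
    refine (Set.ssubset_iff_of_subset ?_).2 ?_
    · intro s hs
      refine supp_retr_subset (supp cs g ∩ col cs g ⁻¹' {col cs g s}) _ ?_
      rw [← h1, ha, (hg.cycMin_factor _).supp_zpow (ha0 _), supp_factor]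
      exact ⟨hs, rfl⟩
    · obtain ⟨s, hs⟩ : (supp cs (z * l * z⁻¹)).Nonempty := by
        rw [Set.nonempty_iff_ne_empty, Ne, supp_eq_empty_iff]; exact hl01
      refine ⟨s, ?_, ((mem_par_iff_supp_subset cs).1 hl0 hs).1⟩
      rw [← h2] at hs
      exact supp_retr_subset _ _ hs

/-- Pairs of a group element mapping into the axis and its exponents. -/
noncomputable def axisRel {G : Type*} [Group G] (j : G →* W) (g : W) :
    Subgroup (G × Multiplicative (Col cs g → ℤ)) where
  carrier := {p | j p.1 ∈ par cs (supp cs g) ∧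
    ∀ b, comp cs (col cs g) b (j p.1) = factor cs g b ^ (p.2.toAdd b)}
  one_mem' := by simp [one_mem]
  mul_mem' := by
    rintro p q ⟨hp, hp'⟩ ⟨hq, hq'⟩
    refine ⟨by simpa using mul_mem hp hq, fun b => ?_⟩
    simp [hp', hq', zpow_add]
  inv_mem' := by
    rintro p ⟨hp, hp'⟩
    refine ⟨by simpa using hp, fun b => ?_⟩
    simp [hp']

variable (cs) in
theorem exists_maximal [Finite I] {G : Type*} [Group G] (j : G →* W)
    (hj : Function.Injective j) :
    ∃ g : G, j g ∈ even cs ∧ ∃ (w : W) (H : Subgroup (G × Multiplicative (Col cs w → ℤ))),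
      (∀ x, (x, 1) ∈ H → x = 1) ∧ ∀ c, Commute g c → ∃ k ≠ 0, ∃ a, (c ^ k, a) ∈ H := by
  classical
  let Q : ℕ → Prop := fun N => ∃ (g : G) (z : W), j g ∈ even cs ∧ MinElt cs (z * j g * z⁻¹) ∧
    (supp cs (z * j g * z⁻¹)).ncard = N
  have hQ : ∃ N, Q N := by
    obtain ⟨z, hz⟩ := exists_conj_minElt cs (one_mem (even cs))
    exact ⟨_, 1, z, by simp [one_mem], by simpa using hz, rfl⟩
  have hbd : ∀ N, Q N → N ≤ Nat.card I := by
    rintro _ ⟨g, z, -, -, rfl⟩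
    exact Set.ncard_le_card _
  obtain ⟨N, hN⟩ := hQ
  obtain ⟨g, z, hge, hmin, hcard⟩ := Nat.findGreatest_spec (P := Q) (hbd N hN) hN
  refine ⟨g, hge, z * j g * z⁻¹, axisRel ((MulAut.conj z).toMonoidHom.comp j) _, ?_, ?_⟩
  · rintro x ⟨h1, h2⟩
    have h3 := (sep_col cs _).ext h1 (one_mem _) fun b => by rw [h2 b]; simp
    simpa using (injective_iff_map_eq_one j).1 hj x (by simpa using h3)
  · intro c hc
    generalize hg0 : z * j g * z⁻¹ = g0 at hmin hcard
    obtain ⟨J, hJ⟩ : ∃ J : G →* W, J = (MulAut.conj z).toMonoidHom.comp j := ⟨_, rfl⟩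
    rw [← hJ]
    have hJg : J g = g0 := by rw [hJ, ← hg0]; simp
    have hJe : ∀ x, j x ∈ even cs ↔ J x ∈ even cs := by
      intro x
      rw [hJ]
      refine ⟨fun h => Subgroup.Normal.conj_mem inferInstance _ h z, fun h => ?_⟩
      simpa [mul_assoc] using Subgroup.Normal.conj_mem (H := even cs) inferInstance _ h z⁻¹
    have hcomm : Commute g0 (J c) := by rw [← hJg]; exact hc.map J
    obtain ⟨l, y, hly, hl, hy, hgy⟩ := hmin.exists_of_commute hcomm
    obtain ⟨k, hk, hyk⟩ := hmin.exists_pow_mem_axis hy.1 hgy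
    obtain ⟨m, hm, -, hme⟩ := Subgroup.exists_pow_mem_of_index_ne_zero
      (H := even cs) Subgroup.FiniteIndex.index_ne_zero (J c)
    have hcl : Commute l y := (commute_of_mem_par cs (fun s hs t ht => ht.2 s hs) hy.1 hl).symm
    have hpow : J (c ^ (k * m)) = y ^ (k * m) * l ^ (k * m) := by
      rw [map_pow, hly, hcl.mul_pow, (hcl.pow_pow _ _).eq]
    have hax : y ^ (k * m) ∈ axis cs g0 1 := by rw [pow_mul]; exact pow_mem hyk m
    obtain ⟨hyp, hya⟩ := mem_axis_iff.1 hax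
    choose a ha using hya
    have hl1 : l ^ (k * m) = 1 := by
      by_contra hne
      obtain ⟨n, hn⟩ : ∃ n : ℕ, ∀ b, (n : ℤ) + a b ≠ 0 := by
        refine ⟨1 + ∑ b, (a b).natAbs, fun b => ?_⟩
        have h : (a b).natAbs ≤ ∑ b, (a b).natAbs := Finset.single_le_sum
          (f := fun b => (a b).natAbs) (fun _ _ => Nat.zero_le _) (Finset.mem_univ b)
        generalize ∑ b, (a b).natAbs = e at h
        omega
      have hu : J (g ^ n * c ^ (k * m)) = (g0 ^ n * y ^ (k * m)) * l ^ (k * m) := by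
        rw [map_mul, map_pow, hJg, hpow, mul_assoc]
      have hue : J (g ^ n * c ^ (k * m)) ∈ even cs := by
        rw [map_mul, map_pow, map_pow]
        refine mul_mem (pow_mem ((hJe g).1 hge) _) ?_
        rw [mul_comm, pow_mul]
        exact pow_mem hme _
      have hue' := hue
      rw [hu] at hue'
      obtain ⟨v, hv1, hv2⟩ := hmin.exists_larger (a := fun b => (n : ℤ) + a b)
        (mul_mem (pow_mem (mem_par_supp cs g0) n) hyp)
        (fun b => by rw [map_mul, map_pow, ha, zpow_add, zpow_natCast]; simp) hn
        (pow_mem hl _) hne hue'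
      have hv3 : v * (g0 ^ n * y ^ (k * m) * l ^ (k * m)) * v⁻¹ =
          (v * z) * j (g ^ n * c ^ (k * m)) * (v * z)⁻¹ := by
        rw [← hu, hJ]; simp [mul_assoc]
      rw [hv3] at hv1 hv2
      have hlt := Set.ncard_lt_ncard hv2
      rw [hcard] at hlt
      have hq : Q (supp cs ((v * z) * j (g ^ n * c ^ (k * m)) * (v * z)⁻¹)).ncard :=
        ⟨_, _, (hJe _).2 hue, hv1, rfl⟩
      exact absurd (Nat.le_findGreatest (hbd _ hq) hq) (by omega)
    rw [hl1, mul_one] at hpow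
    refine ⟨k * m, by positivity, Multiplicative.ofAdd a, ?_⟩
    change J (c ^ (k * m)) ∈ _ ∧ ∀ b, comp cs (col cs g0) b (J (c ^ (k * m))) = _
    rw [hpow]
    exact ⟨hyp, fun b => by rw [ha b]; simp⟩

end

section

variable {C J : Type*} [Group C] (ψ : C →* AddMonoid.End (J → ℤ)) (rk : J → ℕ)

/-- An action by unitriangular matrices with respect to a rank function. -/
def Unitriangular : Prop :=
  ∀ c u j, (∀ k, rk k < rk j → u k = 0) → ψ c u j = u j

variable {ψ rk}

theorem act_mul (c d : C) (u : J → ℤ) : ψ (c * d) u = ψ c (ψ d u) := by rw [map_mul]; rfl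

theorem act_inv_act (c : C) (u : J → ℤ) : ψ c⁻¹ (ψ c u) = u := by
  rw [← act_mul, inv_mul_cancel, map_one]; rfl

/-- Sets of indices closed under decreasing the rank. -/
def RankClosed (rk : J → ℕ) (S : Finset J) : Prop := ∀ j ∈ S, ∀ k, rk k < rk j → k ∈ S

namespace Unitriangular

theorem eq_add (h : Unitriangular ψ rk) (c : C) {u v : J → ℤ} {j : J}
    (huv : ∀ k, rk k < rk j → u k = v k) : ψ c u j = ψ c v j + (u j - v j) := by
  have := h c (u - v) j fun k hk => by simp [huv k hk]
  rw [map_sub, Pi.sub_apply, Pi.sub_apply] at this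
  linarith

theorem congr (h : Unitriangular ψ rk) {S : Finset J} (hS : RankClosed rk S) (c : C)
    {u v : J → ℤ} (huv : ∀ k ∈ S, u k = v k) : ∀ k ∈ S, ψ c u k = ψ c v k := by
  intro k hk
  rw [h.eq_add c fun k' hk' => huv k' (hS k hk k' hk'), huv k hk, sub_self, add_zero]

variable (ψ) in
theorem dvd (c : C) {M : ℤ} {u v : J → ℤ} (huv : ∀ k, M ∣ u k - v k) (k : J) :
    M ∣ ψ c u k - ψ c v k := by
  choose t ht using huv
  have h1 : u - v = M • t := by ext k; simp [ht]
  have h2 := congrFun (congrArg (ψ c) h1) k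
  rw [map_sub, map_zsmul] at h2
  exact ⟨_, by simpa using h2⟩

/-- The stabiliser of the coordinates in `S` of a vector. -/
def stab (h : Unitriangular ψ rk) {S : Finset J} (hS : RankClosed rk S) (u : J → ℤ) :
    Subgroup C where
  carrier := {c | ∀ k ∈ S, ψ c u k = u k}
  one_mem' := by intro k _; rw [map_one]; rfl
  mul_mem' := by
    intro c d hc hd k hk
    rw [act_mul, h.congr hS c hd k hk, hc k hk]
  inv_mem' := by
    intro c hc k hk
    rw [← h.congr hS c⁻¹ hc k hk, act_inv_act]

variable (ψ) in
/-- The stabiliser of a vector modulo an integer. -/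
def modStab (M : ℕ) (u : J → ℤ) : Subgroup C where
  carrier := {c | ∀ k, (M : ℤ) ∣ ψ c u k - u k}
  one_mem' := by intro k; rw [map_one]; simp
  mul_mem' := by
    intro c d hc hd k
    rw [act_mul]
    simpa using dvd_add (dvd ψ c hd k) (hc k)
  inv_mem' := by
    intro c hc k
    have := dvd ψ c⁻¹ hc k
    rw [act_inv_act] at this
    rwa [dvd_sub_comm]

theorem finiteIndex_modStab [Finite J] {M : ℕ} (hM : M ≠ 0) (u : J → ℤ) :
    (modStab ψ M u).FiniteIndex := by
  have : NeZero M := ⟨hM⟩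
  refine finiteIndex_of_finite_range _ (fun c k => (ψ c u k : ZMod M)) (Set.toFinite _) ?_
  intro a b hab k
  have h : ∀ k, (M : ℤ) ∣ ψ b u k - ψ a u k := fun k =>
    (ZMod.intCast_eq_intCast_iff_dvd_sub _ _ _).1 (congrFun hab k)
  have := dvd ψ a⁻¹ h k
  rwa [act_inv_act, ← act_mul] at this

theorem exists_mul_act_eq_aux [Finite J] (h : Unitriangular ψ rk) (u w : J → ℤ) (S : Finset J) :
    RankClosed rk S → ∀ C0 : Subgroup C, C0.FiniteIndex → ∃ M : ℕ, M ≠ 0 ∧ ∀ c,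
      (∀ j ∈ S, (M : ℤ) ∣ ψ c u j - w j) → ∃ c0 ∈ C0, ∀ j ∈ S, ψ (c * c0) u j = w j := by
  classical
  induction S using Finset.induction_on_max_value rk with
  | empty => exact fun _ C0 _ => ⟨1, one_ne_zero, fun c _ => ⟨1, one_mem _, by simp⟩⟩
  | insert j S hjS hmax ih =>
    intro hS C0 hC0
    have hS' : RankClosed rk S := by
      intro a ha k hk
      refine (Finset.mem_insert.1 (hS a (Finset.mem_insert_of_mem ha) k hk)).resolve_left ?_
      rintro rfl
      exact absurd (hmax a ha) (by omega)
    have hlow : ∀ k, rk k < rk j → k ∈ S := by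
      intro k hk
      refine (Finset.mem_insert.1 (hS j (Finset.mem_insert_self _ _) k hk)).resolve_left ?_
      rintro rfl
      omega
    have hmul : ∀ c, ∀ d ∈ h.stab hS' u, ψ (c * d) u j = ψ c u j + (ψ d u j - u j) := by
      intro c d hd
      rw [act_mul, h.eq_add c fun k hk => hd k (hlow k hk)]
    let X : AddSubgroup ℤ :=
      { carrier := {n | ∃ c ∈ C0, c ∈ h.stab hS' u ∧ ψ c u j - u j = n}
        zero_mem' := ⟨1, one_mem _, one_mem _, by rw [map_one]; simp⟩
        add_mem' := by
          rintro _ _ ⟨c, hc, hc', rfl⟩ ⟨d, hd, hd', rfl⟩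
          exact ⟨c * d, mul_mem hc hd, mul_mem hc' hd', by rw [hmul c d hd']; ring⟩
        neg_mem' := by
          rintro _ ⟨c, hc, hc', rfl⟩
          refine ⟨c⁻¹, inv_mem hc, inv_mem hc', ?_⟩
          have := hmul c⁻¹ c hc'
          rw [inv_mul_cancel, map_one] at this
          simp only [AddMonoid.End.coe_one, id] at this
          linarith }
    obtain ⟨M₂, hM₂, hX⟩ : ∃ M₂ : ℕ, M₂ ≠ 0 ∧ ∀ c, (∀ k ∈ S, ψ c u k = w k) →
        (M₂ : ℤ) ∣ w j - ψ c u j → w j - ψ c u j ∈ X := by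
      obtain ⟨f, hf⟩ := Int.subgroup_cyclic X
      have hf' : ∀ n, n ∈ X ↔ f ∣ n := fun n => by
        rw [hf, AddSubgroup.mem_closure_singleton, Int.dvd_def]
        simp [mul_comm, eq_comm]
      by_cases hf0 : f = 0
      · by_cases hex : ∃ c, ∀ k ∈ S, ψ c u k = w k
        · obtain ⟨c, hc⟩ := hex
          refine ⟨(w j - ψ c u j).natAbs + 1, by omega, fun d hd hdvd => ?_⟩
          have hcd : c⁻¹ * d ∈ h.stab hS' u := by
            intro k hk
            rw [act_mul, h.congr hS' c⁻¹ (fun k hk => (hd k hk).trans (hc k hk).symm) k hk,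
              act_inv_act]
          have hpow : ∀ n : ℕ, ∀ e ∈ h.stab hS' u, ψ (e ^ n) u j - u j = n * (ψ e u j - u j) := by
            intro n e he
            induction n with
            | zero => rw [pow_zero, map_one]; simp
            | succ n ih =>
              rw [pow_succ, hmul _ _ he]
              push_cast
              linarith
          obtain ⟨m, hm, -, hmC⟩ := Subgroup.exists_pow_mem_of_index_ne_zero
            hC0.index_ne_zero (c⁻¹ * d)
          have h1 : ψ ((c⁻¹ * d) ^ m) u j - u j ∈ X := ⟨_, hmC, pow_mem hcd m, rfl⟩
          rw [hf', hf0, zero_dvd_iff, hpow m _ hcd] at h1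
          have h2 : ψ (c⁻¹ * d) u j - u j = 0 := by
            rcases mul_eq_zero.1 h1 with h1 | h1
            · simp at h1; omega
            · exact h1
          have h3 := hmul c _ hcd
          rw [mul_inv_cancel_left, h2, add_zero] at h3
          rw [h3] at hdvd ⊢
          have h4 : w j - ψ c u j = 0 := by
            by_contra hne
            have := Nat.le_of_dvd (Int.natAbs_pos.2 hne) (Int.natCast_dvd.1 hdvd)
            omega
          rw [h4]
          exact zero_mem X
        · exact ⟨1, one_ne_zero, fun c hc => absurd ⟨c, hc⟩ hex⟩
      · exact ⟨f.natAbs, by simpa using hf0, fun c _ hd => (hf' _).2 (by simpa using hd)⟩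
    have hfi := finiteIndex_modStab (ψ := ψ) hM₂ u
    obtain ⟨M₁, hM₁, hI⟩ := ih hS' (C0 ⊓ modStab ψ M₂ u) inferInstance
    refine ⟨M₁ * M₂, mul_ne_zero hM₁ hM₂, fun c hc => ?_⟩
    obtain ⟨c0, ⟨hc0, hc0'⟩, hw⟩ := hI c fun k hk =>
      dvd_trans ⟨M₂, by push_cast; ring⟩ (hc k (Finset.mem_insert_of_mem hk))
    obtain ⟨d, hd, hd', hdj⟩ := hX (c * c0) hw (by
      have h1 := dvd ψ c hc0' j
      have h2 : (M₂ : ℤ) ∣ ψ c u j - w j :=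
        dvd_trans ⟨M₁, by push_cast; ring⟩ (hc j (Finset.mem_insert_self _ _))
      rw [act_mul, dvd_sub_comm]
      simpa using dvd_add h1 h2)
    refine ⟨c0 * d, mul_mem hc0 hd, fun k hk => ?_⟩
    rw [← mul_assoc]
    rcases Finset.mem_insert.1 hk with rfl | hk
    · rw [hmul _ _ hd', hdj]; ring
    · rw [act_mul, h.congr hS' _ hd' k hk, hw k hk]

/-- Congruence separability of orbits of unitriangular actions. -/
theorem exists_act_eq [Finite J] (h : Unitriangular ψ rk) (u w : J → ℤ) :
    ∃ M : ℕ, M ≠ 0 ∧ ∀ c, (∀ j, (M : ℤ) ∣ ψ c u j - w j) → ∃ c', ψ c' u = w := by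
  have := Fintype.ofFinite J
  obtain ⟨M, hM, H⟩ := h.exists_mul_act_eq_aux u w Finset.univ (fun _ _ _ _ => Finset.mem_univ _)
    ⊤ inferInstance
  refine ⟨M, hM, fun c hc => ?_⟩
  obtain ⟨c0, -, h0⟩ := H c fun j _ => hc j
  exact ⟨c * c0, funext fun j => h0 j (Finset.mem_univ j)⟩

theorem act_eq_of_pow (h : Unitriangular ψ rk) {c : C} {n : ℕ} (hn : n ≠ 0) {u : J → ℤ}
    (hc : ψ (c ^ n) u = u) : ψ c u = u := by
  have key : ∀ m j, rk j < m → ψ c u j = u j := by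
    intro m
    induction m with
    | zero => intro j hj; omega
    | succ m ih =>
      intro j hj
      have h1 : ∀ i : ℕ, ψ (c ^ i) u j = u j + i * (ψ c u j - u j) := by
        intro i
        induction i with
        | zero => rw [pow_zero, map_one]; simp
        | succ i ih' =>
          rw [pow_succ, act_mul, h.eq_add _ fun k hk => ih k (by omega), ih']
          push_cast
          ring
      have h2 := h1 n
      rw [hc] at h2
      have h3 : (n : ℤ) * (ψ c u j - u j) = 0 := by linarith
      rcases mul_eq_zero.1 h3 with h3 | h3
      · simp at h3; omega
      · linarith
  exact funext fun j => key _ j (Nat.lt_succ_self _)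

end Unitriangular

end

section

variable {V : Type*} {Γ : SimpleGraph V}

/-- The homomorphism from a right-angled Artin group given by the images of the generators. -/
def raagLift {G : Type*} [Group G] (f : V → G) (h : ∀ u v, Γ.Adj u v → f u * f v = f v * f u) :
    RAAG Γ →* G :=
  PresentedGroup.toGroup (f := f) (by
    rintro _ ⟨u, v, huv, rfl⟩
    simp only [map_mul, map_inv, FreeGroup.lift_apply_of]
    rw [h u v huv]
    group)

theorem raagLift_of {G : Type*} [Group G] (f : V → G)
    (h : ∀ u v, Γ.Adj u v → f u * f v = f v * f u) (v : V) :
    raagLift f h (PresentedGroup.of v) = f v := PresentedGroup.toGroup.of _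

theorem raag_commute {u v : V} (h : Γ.Adj u v) :
    Commute (PresentedGroup.of u : RAAG Γ) (PresentedGroup.of v) := by
  have : (PresentedGroup.mk (raagRels Γ)) (FreeGroup.of u * FreeGroup.of v * (FreeGroup.of u)⁻¹ *
      (FreeGroup.of v)⁻¹) = 1 := PresentedGroup.one_of_mem ⟨u, v, h, rfl⟩
  simp only [map_mul, map_inv] at this
  rw [mul_inv_eq_one, mul_inv_eq_iff_eq_mul] at this
  exact this

variable {W : Type*} [Group W] (cs : CoxeterSystem (coxMatrix Γ) W)

/-- The ball in the word metric. -/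
abbrev Ball (d : ℕ) := {w : W // cs.length w ≤ d}

instance [Finite V] (d : ℕ) : Finite (Ball cs d) := (finite_length_le cs d).to_subtype

noncomputable instance [Finite V] (d : ℕ) : Fintype (Ball cs d) := Fintype.ofFinite _

open Classical in
/-- The operator on functions on the ball of precomposing with left multiplication by a simple
reflection where this decreases the length. -/
noncomputable def lowering (d : ℕ) (v : V) : Module.End ℤ (Ball cs d → ℤ) where
  toFun f w := if h : cs.IsLeftDescent w.1 v then f ⟨cs.simple v * w.1, (le_of_lt h).trans w.2⟩
    else 0
  map_add' f g := by
    ext w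
    by_cases h : cs.IsLeftDescent w.1 v <;> simp [h]
  map_smul' a f := by
    ext w
    by_cases h : cs.IsLeftDescent w.1 v <;> simp [h]

theorem lowering_of_isLeftDescent {d : ℕ} {v : V} {f : Ball cs d → ℤ} {w : W}
    (hw : cs.length w ≤ d) (h : cs.IsLeftDescent w v) :
    lowering cs d v f ⟨w, hw⟩ = f ⟨cs.simple v * w, (le_of_lt h).trans hw⟩ := dif_pos h

theorem lowering_of_not_isLeftDescent {d : ℕ} {v : V} {f : Ball cs d → ℤ} {w : W}
    (hw : cs.length w ≤ d) (h : ¬ cs.IsLeftDescent w v) :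
    lowering cs d v f ⟨w, hw⟩ = 0 := dif_neg h

theorem lowering_sq (d : ℕ) (v : V) : lowering cs d v * lowering cs d v = 0 := by
  refine LinearMap.ext fun f => funext fun ⟨w, hw⟩ => ?_
  change lowering cs d v (lowering cs d v f) ⟨w, hw⟩ = 0
  by_cases h : cs.IsLeftDescent w v
  · rw [lowering_of_isLeftDescent cs hw h, lowering_of_not_isLeftDescent]
    exact cs.isLeftDescent_iff_not_isLeftDescent_mul.1 h
  · rw [lowering_of_not_isLeftDescent cs hw h]

theorem lowering_comm (d : ℕ) {u v : V} (huv : Γ.Adj u v) :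
    lowering cs d u * lowering cs d v = lowering cs d v * lowering cs d u := by
  refine LinearMap.ext fun f => funext fun ⟨w, hw⟩ => ?_
  change lowering cs d u (lowering cs d v f) ⟨w, hw⟩ = lowering cs d v (lowering cs d u f) ⟨w, hw⟩
  have hu := isLeftDescent_simple_mul_iff cs huv.symm (w := w)
  have hv := isLeftDescent_simple_mul_iff cs huv (w := w)
  by_cases h1 : cs.IsLeftDescent w u <;> by_cases h2 : cs.IsLeftDescent w v
  · rw [lowering_of_isLeftDescent cs hw h1, lowering_of_isLeftDescent cs hw h2,
      lowering_of_isLeftDescent cs _ (hv.2 h2), lowering_of_isLeftDescent cs _ (hu.2 h1)]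
    congr 2
    rw [← mul_assoc, ← mul_assoc, simple_comm cs huv]
  · rw [lowering_of_isLeftDescent cs hw h1, lowering_of_not_isLeftDescent cs hw h2,
      lowering_of_not_isLeftDescent cs _ (hv.not.2 h2)]
  · rw [lowering_of_isLeftDescent cs hw h2, lowering_of_not_isLeftDescent cs hw h1,
      lowering_of_not_isLeftDescent cs _ (hu.not.2 h1)]
  · rw [lowering_of_not_isLeftDescent cs hw h1, lowering_of_not_isLeftDescent cs hw h2]

/-- The unipotent operator attached to a generator. -/
noncomputable def magnusUnit (d : ℕ) (v : V) : (Module.End ℤ (Ball cs d → ℤ))ˣ where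
  val := 1 + lowering cs d v
  inv := 1 - lowering cs d v
  val_inv := by
    rw [add_mul, mul_sub, mul_sub, lowering_sq]; simp
  inv_val := by
    rw [sub_mul, mul_add, mul_add, lowering_sq]; simp

/-- A truncated Magnus representation of a right-angled Artin group. -/
noncomputable def magnus (d : ℕ) : RAAG Γ →* Module.End ℤ (Ball cs d → ℤ) :=
  (Units.coeHom _).comp (raagLift (magnusUnit cs d) fun u v h => by
    ext1
    simp only [Units.val_mul, magnusUnit, add_mul, mul_add, lowering_comm cs d h]
    simp only [one_mul, mul_one]
    abel)

theorem magnus_of (d : ℕ) (v : V) :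
    magnus cs d (PresentedGroup.of v) = 1 + lowering cs d v := by
  rw [magnus, MonoidHom.comp_apply, raagLift_of]; rfl

theorem magnus_of_inv (d : ℕ) (v : V) :
    magnus cs d (PresentedGroup.of v)⁻¹ = 1 - lowering cs d v := by
  rw [magnus, MonoidHom.comp_apply, map_inv, raagLift_of]; rfl

theorem magnus_of_zpow (d : ℕ) (v : V) (k : ℤ) :
    magnus cs d (PresentedGroup.of v ^ k) = 1 + k • lowering cs d v := by
  induction k with
  | zero => simp
  | succ k ih =>
    rw [zpow_add_one, map_mul, ih, magnus_of, add_mul, mul_add, mul_add, smul_mul_assoc,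
      smul_mul_assoc, lowering_sq]
    simp only [one_mul, mul_one, smul_zero, add_zero, add_smul, one_smul]
    abel
  | pred k ih =>
    rw [zpow_sub_one, map_mul, ih, magnus_of_inv, add_mul, mul_sub, mul_sub, smul_mul_assoc,
      smul_mul_assoc, lowering_sq]
    simp only [one_mul, mul_one, smul_zero, sub_zero, sub_smul, one_smul]
    abel

theorem magnus_apply_of_forall {d : ℕ} (a : RAAG Γ) : ∀ {f : Ball cs d → ℤ} {w : Ball cs d},
    (∀ w' : Ball cs d, cs.length w'.1 < cs.length w.1 → f w' = 0) → magnus cs d a f w = f w := by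
  have key : ∀ {v : V} {f : Ball cs d → ℤ} {w : Ball cs d},
      (∀ w' : Ball cs d, cs.length w'.1 < cs.length w.1 → f w' = 0) → lowering cs d v f w = 0 := by
    rintro v f ⟨w, hw⟩ h
    by_cases h1 : cs.IsLeftDescent w v
    · rw [lowering_of_isLeftDescent cs hw h1]
      exact h _ h1
    · rw [lowering_of_not_isLeftDescent cs hw h1]
  have hmul : ∀ a b : RAAG Γ,
      (∀ {f : Ball cs d → ℤ} {w : Ball cs d},
        (∀ w' : Ball cs d, cs.length w'.1 < cs.length w.1 → f w' = 0) →
          magnus cs d a f w = f w) →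
      (∀ {f : Ball cs d → ℤ} {w : Ball cs d},
        (∀ w' : Ball cs d, cs.length w'.1 < cs.length w.1 → f w' = 0) →
          magnus cs d b f w = f w) →
      ∀ {f : Ball cs d → ℤ} {w : Ball cs d},
        (∀ w' : Ball cs d, cs.length w'.1 < cs.length w.1 → f w' = 0) →
          magnus cs d (a * b) f w = f w := by
    intro a b ha hb f w hf
    rw [map_mul]
    change magnus cs d a (magnus cs d b f) w = f w
    rw [ha, hb hf]
    intro w' hw'
    rw [hb fun w'' hw'' => hf _ (hw''.trans hw')]
    exact hf _ hw'
  have hgen : a ∈ Subgroup.closure (Set.range (PresentedGroup.of (rels := raagRels Γ))) := by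
    rw [PresentedGroup.closure_range_of]; trivial
  induction hgen using Subgroup.closure_induction'' with
  | mem x hx =>
    obtain ⟨v, rfl⟩ := hx
    intro f w hf
    rw [magnus_of, LinearMap.add_apply, Pi.add_apply, key hf, add_zero]; rfl
  | inv_mem x hx =>
    obtain ⟨v, rfl⟩ := hx
    intro f w hf
    rw [magnus_of_inv, LinearMap.sub_apply, Pi.sub_apply, key hf, sub_zero]; rfl
  | one => intro f w hf; rw [map_one]; rfl
  | mul a b _ _ ha hb => exact hmul a b ha hb

/-- The element given by a list of syllables. -/
def syllProd (l : List (V × ℤ)) : RAAG Γ := (l.map fun p => PresentedGroup.of p.1 ^ p.2).prod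

theorem exists_split_of_isLeftDescent {ω : List V} (hω : cs.IsReduced ω) {s : V}
    (hs : cs.IsLeftDescent (cs.wordProd ω) s) :
    ∃ α β, ω = α ++ s :: β ∧ ∀ t ∈ α, Γ.Adj s t := by
  induction ω with
  | nil =>
    unfold CoxeterSystem.IsLeftDescent at hs
    simp at hs
  | cons t ω ih =>
    by_cases hst : s = t
    · exact ⟨[], ω, by simp [hst], by simp⟩
    · have hω' : cs.IsReduced ω := by simpa using hω.drop 1
      have ht : cs.IsLeftDescent (cs.wordProd (t :: ω)) t := by
        unfold CoxeterSystem.IsLeftDescent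
        rw [hω.eq, cs.wordProd_cons, cs.simple_mul_simple_cancel_left, hω'.eq]
        simp
      have hadj : Γ.Adj s t := by
        rw [← cs.isRightDescent_inv_iff] at hs ht
        exact adj_of_isRightDescent cs hst hs ht
      rw [cs.wordProd_cons, isLeftDescent_simple_mul_iff cs hadj.symm] at hs
      obtain ⟨α, β, h1, h2⟩ := ih hω' hs
      refine ⟨t :: α, β, by rw [h1]; rfl, ?_⟩
      intro r hr
      rcases List.mem_cons.1 hr with rfl | hr
      · exact hadj
      · exact h2 r hr

theorem exists_shorter (l : List (V × ℤ)) (h : ¬ cs.IsReduced (l.map Prod.fst)) :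
    ∃ l' : List (V × ℤ), l'.length < l.length ∧
      (syllProd l' : RAAG Γ) = syllProd l := by
  induction l with
  | nil => exact absurd (by simp [CoxeterSystem.IsReduced]) h
  | cons p l ih =>
    by_cases hl : cs.IsReduced (l.map Prod.fst)
    · have hd : cs.IsLeftDescent (cs.wordProd (l.map Prod.fst)) p.1 := by
        by_contra hnd
        rw [cs.not_isLeftDescent_iff, hl.eq] at hnd
        refine h ?_
        unfold CoxeterSystem.IsReduced
        rw [List.map_cons, cs.wordProd_cons, hnd]
        simp
      obtain ⟨α, β, h1, h2⟩ := exists_split_of_isLeftDescent cs hl hd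
      obtain ⟨l1, l2, rfl, h3, h4⟩ := List.map_eq_append_iff.1 h1
      obtain ⟨q, l3, rfl, h5, h6⟩ := List.map_eq_cons_iff.1 h4
      refine ⟨l1 ++ (p.1, p.2 + q.2) :: l3, by simp, ?_⟩
      have hc : Commute ((PresentedGroup.of p.1 : RAAG Γ) ^ p.2) (syllProd l1) := by
        refine Commute.list_prod_right _ _ ?_
        intro x hx
        obtain ⟨r, hr, rfl⟩ := List.mem_map.1 hx
        refine (raag_commute (h2 r.1 ?_)).zpow_zpow _ _
        rw [← h3]
        exact List.mem_map_of_mem hr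
      unfold syllProd at hc ⊢
      simp only [List.map_append, List.map_cons, List.prod_append, List.prod_cons]
      rw [← mul_assoc _ (List.prod _), hc.eq, zpow_add, h5]
      simp only [mul_assoc]
    · obtain ⟨l', h1, h2⟩ := ih hl
      refine ⟨p :: l', by simpa using h1, ?_⟩
      unfold syllProd at h2 ⊢
      simp [h2]

theorem exists_syllProd_reduced (a : RAAG Γ) :
    ∃ l : List (V × ℤ), syllProd l = a ∧ cs.IsReduced (l.map Prod.fst) ∧ ∀ p ∈ l, p.2 ≠ 0 := by
  have hex : ∃ l : List (V × ℤ), syllProd l = a := by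
    have hgen : a ∈ Subgroup.closure (Set.range (PresentedGroup.of (rels := raagRels Γ))) := by
      rw [PresentedGroup.closure_range_of]; trivial
    induction hgen using Subgroup.closure_induction'' with
    | mem x hx =>
      obtain ⟨v, rfl⟩ := hx
      exact ⟨[(v, 1)], by simp [syllProd]⟩
    | inv_mem x hx =>
      obtain ⟨v, rfl⟩ := hx
      exact ⟨[(v, -1)], by simp [syllProd]⟩
    | one => exact ⟨[], rfl⟩
    | mul a b _ _ ha hb =>
      obtain ⟨l1, rfl⟩ := ha
      obtain ⟨l2, rfl⟩ := hb
      exact ⟨l1 ++ l2, by simp [syllProd]⟩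
  obtain ⟨l, hl, hmin⟩ := WellFounded.has_min
    (measure (List.length (α := V × ℤ))).wf {l | (syllProd l : RAAG Γ) = a} hex
  simp only [InvImage, WellFoundedRelation.rel] at hmin
  refine ⟨l, hl, ?_, ?_⟩
  · by_contra hred
    obtain ⟨l', h1, h2⟩ := exists_shorter cs l hred
    exact hmin l' (h2.trans hl) h1
  · rintro ⟨v, k⟩ hp rfl
    obtain ⟨l1, l2, rfl⟩ := List.append_of_mem hp
    refine hmin (l1 ++ l2) ?_ (by simp)
    simp only [Set.mem_ofPred_eq] at hl ⊢
    rw [← hl]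
    simp [syllProd]

theorem magnus_syllProd [DecidableEq W] {d : ℕ} (l : List (V × ℤ))
    (h : cs.IsReduced (l.map Prod.fst)) :
    (∀ w : Ball cs d, l.length < cs.length w.1 →
      magnus cs d (syllProd l) (fun w => if w.1 = 1 then 1 else 0) w = 0) ∧
    ∀ hw, magnus cs d (syllProd l) (fun w => if w.1 = 1 then 1 else 0)
      ⟨cs.wordProd (l.map Prod.fst), hw⟩ = (l.map Prod.snd).prod := by
  induction l with
  | nil =>
    refine ⟨?_, ?_⟩
    · rintro ⟨w, hw⟩ hlt
      have : w ≠ 1 := by rintro rfl; simp at hlt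
      simp [syllProd, this]
    · simp [syllProd]
  | cons p l ih =>
    have hl : cs.IsReduced (l.map Prod.fst) := by simpa using h.drop 1
    obtain ⟨ih1, ih2⟩ := ih hl
    have hcons : ∀ f : Ball cs d → ℤ, ∀ w, magnus cs d (syllProd (p :: l)) f w =
        magnus cs d (syllProd l) f w +
          p.2 * lowering cs d p.1 (magnus cs d (syllProd l) f) w := by
      intro f w
      have : (syllProd (p :: l) : RAAG Γ) = PresentedGroup.of p.1 ^ p.2 * syllProd l := by
        simp [syllProd]
      rw [this, map_mul, magnus_of_zpow]
      simp
    refine ⟨?_, ?_⟩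
    · rintro ⟨w, hw⟩ hlt
      rw [List.length_cons] at hlt
      simp only at hlt
      rw [hcons, ih1 _ (by simp only; omega), zero_add]
      by_cases hd : cs.IsLeftDescent w p.1
      · rw [lowering_of_isLeftDescent cs hw hd, ih1, mul_zero]
        rw [cs.isLeftDescent_iff] at hd
        simp only
        omega
      · rw [lowering_of_not_isLeftDescent cs hw hd, mul_zero]
    · intro hw
      have hlen := h.eq
      have hlen' := hl.eq
      have hsw : cs.simple p.1 * cs.wordProd (p.1 :: l.map Prod.fst) =
          cs.wordProd (l.map Prod.fst) := by
        rw [cs.wordProd_cons, cs.simple_mul_simple_cancel_left]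
      simp only [List.map_cons, List.length_cons, List.length_map] at hlen hlen' hw
      have hd : cs.IsLeftDescent (cs.wordProd (p.1 :: l.map Prod.fst)) p.1 := by
        unfold CoxeterSystem.IsLeftDescent
        rw [hlen, cs.wordProd_cons, cs.simple_mul_simple_cancel_left, hlen']
        omega
      simp only [List.map_cons]
      rw [hcons, ih1 _ (by simp only [hlen]; omega), zero_add, lowering_of_isLeftDescent cs _ hd,
        List.prod_cons]
      congr 1
      rw [← ih2 (by
        rw [cs.wordProd_cons] at hw hlen
        omega)]
      exact congrArg _ (Subtype.ext hsw)

/-- The truncated Magnus representations are jointly faithful. -/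
theorem eq_one_of_magnus {a : RAAG Γ} (h : ∀ d, magnus cs d a = 1) : a = 1 := by
  classical
  obtain ⟨l, rfl, h1, h2⟩ := exists_syllProd_reduced cs a
  have hlen := h1.eq
  have h3 := (magnus_syllProd cs (d := (l.map Prod.fst).length) l h1).2 hlen.le
  have hne : (l.map Prod.snd).prod ≠ 0 := by
    rw [Ne, List.prod_eq_zero_iff, List.mem_map]
    rintro ⟨p, hp, hp'⟩
    exact h2 p hp hp'
  rw [h] at h3
  by_contra hne1
  have hl : l ≠ [] := by rintro rfl; exact hne1 rfl
  have hw : cs.wordProd (l.map Prod.fst) ≠ 1 := by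
    intro h4
    rw [h4, cs.length_one] at hlen
    rw [List.length_map] at hlen
    exact hl (List.length_eq_zero_iff.1 hlen.symm)
  refine hne (h3.symm.trans ?_)
  simp [hw]

end

section

variable {V : Type*} {Γ : SimpleGraph V} {W : Type*} [Group W]
  (cs : CoxeterSystem (coxMatrix Γ) W)

theorem magnus_restrict {d e : ℕ} (hde : d ≤ e) (a : RAAG Γ) : ∀ (f : Ball cs e → ℤ),
    (fun w : Ball cs d => magnus cs e a f ⟨w.1, w.2.trans hde⟩) =
      magnus cs d a fun w => f ⟨w.1, w.2.trans hde⟩ := by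
  have key : ∀ (v : V) (f : Ball cs e → ℤ) (w : Ball cs d),
      lowering cs e v f ⟨w.1, w.2.trans hde⟩ =
        lowering cs d v (fun w => f ⟨w.1, w.2.trans hde⟩) w := by
    rintro v f ⟨w, hw⟩
    by_cases h : cs.IsLeftDescent w v
    · rw [lowering_of_isLeftDescent cs _ h, lowering_of_isLeftDescent cs _ h]
    · rw [lowering_of_not_isLeftDescent cs _ h, lowering_of_not_isLeftDescent cs _ h]
  induction a using PresentedGroup.induction_on with
  | _ z =>
    induction z using FreeGroup.induction_on with
    | C1 => intro f; simp
    | of v =>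
      intro f
      change (fun w : Ball cs d => magnus cs e (PresentedGroup.of v) f _) =
        magnus cs d (PresentedGroup.of v) _
      ext w
      simp [magnus_of, key]
    | inv_of v _ =>
      intro f
      change (fun w : Ball cs d => magnus cs e (PresentedGroup.of v)⁻¹ f _) =
        magnus cs d (PresentedGroup.of v)⁻¹ _
      ext w
      simp [magnus_of_inv, key]
    | mul x y hx hy =>
      intro f
      simp only [map_mul, Module.End.mul_apply]
      rw [← hy, ← hx]

theorem magnus_eq_of_le {d e : ℕ} (hde : d ≤ e) {a b : RAAG Γ}
    (h : magnus cs e a = magnus cs e b) : magnus cs d a = magnus cs d b := by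
  classical
  refine LinearMap.ext fun f => ?_
  have hf : f = fun w : Ball cs d => (fun w' : Ball cs e =>
      if hw : cs.length w'.1 ≤ d then f ⟨w'.1, hw⟩ else 0) ⟨w.1, w.2.trans hde⟩ := by
    ext ⟨w, hw⟩
    simp [hw]
  have key := fun a => magnus_restrict cs hde a fun w' : Ball cs e =>
    if hw : cs.length w'.1 ≤ d then f ⟨w'.1, hw⟩ else 0
  rw [hf, ← key, ← key, h]

variable [Finite V]

open Classical in
/-- The truncated Magnus representation in matrix form. -/
noncomputable def magnusMatrix (d : ℕ) : RAAG Γ →* Matrix (Ball cs d) (Ball cs d) ℤ :=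
  (LinearMap.toMatrixAlgEquiv' (R := ℤ) (n := Ball cs d) :
    Module.End ℤ (Ball cs d → ℤ) →* Matrix (Ball cs d) (Ball cs d) ℤ).comp (magnus cs d)

open Classical in
theorem magnusMatrix_apply {d : ℕ} (a : RAAG Γ) (i k : Ball cs d) :
    magnusMatrix cs d a i k = magnus cs d a (Pi.single k 1) i := by
  simp [magnusMatrix, LinearMap.toMatrixAlgEquiv'_apply]

theorem magnusMatrix_eq_iff {d : ℕ} {a b : RAAG Γ} :
    magnusMatrix cs d a = magnusMatrix cs d b ↔ magnus cs d a = magnus cs d b := by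
  classical
  exact (LinearMap.toMatrixAlgEquiv' (R := ℤ) (n := Ball cs d)).injective.eq_iff

theorem magnusMatrix_self {d : ℕ} (a : RAAG Γ) (i : Ball cs d) : magnusMatrix cs d a i i = 1 := by
  classical
  rw [magnusMatrix_apply, magnus_apply_of_forall, Pi.single_eq_same]
  intro w hw
  rw [Pi.single_eq_of_ne]
  rintro rfl
  exact lt_irrefl _ hw

theorem magnusMatrix_eq_zero {d : ℕ} (a : RAAG Γ) {i k : Ball cs d} (hik : i ≠ k)
    (h : cs.length i.1 ≤ cs.length k.1) : magnusMatrix cs d a i k = 0 := by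
  classical
  rw [magnusMatrix_apply, magnus_apply_of_forall, Pi.single_eq_of_ne hik]
  intro w hw
  rw [Pi.single_eq_of_ne]
  rintro rfl
  exact absurd hw h.not_gt

/-- The action of a right-angled Artin group on tuples of matrices by conjugation. -/
noncomputable def conjAct (X : Type*) (d : ℕ) :
    RAAG Γ →* AddMonoid.End (X × Ball cs d × Ball cs d → ℤ) where
  toFun c :=
    { toFun u p := (magnusMatrix cs d c * (Matrix.of fun k l => u (p.1, k, l)) *
        magnusMatrix cs d c⁻¹) p.2.1 p.2.2
      map_zero' := by
        ext p
        have : (Matrix.of fun k l => (0 : X × Ball cs d × Ball cs d → ℤ) (p.1, k, l)) = 0 := rfl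
        rw [this]
        simp
      map_add' u v := by
        ext p
        have : (Matrix.of fun k l => (u + v) (p.1, k, l)) =
          (Matrix.of fun k l => u (p.1, k, l)) + Matrix.of fun k l => v (p.1, k, l) := rfl
        rw [this, Matrix.mul_add, Matrix.add_mul]
        rfl }
  map_one' := by
    ext u p
    change (magnusMatrix cs d 1 * (Matrix.of fun k l => u (p.1, k, l)) *
      magnusMatrix cs d 1⁻¹) p.2.1 p.2.2 = u p
    simp
  map_mul' c c' := by
    ext u p
    change (magnusMatrix cs d (c * c') * (Matrix.of fun k l => u (p.1, k, l)) *
      magnusMatrix cs d (c * c')⁻¹) p.2.1 p.2.2 = (magnusMatrix cs d c *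
        (magnusMatrix cs d c' * (Matrix.of fun k l => u (p.1, k, l)) * magnusMatrix cs d c'⁻¹) *
          magnusMatrix cs d c⁻¹) p.2.1 p.2.2
    rw [mul_inv_rev, map_mul, map_mul]
    simp only [mul_assoc]

theorem conjAct_unitriangular (X : Type*) (d : ℕ) :
    Unitriangular (conjAct cs X d) fun p => cs.length p.2.1.1 + (d - cs.length p.2.2.1) := by
  rintro c u ⟨x, i, j⟩ h
  change (magnusMatrix cs d c * (Matrix.of fun k l => u (x, k, l)) *
    magnusMatrix cs d c⁻¹) i j = u (x, i, j)
  have hzero : ∀ k l, (k ≠ i ∨ l ≠ j) →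
      magnusMatrix cs d c i k * u (x, k, l) * magnusMatrix cs d c⁻¹ l j = 0 := by
    intro k l hkl
    by_cases h1 : k ≠ i ∧ cs.length i.1 ≤ cs.length k.1
    · rw [magnusMatrix_eq_zero cs c h1.1.symm h1.2, zero_mul, zero_mul]
    by_cases h2 : l ≠ j ∧ cs.length l.1 ≤ cs.length j.1
    · rw [magnusMatrix_eq_zero cs _ h2.1 h2.2, mul_zero]
    have hk : cs.length k.1 ≤ cs.length i.1 ∧ (k ≠ i → cs.length k.1 < cs.length i.1) := by
      by_cases hki : k = i
      · subst hki; simp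
      · simp only [ne_eq, hki, not_false_eq_true, true_and, forall_const] at h1 ⊢
        omega
    have hl : cs.length j.1 ≤ cs.length l.1 ∧ (l ≠ j → cs.length j.1 < cs.length l.1) := by
      by_cases hlj : l = j
      · subst hlj; simp
      · simp only [ne_eq, hlj, not_false_eq_true, true_and, forall_const] at h2 ⊢
        omega
    have := l.2
    have := j.2
    rw [h (x, k, l), mul_zero, zero_mul]
    change cs.length k.1 + (d - cs.length l.1) < cs.length i.1 + (d - cs.length j.1)
    rcases hkl with hkl | hkl
    · have := hk.2 hkl
      omega
    · have := hl.2 hkl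
      omega
  simp only [Matrix.mul_apply, Matrix.of_apply, Finset.sum_mul]
  rw [Finset.sum_eq_single j _ (by simp), Finset.sum_eq_single i _ (by simp),
    magnusMatrix_self, magnusMatrix_self, one_mul, mul_one]
  · exact fun k _ hk => hzero k j (Or.inl hk)
  · exact fun l _ hl => Finset.sum_eq_zero fun k _ => hzero k l (Or.inr hl)

/-- The coordinates of the matrices of a tuple of group elements. -/
noncomputable def matrixCoords {X : Type*} (d : ℕ) (y : X → RAAG Γ) :
    X × Ball cs d × Ball cs d → ℤ := fun p => magnusMatrix cs d (y p.1) p.2.1 p.2.2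

theorem conjAct_matrixCoords {X : Type*} (d : ℕ) (c : RAAG Γ) (y : X → RAAG Γ) :
    conjAct cs X d c (matrixCoords cs d y) = matrixCoords cs d fun x => c * y x * c⁻¹ := by
  ext p
  change (magnusMatrix cs d c * magnusMatrix cs d (y p.1) * magnusMatrix cs d c⁻¹) p.2.1 p.2.2 = _
  rw [← map_mul, ← map_mul]
  rfl

theorem matrixCoords_eq_iff {X : Type*} {d : ℕ} {y z : X → RAAG Γ} :
    matrixCoords cs d y = matrixCoords cs d z ↔ ∀ x, magnus cs d (y x) = magnus cs d (z x) := by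
  simp only [← magnusMatrix_eq_iff]
  constructor
  · intro h x
    ext i j
    exact congrFun h (x, i, j)
  · intro h
    ext p
    exact congrFun (congrFun (h p.1) _) _

theorem exists_congruence_subgroup (d : ℕ) {M : ℕ} (hM : M ≠ 0) :
    ∃ N : Subgroup (RAAG Γ), N.Normal ∧ N.FiniteIndex ∧ ∀ a b, a⁻¹ * b ∈ N →
      ∀ i j, (M : ℤ) ∣ magnusMatrix cs d a i j - magnusMatrix cs d b i j := by
  classical
  have : NeZero M := ⟨hM⟩
  let f : RAAG Γ →* Matrix (Ball cs d) (Ball cs d) (ZMod M) :=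
    (RingHom.mapMatrix (Int.castRingHom (ZMod M))).toMonoidHom.comp (magnusMatrix cs d)
  have hf : ∀ a b, a⁻¹ * b ∈ f.ker → f a = f b := by
    intro a b h
    rw [MonoidHom.mem_ker] at h
    calc f a = f a * f (a⁻¹ * b) := by rw [h, mul_one]
      _ = f b := by rw [← map_mul, mul_inv_cancel_left]
  refine ⟨f.ker, inferInstance, finiteIndex_of_finite_range _ f (Set.toFinite _) ?_, ?_⟩
  · intro a b h
    rw [MonoidHom.mem_ker, map_mul, ← h, ← map_mul, inv_mul_cancel, map_one]
  · intro a b h i j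
    have := congrFun (congrFun (hf a b h) i) j
    rw [← ZMod.intCast_zmod_eq_zero_iff_dvd, Int.cast_sub, sub_eq_zero]
    exact this

end

section

/-- A descending chain of groups of integer vectors is constant up to torsion from some point. -/
theorem exists_forall_smul_mem {β : Type*} [Finite β] (E : ℕ → AddSubgroup (β → ℤ))
    (hE : Antitone E) : ∃ n, ∀ m, n ≤ m → ∀ a ∈ E n, ∃ k : ℤ, k ≠ 0 ∧ k • a ∈ E m := by
  let f n := Module.finrank ℤ (AddSubgroup.toIntSubmodule (E n))
  refine ⟨Function.argmin f, fun m hm a ha => ?_⟩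
  have hle : AddSubgroup.toIntSubmodule (E m) ≤ AddSubgroup.toIntSubmodule (E _) := hE hm
  have h1 : f (Function.argmin f) ≤ f m := Function.argmin_le f m
  let N := (AddSubgroup.toIntSubmodule (E m)).comap
    (AddSubgroup.toIntSubmodule (E (Function.argmin f))).subtype
  have h2 : Module.finrank ℤ N = f m := (Submodule.comapSubtypeEquivOfLe hle).finrank_eq
  have h3 := Submodule.finrank_quotient_add_finrank N
  have h4 : Module.finrank ℤ (_ ⧸ N) = 0 := by
    have : f (Function.argmin f) = Module.finrank ℤ
      (AddSubgroup.toIntSubmodule (E (Function.argmin f))) := rfl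
    omega
  obtain ⟨k, hk, hk'⟩ := Module.finrank_eq_zero_iff.1 h4 (N.mkQ ⟨a, ha⟩)
  refine ⟨k, hk, ?_⟩
  rw [← map_smul, Submodule.mkQ_apply, Submodule.Quotient.mk_eq_zero] at hk'
  exact hk'

theorem exists_forall_eq_of_antitone {C β : Type*} [Group C] [Finite β]
    (H : Subgroup (C × Multiplicative (β → ℤ))) (h1 : ∀ x, (x, 1) ∈ H → x = 1)
    (h2 : ∀ c, ∃ k : ℕ, k ≠ 0 ∧ ∃ a, (c ^ k, a) ∈ H) (D : ℕ → Subgroup C) (hD : Antitone D)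
    (hpow : ∀ n c (k : ℕ), k ≠ 0 → c ^ k ∈ D n → c ∈ D n) : ∃ n, ∀ m, n ≤ m → D n ≤ D m := by
  let E n : AddSubgroup (β → ℤ) :=
    Subgroup.toAddSubgroup' ((H ⊓ (D n).comap (MonoidHom.fst _ _)).map (MonoidHom.snd _ _))
  have hE : ∀ n a, a ∈ E n ↔ ∃ x, (x, Multiplicative.ofAdd a) ∈ H ∧ x ∈ D n := by
    intro n a
    constructor
    · rintro ⟨⟨x, b⟩, ⟨h, h'⟩, rfl⟩
      exact ⟨x, h, h'⟩
    · rintro ⟨x, h, h'⟩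
      exact ⟨(x, Multiplicative.ofAdd a), ⟨h, h'⟩, rfl⟩
  obtain ⟨n, hn⟩ := exists_forall_smul_mem E fun n m hnm a ha => by
    rw [hE] at ha ⊢
    obtain ⟨x, h, h'⟩ := ha
    exact ⟨x, h, hD hnm h'⟩
  refine ⟨n, fun m hm c hc => ?_⟩
  obtain ⟨k, hk, a, ha⟩ := h2 c
  obtain ⟨l, hl, h⟩ := hn m hm (Multiplicative.toAdd a)
    ((hE _ _).2 ⟨_, ha, pow_mem hc k⟩)
  obtain ⟨x, hx, hxm⟩ := (hE _ _).1 h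
  have hx' : (c ^ k) ^ l = x := by
    rw [← mul_inv_eq_one]
    apply h1
    convert mul_mem (zpow_mem ha l) (inv_mem hx) using 1
    ext1
    · rfl
    · exact (mul_inv_cancel _).symm
  refine hpow m c (k * l.natAbs) (mul_ne_zero hk (Int.natAbs_ne_zero.2 hl)) ?_
  rw [pow_mul]
  rcases Int.natAbs_eq l with h | h
  · rw [← zpow_natCast, ← h, hx']; exact hxm
  · rw [h, zpow_neg] at hx'
    rw [← zpow_natCast, ← inv_mem_iff, hx']
    exact hxm

/-- A conjugacy problem for tuples of elements of a right-angled Artin group that is soluble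
modulo all subgroups of finite index is soluble. -/
theorem exists_conj_of_forall {V : Type*} {Γ : SimpleGraph V} [Finite V] {C X β : Type*} [Group C] [Finite β] [Finite X]
    (i : C →* RAAG Γ)   (H : Subgroup (C × Multiplicative (β → ℤ))) (h1 : ∀ x, (x, 1) ∈ H → x = 1)
    (h2 : ∀ c, ∃ k : ℕ, k ≠ 0 ∧ ∃ a, (c ^ k, a) ∈ H) (y z : X → RAAG Γ)
    (h : ∀ N : Subgroup (RAAG Γ), N.Normal → N.FiniteIndex →
      ∃ c, ∀ x, (i c * y x * (i c)⁻¹)⁻¹ * z x ∈ N) :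
    ∃ c, ∀ x, i c * y x * (i c)⁻¹ = z x := by
  let cs := (coxMatrix Γ).toCoxeterSystem
  let ψ d : C →* _ := (conjAct cs X d).comp i
  have hψ : ∀ d, Unitriangular (ψ d) _ := fun d c => conjAct_unitriangular cs X d (i c)
  have hiff : ∀ d c (u v : X → RAAG Γ), ψ d c (matrixCoords cs d u) = matrixCoords cs d v ↔
      ∀ x, magnus cs d (i c * u x * (i c)⁻¹) = magnus cs d (v x) := by
    intro d c u v
    rw [← matrixCoords_eq_iff, ← conjAct_matrixCoords]
    rfl
  have hanti : ∀ {d e} c (u v : X → RAAG Γ), d ≤ e →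
      ψ e c (matrixCoords cs e u) = matrixCoords cs e v →
      ψ d c (matrixCoords cs d u) = matrixCoords cs d v := by
    intro d e c u v hde
    rw [hiff, hiff]
    exact fun h x => magnus_eq_of_le cs hde (h x)
  let D d : Subgroup C :=
    { carrier := {c | ψ d c (matrixCoords cs d y) = matrixCoords cs d y}
      one_mem' := by rw [Set.mem_ofPred_eq, map_one]; rfl
      mul_mem' := by
        intro a b ha hb
        rw [Set.mem_ofPred_eq] at ha hb ⊢
        rw [act_mul, hb, ha]
      inv_mem' := by
        intro a ha
        rw [Set.mem_ofPred_eq] at ha ⊢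
        conv_lhs => rw [← ha]
        rw [act_inv_act] }
  obtain ⟨n, hn⟩ := exists_forall_eq_of_antitone H h1 h2 D (fun d e hde c => hanti c y y hde)
    fun d c k hk => (hψ d).act_eq_of_pow hk
  have hS : ∀ d, ∃ c, ψ d c (matrixCoords cs d y) = matrixCoords cs d z := by
    intro d
    obtain ⟨M, hM, hM'⟩ := (hψ d).exists_act_eq (matrixCoords cs d y) (matrixCoords cs d z)
    obtain ⟨N, hN, hN', hN''⟩ := exists_congruence_subgroup cs d hM
    obtain ⟨c, hc⟩ := h N hN hN'
    refine hM' c fun j => ?_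
    have := hN'' _ _ (hc j.1) j.2.1 j.2.2
    change (M : ℤ) ∣ conjAct cs X d (i c) _ j - _
    rw [conjAct_matrixCoords]
    exact this
  obtain ⟨c, hc⟩ := hS n
  refine ⟨c, fun x => ?_⟩
  rw [← inv_mul_eq_one]
  refine eq_one_of_magnus cs fun d => ?_
  obtain ⟨c', hc'⟩ := hS (max n d)
  have hcc : c'⁻¹ * c ∈ D (max n d) := by
    refine hn _ (le_max_left _ _) ?_
    change ψ n _ _ = _
    rw [act_mul, hc, ← hanti _ _ _ (le_max_left _ _) hc', act_inv_act]
  have hm : ψ (max n d) c (matrixCoords cs _ y) = matrixCoords cs _ z := by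
    rw [← hc', ← mul_inv_cancel_left c' c, act_mul]
    congr 1
  have := (hiff _ _ _ _).1 (hanti _ _ _ (le_max_right n d) hm) x
  rw [map_mul, ← this, ← map_mul, inv_mul_cancel, map_one]

end

section

variable {V : Type*} (Γ : SimpleGraph V)

/-- The defining graph of a right-angled Coxeter group commensurable with a right-angled Artin
group. -/
def doubleGraph : SimpleGraph (V ⊕ V) where
  Adj
    | .inl v, .inl w => v ≠ w
    | .inl v, .inr w => v ≠ w
    | .inr v, .inl w => v ≠ w
    | .inr v, .inr w => Γ.Adj v w
  symm := ⟨by rintro (v | v) (w | w) h <;> exact h.symm⟩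
  loopless := ⟨by
    rintro (v | v) h
    · exact h rfl
    · exact Γ.loopless.irrefl v h⟩

variable {Γ} {W : Type*} [Group W] (cs : CoxeterSystem (coxMatrix (doubleGraph Γ)) W)

theorem simple_inl_comm (v w : V) : cs.simple (.inl v) * cs.simple (.inl w) =
    cs.simple (.inl w) * cs.simple (.inl v) := by
  by_cases h : v = w
  · rw [h]
  · exact simple_comm cs (show (doubleGraph Γ).Adj (.inl v) (.inl w) from h)

theorem simple_inl_inr_comm {v w : V} (h : v ≠ w) : cs.simple (.inl v) * cs.simple (.inr w) =
    cs.simple (.inr w) * cs.simple (.inl v) :=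
  simple_comm cs (show (doubleGraph Γ).Adj (.inl v) (.inr w) from h)

/-- The embedding of a right-angled Artin group in a right-angled Coxeter group. -/
noncomputable def toCoxeter : RAAG Γ →* W :=
  raagLift (fun v => cs.simple (.inl v) * cs.simple (.inr v)) fun u v h =>
    Commute.mul_left
      (Commute.mul_right (simple_inl_comm cs u v) (simple_inl_inr_comm cs h.ne))
      (Commute.mul_right (simple_inl_inr_comm cs h.ne').symm
        (simple_comm cs (show (doubleGraph Γ).Adj (.inr u) (.inr v) from h)))

theorem toCoxeter_of (v : V) :
    toCoxeter cs (PresentedGroup.of v) = cs.simple (.inl v) * cs.simple (.inr v) :=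
  raagLift_of _ _ v

open Classical in
/-- The automorphism of a right-angled Artin group inverting one generator. -/
noncomputable def inversion (v : V) : RAAG Γ →* RAAG Γ :=
  raagLift (fun u => if u = v then (PresentedGroup.of u)⁻¹ else PresentedGroup.of u) fun u w h => by
    have h' := raag_commute h
    split_ifs
    · exact h'.inv_inv
    · exact h'.inv_left
    · exact h'.inv_right
    · exact h'

theorem inversion_of_self (v : V) :
    inversion (Γ := Γ) v (PresentedGroup.of v) = (PresentedGroup.of v)⁻¹ := by
  rw [inversion, raagLift_of, if_pos rfl]

theorem inversion_of_ne {u v : V} (h : u ≠ v) :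
    inversion (Γ := Γ) v (PresentedGroup.of u) = PresentedGroup.of u := by
  rw [inversion, raagLift_of, if_neg h]

theorem inversion_inversion (v : V) (x : RAAG Γ) : inversion v (inversion v x) = x := by
  have : (inversion v).comp (inversion v) = MonoidHom.id (RAAG Γ) := by
    refine PresentedGroup.ext fun u => ?_
    by_cases h : u = v
    · subst h
      simp [inversion_of_self]
    · simp [inversion_of_ne h]
  exact DFunLike.congr_fun this x

theorem inversion_comm {u v : V} (huv : u ≠ v) (x : RAAG Γ) :
    inversion u (inversion v x) = inversion v (inversion u x) := by
  have : (inversion u).comp (inversion v) = (inversion v).comp (inversion (Γ := Γ) u) := by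
    refine PresentedGroup.ext fun w => ?_
    by_cases h : w = v
    · subst h
      simp [inversion_of_self, inversion_of_ne huv.symm]
    · by_cases h' : w = u
      · subst h'
        simp [inversion_of_self, inversion_of_ne huv]
      · simp [inversion_of_ne h, inversion_of_ne h']
  exact DFunLike.congr_fun this x

/-- The action of the generating reflections on a right-angled Artin group. -/
noncomputable def reflection : V ⊕ V → Equiv.Perm (RAAG Γ)
  | .inl v => Function.Involutive.toPerm (inversion v) (inversion_inversion v)
  | .inr v => Function.Involutive.toPerm (fun x => inversion v (PresentedGroup.of v * x)) fun x => by
      simp only [map_mul, inversion_of_self, inversion_inversion, mul_inv_cancel_left]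

theorem reflection_inl (v : V) (x : RAAG Γ) : reflection (.inl v) x = inversion v x := rfl

theorem reflection_inr (v : V) (x : RAAG Γ) :
    reflection (.inr v) x = (PresentedGroup.of v)⁻¹ * inversion v x := by
  change inversion v (PresentedGroup.of v * x) = _
  rw [map_mul, inversion_of_self]

/-- The action of the right-angled Coxeter group on the right-angled Artin group. -/
noncomputable def coxeterAction : W →* Equiv.Perm (RAAG Γ) :=
  liftInv cs reflection
    (by
      rintro (v | v) <;> ext x <;> rw [Equiv.Perm.mul_apply]
      · exact inversion_inversion v x
      · rw [reflection_inr, reflection_inr, map_mul, map_inv, inversion_of_self,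
          inversion_inversion, inv_inv, inv_mul_cancel_left, Equiv.Perm.one_apply])
    (by
      rintro (v | v) (w | w) h <;> ext x
      · exact inversion_comm h x
      · simp only [Equiv.Perm.mul_apply, reflection_inl, reflection_inr, map_mul, map_inv,
          inversion_of_ne (Ne.symm h), inversion_comm h]
      · simp only [Equiv.Perm.mul_apply, reflection_inl, reflection_inr, map_mul, map_inv,
          inversion_of_ne h, inversion_comm h]
      · have h' : Γ.Adj v w := h
        simp only [Equiv.Perm.mul_apply, reflection_inr, map_mul, map_inv,
          inversion_of_ne h'.ne, inversion_of_ne h'.ne', inversion_comm h'.ne, ← mul_assoc]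
        rw [(raag_commute h').inv_inv.eq])

theorem toCoxeter_injective : Function.Injective (toCoxeter cs) := by
  have : (coxeterAction cs).comp (toCoxeter cs) = MulAction.toPermHom (RAAG Γ) (RAAG Γ) := by
    refine PresentedGroup.ext fun v => ?_
    ext x
    rw [MonoidHom.comp_apply, toCoxeter_of, map_mul, coxeterAction, liftInv_simple, liftInv_simple,
      Equiv.Perm.mul_apply, reflection_inl, reflection_inr, map_mul, inversion_inversion, map_inv,
      inversion_of_self, inv_inv]
    rfl
  intro a b h
  have h2 := DFunLike.congr_fun (congrArg (coxeterAction cs) h) 1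
  rw [← MonoidHom.comp_apply, ← MonoidHom.comp_apply, this] at h2
  simpa using h2

theorem toCoxeter_range_normal : (toCoxeter cs).range.Normal := by
  have hgen : ∀ v, cs.simple (.inl v) * cs.simple (.inr v) ∈ (toCoxeter cs).range := fun v =>
    ⟨_, toCoxeter_of cs v⟩
  have hinl : ∀ v, ∀ x ∈ (toCoxeter cs).range,
      cs.simple (.inl v) * x * (cs.simple (.inl v))⁻¹ ∈ (toCoxeter cs).range := by
    rintro v _ ⟨x, rfl⟩
    have : (MulAut.conj (cs.simple (.inl v))).toMonoidHom.comp (toCoxeter cs) =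
        (toCoxeter cs).comp (inversion v) := by
      refine PresentedGroup.ext fun w => ?_
      by_cases h : w = v
      · subst h
        simp [inversion_of_self, toCoxeter_of]
      · have h1 := simple_inl_comm cs v w
        have h2 := simple_inl_inr_comm cs (Ne.symm h)
        simp only [MonoidHom.comp_apply, inversion_of_ne h, toCoxeter_of, MulEquiv.toMonoidHom_eq_coe,
          MonoidHom.coe_coe, MulAut.conj_apply]
        rw [← mul_assoc, h1, mul_assoc _ _ (cs.simple (.inr w)), h2, mul_assoc, mul_assoc,
          mul_inv_cancel, mul_one]
    exact ⟨inversion v x, (DFunLike.congr_fun this x).symm⟩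
  refine ⟨fun x hx w => ?_⟩
  induction w using cs.simple_induction generalizing x with
  | simple i =>
    rcases i with v | v
    · exact hinl v x hx
    · have h := hinl v _ (mul_mem (mul_mem (hgen v) hx) (inv_mem (hgen v)))
      convert h using 1
      rw [mul_inv_rev, cs.inv_simple, cs.inv_simple]
      simp only [← mul_assoc, cs.simple_mul_simple_self, one_mul]
      rw [mul_assoc _ _ (cs.simple (.inl v)), cs.simple_mul_simple_self, mul_one]
  | one => simpa using hx
  | mul w w' h h' =>
    convert h _ (h' _ hx) using 1
    group

theorem finite_closure_of_commute {G : Type*} [Group G] {s : Set G} (hs : s.Finite)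
    (h2 : ∀ x ∈ s, x * x = 1) (hc : ∀ x ∈ s, ∀ y ∈ s, x * y = y * x) :
    Finite (Subgroup.closure s) := by
  have := Subgroup.isMulCommutative_closure hc
  let : CommGroup (Subgroup.closure s) := { mul_comm := mul_comm' }
  have : Group.FG (Subgroup.closure s) :=
    (Group.fg_iff_subgroup_fg _).2 ((Subgroup.fg_iff _).2 ⟨s, rfl, hs⟩)
  refine CommGroup.finite_of_fg_isMulTorsion _ fun x => ?_
  rw [isOfFinOrder_iff_pow_eq_one]
  refine ⟨2, by simp, ?_⟩
  obtain ⟨x, hx⟩ := x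
  ext1
  change x ^ 2 = 1
  induction hx using Subgroup.closure_induction with
  | mem x hx => rw [pow_two, h2 x hx]
  | one => simp
  | inv x _ hx => rw [inv_pow, hx, inv_one]
  | mul x y hx' hy' hx hy =>
    have hxy : Commute x y := congrArg Subtype.val
      (mul_comm (⟨x, hx'⟩ : Subgroup.closure s) ⟨y, hy'⟩)
    rw [hxy.mul_pow, hx, hy, one_mul]

theorem toCoxeter_range_finiteIndex [Finite V] : (toCoxeter cs).range.FiniteIndex := by
  have := toCoxeter_range_normal cs
  let S := Subgroup.closure (Set.range fun v => cs.simple (.inl v))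
  have : Finite S := finite_closure_of_commute (Set.finite_range _)
    (by rintro _ ⟨v, rfl⟩; exact cs.simple_mul_simple_self _)
    (by rintro _ ⟨v, rfl⟩ _ ⟨w, rfl⟩; exact simple_inl_comm cs v w)
  have hinl : ∀ v, cs.simple (.inl v) ∈ S := fun v => Subgroup.subset_closure ⟨v, rfl⟩
  have htop : S ⊔ (toCoxeter cs).range = ⊤ := by
    rw [eq_top_iff, ← cs.subgroup_closure_range_simple, Subgroup.closure_le]
    rintro _ ⟨v | v, rfl⟩
    · exact Subgroup.mem_sup_left (hinl v)
    · have h := mul_mem (Subgroup.mem_sup_left (hinl v) : _ ∈ S ⊔ (toCoxeter cs).range)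
        (Subgroup.mem_sup_right ⟨_, toCoxeter_of cs v⟩)
      rwa [cs.simple_mul_simple_cancel_left] at h
  refine ⟨?_⟩
  rw [← Subgroup.relIndex_top_right, ← htop, Subgroup.relIndex_sup_right]
  exact Subgroup.FiniteIndex.index_ne_zero

end

section

/-- An automorphism inducing an inner automorphism on every finite quotient. -/
def ProfinitelyInner {G : Type*} [Group G] (φ : MulAut G) : Prop :=
  ∀ N : Subgroup G, N.Normal → N.FiniteIndex → ∃ c, ∀ x, (c * x * c⁻¹)⁻¹ * φ x ∈ N

theorem exists_characteristic_le {G : Type*} [Group G] [Group.FG G] (N : Subgroup G) [N.Normal]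
    [N.FiniteIndex] : ∃ N' ≤ N, N'.Characteristic ∧ N'.FiniteIndex := by
  obtain ⟨S, hS⟩ := Group.fg_def.1 ‹Group.FG G›
  have : Finite (G →* G ⧸ N) := by
    refine Finite.of_injective (β := S → G ⧸ N) (fun f x => f x) fun f f' h => ?_
    exact MonoidHom.eq_of_eqOn_dense hS fun x hx => congrFun h ⟨x, hx⟩
  refine ⟨⨅ f : G →* G ⧸ N, f.ker, ?_, ?_, Subgroup.finiteIndex_iInf fun f =>
    finiteIndex_of_finite_range _ f (Set.toFinite _) fun a b h => ?_⟩
  · intro x hx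
    have := Subgroup.mem_iInf.1 hx (QuotientGroup.mk' N)
    rwa [QuotientGroup.ker_mk'] at this
  · refine Subgroup.characteristic_iff_le_comap.2 fun φ x hx => ?_
    rw [Subgroup.mem_comap, Subgroup.mem_iInf]
    exact fun f => Subgroup.mem_iInf.1 hx (f.comp φ.toMonoidHom)
  · rw [MonoidHom.mem_ker, map_mul, ← h, ← map_mul, inv_mul_cancel, map_one]

/-- The action of automorphisms on the quotient by a characteristic subgroup. -/
def quotientAut {G : Type*} [Group G] (N : Subgroup G) [hN : N.Characteristic] :
    MulAut G →* MulAut (G ⧸ N) where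
  toFun φ := QuotientGroup.congr N N φ (Subgroup.characteristic_iff_map_eq.1 hN φ)
  map_one' := by
    ext x
    induction x using QuotientGroup.induction_on
    rfl
  map_mul' φ ψ := by
    ext x
    induction x using QuotientGroup.induction_on
    rfl

/-- Grossman's criterion for residual finiteness of the outer automorphism group. -/
theorem residuallyFinite_outerAut {G : Type*} [Group G] [Group.FG G]
    (hG : ∀ φ : MulAut G, ProfinitelyInner φ → ∃ c, φ = MulAut.conj c) :
    ResiduallyFinite (OuterAut G) := by
  intro k hk
  obtain ⟨φ, rfl⟩ := QuotientGroup.mk_surjective k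
  by_contra hcon
  push Not at hcon
  refine hk ((QuotientGroup.eq_one_iff φ).2 ?_)
  obtain ⟨c, rfl⟩ := hG φ fun N hN hN' => by
    obtain ⟨N', hle, hchar, hfi⟩ := exists_characteristic_le N
    have : Finite (OuterAut (G ⧸ N')) := by
      have : Finite (MulAut (G ⧸ N')) := Finite.of_injective _ DFunLike.coe_injective
      infer_instance
    let E : OuterAut (G ⧸ N') ≃* Shrink.{0} (OuterAut (G ⧸ N')) := Shrink.mulEquiv.symm
    have hle' : (MulAut.conj : G →* MulAut G).range ≤
        (MulAut.conj : G ⧸ N' →* MulAut (G ⧸ N')).range.comap (quotientAut N') := by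
      rintro _ ⟨g, rfl⟩
      refine ⟨g, ?_⟩
      ext x
      induction x using QuotientGroup.induction_on
      rfl
    have h := hcon (Shrink.{0} (OuterAut (G ⧸ N'))) inferInstance inferInstance
      (E.toMonoidHom.comp (QuotientGroup.map _ _ (quotientAut N') hle'))
    have h' : QuotientGroup.map _ _ (quotientAut N') hle' (φ : OuterAut G) = 1 :=
      E.injective (h.trans (map_one E).symm)
    rw [QuotientGroup.map_mk, QuotientGroup.eq_one_iff] at h'
    obtain ⟨q, hq⟩ := h'
    obtain ⟨c, rfl⟩ := QuotientGroup.mk_surjective q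
    refine ⟨c, fun x => hle (QuotientGroup.eq.1 ?_)⟩
    exact DFunLike.congr_fun hq (x : G ⧸ N')
  exact ⟨c, rfl⟩

theorem ProfinitelyInner.conj_mul {G : Type*} [Group G] {φ : MulAut G} (h : ProfinitelyInner φ)
    (a : G) : ProfinitelyInner (MulAut.conj a * φ) := by
  intro N hN hN'
  obtain ⟨c, hc⟩ := h N hN hN'
  refine ⟨a * c, fun x => ?_⟩
  convert hN.conj_mem _ (hc x) a using 1
  rw [MulAut.mul_apply, MulAut.conj_apply]
  group

instance {G G' : Type*} [Group G] [Group G'] (f : G →* G') (N : Subgroup G') [N.FiniteIndex] :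
    (N.comap f).FiniteIndex := ⟨by
  rw [Subgroup.index_comap]
  exact (Subgroup.instFiniteIndex_subgroupOf N _).index_ne_zero⟩

variable {I W : Type*} [Group W] {Gr : SimpleGraph I} (cs : CoxeterSystem (coxMatrix Gr) W)

/-- Conjugacy separability for elements of a virtual retract, with control of the conjugator. -/
theorem exists_conj_of_virtual_retract [Finite I] {G : Type*} [Group G] (j : G →* W)
    (K : Subgroup W) [K.FiniteIndex] (hj : ∀ x, j x ∈ K) (r : K →* G)
    (hr : ∀ x, r ⟨j x, hj x⟩ = x) {g h : G} (hg : j g ∈ even cs) (hh : j h ∈ even cs)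
    (N : Subgroup G) [N.FiniteIndex] :
    ∃ P : Subgroup G, P.Normal ∧ P.FiniteIndex ∧
      ∀ k, (h * k)⁻¹ * (k * g) ∈ P → ∃ a, a * k⁻¹ ∈ N ∧ a * g = h * a := by
  have : ((N.comap r).map K.subtype).FiniteIndex := ⟨by
    rw [Subgroup.index_map_subtype]
    exact mul_ne_zero Subgroup.FiniteIndex.index_ne_zero Subgroup.FiniteIndex.index_ne_zero⟩
  obtain ⟨K', hK', hnorm, hfi, hretr⟩ := exists_retr_invariant cs ((N.comap r).map K.subtype)
  obtain ⟨P, hP, hP', H⟩ := conjSep_of_even cs hretr hg hh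
  refine ⟨P.comap j, inferInstance, inferInstance, fun k hk => ?_⟩
  obtain ⟨a, ha, hag⟩ := H (j k) (by simpa using hk)
  obtain ⟨b, hb, hba⟩ := hK' ha
  have ha' : a = ((b * ⟨j k, hj k⟩ : K) : W) := by
    rw [Subgroup.coe_mul, ← Subgroup.subtype_apply, hba, inv_mul_cancel_right]
  refine ⟨r b * k, ?_, ?_⟩
  · rw [mul_inv_cancel_right]; exact hb
  · have h1 : b * ⟨j k, hj k⟩ * ⟨j g, hj g⟩ = ⟨j h, hj h⟩ * (b * ⟨j k, hj k⟩) := by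
      ext1
      change ((b * ⟨j k, hj k⟩ : K) : W) * j g = j h * ((b * ⟨j k, hj k⟩ : K) : W)
      rwa [← ha']
    have h2 := congrArg r h1
    simp only [map_mul, hr] at h2
    exact h2

/-- Profinitely inner automorphisms of virtual retracts are inner. -/
theorem ProfinitelyInner.exists_eq_conj {I W : Type*} [Group W] {Gr : SimpleGraph I}
    (cs : CoxeterSystem (coxMatrix Gr) W) [Finite I] {V : Type*} [Finite V] {Γ : SimpleGraph V}
    {G : Type*} [Group G] [Group.FG G] (i : G →* RAAG Γ) (hi : Function.Injective i) (j : G →* W)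
    (K : Subgroup W) [K.FiniteIndex] (hj : ∀ x, j x ∈ K) (r : K →* G)
    (hr : ∀ x, r ⟨j x, hj x⟩ = x) {φ : MulAut G} (hφ : ProfinitelyInner φ) :
    ∃ c, φ = MulAut.conj c := by
  have hjinj : Function.Injective j := fun x y hxy => by
    rw [← hr x, ← hr y]
    simp only [hxy]
  obtain ⟨g, hg, w, H, h1, h2⟩ := exists_maximal cs j hjinj
  have hgφ : j (φ g) ∈ even cs := by
    obtain ⟨c, hc⟩ := hφ ((even cs).comap j) inferInstance inferInstance
    have h3 := mul_mem (Subgroup.Normal.conj_mem (H := (even cs).comap j) inferInstance g hg c)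
      (hc g)
    rwa [mul_inv_cancel_left] at h3
  obtain ⟨a, ha⟩ : ∃ a, a * g = φ g * a := by
    obtain ⟨P, hP, hP', hPc⟩ := exists_conj_of_virtual_retract cs j K hj r hr hg hgφ ⊤
    obtain ⟨c, hc⟩ := hφ P hP hP'
    obtain ⟨a, -, ha⟩ := hPc c (by
      convert hP.conj_mem _ (inv_mem (hc g)) c⁻¹ using 1
      group)
    exact ⟨a, ha⟩
  suffices h : ∃ c, MulAut.conj a⁻¹ * φ = MulAut.conj c by
    obtain ⟨c, hc⟩ := h
    refine ⟨a * c, ?_⟩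
    rw [map_mul, ← hc, ← mul_assoc, ← map_mul, mul_inv_cancel, map_one, one_mul]
  replace hφ := hφ.conj_mul a⁻¹
  have hφg : (MulAut.conj a⁻¹ * φ) g = g := by
    rw [MulAut.mul_apply, MulAut.conj_apply, inv_inv, mul_assoc, ← ha, inv_mul_cancel_left]
  generalize MulAut.conj a⁻¹ * φ = φ at hφ hφg
  have hcent : ∀ N : Subgroup G, N.Normal → N.FiniteIndex →
      ∃ c : Subgroup.centralizer {g}, ∀ x, (c * x * (c : G)⁻¹)⁻¹ * φ x ∈ N := by
    intro N hN hN'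
    obtain ⟨P, hP, hP', hPc⟩ := exists_conj_of_virtual_retract cs j K hj r hr hg hg N
    obtain ⟨c, hc⟩ := hφ (N ⊓ P) inferInstance inferInstance
    obtain ⟨a, haN, hag⟩ := hPc c (by
      convert hP.conj_mem _ (inv_mem (hc g).2) c⁻¹ using 1
      rw [hφg]
      group)
    refine ⟨⟨a, Subgroup.mem_centralizer_singleton_iff.2 hag⟩, fun x => ?_⟩
    convert mul_mem (mul_mem haN (hN.conj_mem _ (inv_mem haN) (c * x⁻¹ * c⁻¹))) (hc x).1 using 1
    group
  obtain ⟨S, hS⟩ := Group.fg_def.1 ‹Group.FG G›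
  obtain ⟨c, hc⟩ := exists_conj_of_forall (X := S) (i.comp (Subgroup.centralizer {g}).subtype)
    (H.comap ((Subgroup.centralizer {g}).subtype.prodMap (MonoidHom.id _)))
    (fun x hx => Subtype.ext (h1 x hx))
    (fun c => by
      obtain ⟨k, hk, a, ha⟩ := h2 c (Subgroup.mem_centralizer_singleton_iff.1 c.2).symm
      exact ⟨k, hk, a, ha⟩)
    (fun x => i x) (fun x => i (φ x)) (fun N hN hN' => by
      obtain ⟨c, hc⟩ := hcent (N.comap i) inferInstance inferInstance
      exact ⟨c, fun x => by simpa using hc x⟩)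
  refine ⟨c, ?_⟩
  have : φ.toMonoidHom = (MulAut.conj (c : G)).toMonoidHom :=
    MonoidHom.eq_of_eqOn_dense hS fun x hx => hi (by
      have := hc ⟨x, hx⟩
      simpa using this.symm)
  ext x
  exact DFunLike.congr_fun this x

end

end RightAngled

/-- If `G` is isomorphic to a virtual retract of a finitely generated right-angled
Artin group (i.e. `G ∈ 𝒱ℛ`), then `Out(G)` is residually finite. -/
theorem out_residuallyFinite_of_VR {V : Type*} [Fintype V] (Γ : SimpleGraph V)
    (G : Type*) [Group G]
    (R : Subgroup (RAAG Γ)) (hR : IsVirtualRetract R) (e : G ≃* R) :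
    ResiduallyFinite (OuterAut G) := by
  open RightAngled in
  obtain ⟨K, hRK, hK, r, hr⟩ := hR
  have : K.FiniteIndex := ⟨hK⟩
  have : Group.FG (RAAG Γ) := Group.fg_iff.2
    ⟨_, PresentedGroup.closure_range_of (raagRels Γ), Set.finite_range _⟩
  have hrsurj : Function.Surjective r := fun h => ⟨_, hr h⟩
  have : Group.FG R := Group.fg_of_surjective hrsurj
  have : Group.FG G := Group.fg_of_surjective (f := e.symm.toMonoidHom) e.symm.surjective
  refine residuallyFinite_outerAut fun φ hφ => ?_
  let cs := (coxMatrix (doubleGraph Γ)).toCoxeterSystem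
  have hι := toCoxeter_injective cs
  have : (K.map (toCoxeter cs)).FiniteIndex := ⟨by
    rw [Subgroup.index_map_of_injective _ hι]
    exact mul_ne_zero hK (toCoxeter_range_finiteIndex cs).index_ne_zero⟩
  let E := K.equivMapOfInjective _ hι
  have hi : Function.Injective (R.subtype.comp e.toMonoidHom) :=
    Subtype.val_injective.comp e.injective
  refine hφ.exists_eq_conj cs (R.subtype.comp e.toMonoidHom) hi
    ((toCoxeter cs).comp (R.subtype.comp e.toMonoidHom)) (K.map (toCoxeter cs))
    (fun x => ⟨_, hRK (e x).2, rfl⟩) (e.symm.toMonoidHom.comp (r.comp E.symm.toMonoidHom))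
    fun x => ?_
  have hE : E.symm ⟨toCoxeter cs (e x), _, hRK (e x).2, rfl⟩ = ⟨e x, hRK (e x).2⟩ := by
    rw [MulEquiv.symm_apply_eq]
    rfl
  change e.symm (r (E.symm ⟨toCoxeter cs (e x), _, hRK (e x).2, rfl⟩)) = x
  rw [hE, hr, e.symm_apply_apply]
end

section
/- Let G be a finitely generated group and N a normal subgroup of finite index in G whose center Z (viewed as a subgroup of G, namely the image of Subgroup.center N in G) is finitely generated. For each k ≥ 1 let Z^k denote the subgroup {z^k : z ∈ Z} of G (a subgroup since Z is abelian, and normal in G). Suppose that Out(G/Z) is residually finite and that there exists m ≥ 1 such that Out(G/Z^{m·n}) is residually finite for every n ≥ 1. Then Out(G) is residually finite. -/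
open scoped Pointwise

/-- A group whose nontrivial elements are avoided by finite-index subgroups is residually
finite. -/
theorem ResiduallyFinite.of_finiteIndex {K : Type*} [Group K]
    (h : ∀ k : K, k ≠ 1 → ∃ L : Subgroup K, L.FiniteIndex ∧ k ∉ L) : ResiduallyFinite K := by
  intro k hk
  obtain ⟨L, hL, hkL⟩ := h k hk
  obtain ⟨n, ⟨e⟩⟩ := Finite.exists_equiv_fin (K ⧸ L)
  refine ⟨Equiv.Perm (Fin n), inferInstance, inferInstance,
    e.permCongrHom.toMonoidHom.comp (MulAction.toPermHom K (K ⧸ L)), fun h1 => hkL ?_⟩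
  have h2 : MulAction.toPermHom K (K ⧸ L) k = 1 := by
    apply e.permCongrHom.injective
    rw [map_one]
    exact h1
  have h3 : k • ((1 : K) : K ⧸ L) = ((1 : K) : K ⧸ L) := 
    DFunLike.congr_fun h2 ((1 : K) : K ⧸ L)
  rw [MulAction.Quotient.smul_coe, smul_eq_mul, mul_one, eq_comm, QuotientGroup.eq] at h3
  simpa using h3

/-- In a finitely generated module over `ℤ`, an element divisible by every positive integer
vanishes. -/
theorem eq_zero_of_forall_exists_nsmul_eq {A : Type*} [AddCommGroup A] [Module.Finite ℤ A] {x : A}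
    (hx : ∀ n : ℕ, 1 ≤ n → ∃ y : A, n • y = x) : x = 0 := by
  have hmem : x ∈ (⨅ i : ℕ, Ideal.span {(2 : ℤ)} ^ i • ⊤ : Submodule ℤ A) := by
    rw [Submodule.mem_iInf]
    intro i
    obtain ⟨y, rfl⟩ := hx (2 ^ i) Nat.one_le_two_pow
    rw [Ideal.span_singleton_pow, ← natCast_zsmul]
    exact Submodule.smul_mem_smul (by simp) trivial
  obtain ⟨⟨r, hr⟩, hrx⟩ := (Ideal.mem_iInf_smul_pow_eq_bot_iff _ x).mp hmem
  obtain ⟨s, rfl⟩ := Ideal.mem_span_singleton.mp hr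
  have hx0 : (2 * s - 1) • x = 0 := by
    rw [sub_smul, one_smul, sub_eq_zero]
    exact hrx
  have hne : (2 * s - 1).natAbs ≠ 0 := by omega
  have hfin : Finite (Submodule.torsion ℤ A) :=
    Module.finite_of_fg_torsion _ (Submodule.torsion_isTorsion)
  have he : 0 < Nat.card (Submodule.torsion ℤ A) := Nat.card_pos
  have hx0' : (2 * s - 1).natAbs • x = 0 := by
    rcases Int.natAbs_eq (2 * s - 1) with h | h
    · rw [← natCast_zsmul, ← h, hx0]
    · rw [← natCast_zsmul, ← neg_eq_zero, ← neg_smul, ← h, hx0]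
  obtain ⟨y, hy⟩ := hx ((2 * s - 1).natAbs * Nat.card (Submodule.torsion ℤ A))
    (Nat.mul_pos (Nat.pos_of_ne_zero hne) he)
  have hyt : y ∈ Submodule.torsion ℤ A := by
    refine Submodule.mem_torsion_iff _ |>.mpr ⟨⟨(((2 * s - 1).natAbs *
      ((2 * s - 1).natAbs * Nat.card (Submodule.torsion ℤ A)) : ℕ) : ℤ), ?_⟩, ?_⟩
    · rw [mem_nonZeroDivisors_iff_ne_zero]
      exact_mod_cast Nat.mul_ne_zero hne (Nat.mul_ne_zero hne he.ne')
    · change (((2 * s - 1).natAbs *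
        ((2 * s - 1).natAbs * Nat.card (Submodule.torsion ℤ A)) : ℕ) : ℤ) • y = 0
      rw [natCast_zsmul, mul_smul, hy, hx0']
  have hey : Nat.card (Submodule.torsion ℤ A) • y = 0 :=
    congrArg Subtype.val (card_nsmul_eq_zero' (x := (⟨y, hyt⟩ : Submodule.torsion ℤ A)))
  rw [← hy, mul_smul, hey, smul_zero]

/-- Subgroups of finitely generated abelian groups are closed in the profinite topology. -/
theorem Subgroup.mem_of_forall_exists_mul_pow {A : Type*} [CommGroup A] [Group.FG A]
    (D : Subgroup A) {c : A} (hc : ∀ n : ℕ, 1 ≤ n → ∃ d ∈ D, ∃ z : A, c = d * z ^ n) : c ∈ D := by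
  have : Module.Finite ℤ (Additive (A ⧸ D)) := Module.Finite.iff_addGroup_fg.mpr inferInstance
  have h0 : Additive.ofMul (c : A ⧸ D) = 0 := by
    refine eq_zero_of_forall_exists_nsmul_eq fun n hn => ?_
    obtain ⟨d, hd, z, rfl⟩ := hc n hn
    refine ⟨Additive.ofMul (z : A ⧸ D), ?_⟩
    rw [← ofMul_pow, QuotientGroup.mk_mul, (QuotientGroup.eq_one_iff d).mpr hd, one_mul,
      QuotientGroup.mk_pow]
  exact (QuotientGroup.eq_one_iff c).mp h0

instance MonoidHom.finite_of_fg {G F : Type*} [Group G] [Group.FG G] [Group F] [Finite F] :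
    Finite (G →* F) := by
  obtain ⟨S, hS⟩ := Group.fg_def.mp ‹Group.FG G›
  refine Finite.of_injective (fun f (s : S) => f s) fun f g hfg => ?_
  exact MonoidHom.eq_of_eqOn_dense hS fun s hs => congrFun hfg ⟨s, hs⟩

/-- In a finitely generated group, a normal subgroup of finite index has only finitely many images
under automorphisms. -/
theorem MulAut.finiteIndex_stabilizer {G : Type*} [Group G] [Group.FG G] (N : Subgroup G)
    [N.Normal] [N.FiniteIndex] : (MulAction.stabilizer (MulAut G) N).FiniteIndex := by
  have hfin : (MulAction.orbit (MulAut G) N).Finite := by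
    refine (Set.finite_range fun f : G →* G ⧸ N => f.ker).subset ?_
    rintro _ ⟨φ, rfl⟩
    refine ⟨(QuotientGroup.mk' N).comp (φ⁻¹ : MulAut G).toMonoidHom, ?_⟩
    ext x
    simp only [MonoidHom.mem_ker, Subgroup.mem_pointwise_smul_iff_inv_smul_mem]
    exact QuotientGroup.eq_one_iff _
  refine ⟨?_⟩
  rw [MulAction.index_stabilizer]
  exact (Set.ncard_pos hfin).mpr (MulAction.nonempty_orbit N) |>.ne'

/-- Automorphisms preserving a normal subgroup act on the quotient. -/
def MulAut.quotientHom {G : Type*} [Group G] (M : Subgroup G) [M.Normal] :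
    MulAction.stabilizer (MulAut G) M →* MulAut (G ⧸ M) where
  toFun φ := QuotientGroup.congr M M φ.1 φ.2
  map_one' := by
    ext x
    obtain ⟨x, rfl⟩ := QuotientGroup.mk_surjective x
    rfl
  map_mul' φ ψ := by
    ext x
    obtain ⟨x, rfl⟩ := QuotientGroup.mk_surjective x
    rfl

theorem MulAut.conj_mem_stabilizer {G : Type*} [Group G] (M : Subgroup G) [M.Normal] (g : G) :
    MulAut.conj g ∈ MulAction.stabilizer (MulAut G) M :=
  Subgroup.Normal.conj_smul_eq_self g M

/-- An automorphism that is not inner modulo `M` is separated from the inner automorphisms by a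
finite-index subgroup, as soon as `Out (G ⧸ M)` is residually finite. -/
theorem MulAut.exists_finiteIndex_of_quotient {G : Type*} [Group G] (M : Subgroup G) [M.Normal]
    [(MulAction.stabilizer (MulAut G) M).FiniteIndex] (hM : ResiduallyFinite (OuterAut (G ⧸ M)))
    {φ : MulAut G} (hφ : φ ∈ MulAction.stabilizer (MulAut G) M)
    (hne : ¬ ∃ g : G, ∀ x : G, (φ x)⁻¹ * (g * x * g⁻¹) ∈ M) :
    ∃ L : Subgroup (MulAut G), L.FiniteIndex ∧ (MulAut.conj : G →* MulAut G).range ≤ L ∧ φ ∉ L := by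
  let q : MulAction.stabilizer (MulAut G) M →* OuterAut (G ⧸ M) :=
    (QuotientGroup.mk' _).comp (MulAut.quotientHom M)
  have hq : q ⟨φ, hφ⟩ ≠ 1 := by
    intro h
    obtain ⟨g, hg⟩ := (QuotientGroup.eq_one_iff _).mp h
    obtain ⟨g, rfl⟩ := QuotientGroup.mk_surjective g
    refine hne ⟨g, fun x => QuotientGroup.eq.mp ?_⟩
    exact (DFunLike.congr_fun hg (x : G ⧸ M)).symm
  obtain ⟨F, _, _, f, hf⟩ := hM _ hq
  refine ⟨(f.comp q).ker.map (Subgroup.subtype _), ⟨?_⟩, ?_, ?_⟩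
  · rw [Subgroup.index_map_subtype]
    exact Nat.mul_ne_zero Subgroup.FiniteIndex.index_ne_zero Subgroup.FiniteIndex.index_ne_zero
  · rintro _ ⟨g, rfl⟩
    refine ⟨⟨MulAut.conj g, MulAut.conj_mem_stabilizer M g⟩, ?_, rfl⟩
    have h1 : q ⟨MulAut.conj g, MulAut.conj_mem_stabilizer M g⟩ = 1 := by
      refine (QuotientGroup.eq_one_iff _).mpr ⟨(g : G ⧸ M), ?_⟩
      ext x
      obtain ⟨x, rfl⟩ := QuotientGroup.mk_surjective x
      rfl
    simp [MonoidHom.mem_ker, h1]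
  · rintro ⟨ψ, hψ, rfl⟩
    exact hf hψ

/-- An automorphism which modulo every `n`-th power subgroup of an abelian subgroup `Z` centralized
by `N` agrees with conjugation by an element of `N` is inner. -/
theorem MulAut.mem_range_conj_of_forall_mem {G : Type*} [Group G] [Group.FG G] (N Z : Subgroup G)
    [Z.Normal] (hZfg : Z.FG) (hZN : Z ≤ N) (hcomm : ∀ h ∈ N, ∀ z ∈ Z, h * z = z * h)
    (θ : MulAut G)
    (hθZ : ∀ x, x⁻¹ * θ x ∈ Z)
    (hθ : ∀ n : ℕ, 1 ≤ n → ∃ h ∈ N, ∀ x, ∃ z ∈ Z, (θ x)⁻¹ * (h * x * h⁻¹) = z ^ n) :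
    θ ∈ (MulAut.conj : G →* MulAut G).range := by
  obtain ⟨S, hS⟩ := Group.fg_def.mp ‹Group.FG G›
  let _ : CommGroup Z :=
    { (inferInstance : Group Z) with
      mul_comm := fun a b => Subtype.ext (hcomm a (hZN a.2) b b.2) }
  have : Group.FG Z := (Group.fg_iff_subgroup_fg Z).mpr hZfg
  let D : Subgroup (S → Z) :=
    { carrier := {d | ∃ h ∈ N, ∀ s : S, (d s : G) = (s : G)⁻¹ * (h * s * h⁻¹)}
      one_mem' := ⟨1, N.one_mem, by simp⟩
      mul_mem' := by
        rintro d e ⟨h, hh, hd⟩ ⟨k, hk, he⟩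
        refine ⟨h * k, N.mul_mem hh hk, fun s => ?_⟩
        have h1 : h * (e s : G) = e s * h := hcomm h hh _ (e s).2
        have h2 : (e s : G) = h * e s * h⁻¹ := by rw [h1]; group
        rw [Pi.mul_apply, Subgroup.coe_mul, h2, hd, he]
        group
      inv_mem' := by
        rintro d ⟨h, hh, hd⟩
        refine ⟨h⁻¹, N.inv_mem hh, fun s => ?_⟩
        have h1 : h * (d s : G)⁻¹ = (d s : G)⁻¹ * h := hcomm h hh _ (Z.inv_mem (d s).2)
        have h2 : (d s : G)⁻¹ = h⁻¹ * (d s : G)⁻¹ * h := by rw [mul_assoc, ← h1]; group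
        rw [Pi.inv_apply, Subgroup.coe_inv, h2, hd]
        group }
  obtain ⟨h, -, hh⟩ : (fun s : S => (⟨(s : G)⁻¹ * θ s, hθZ s⟩ : Z)) ∈ D := by
    refine Subgroup.mem_of_forall_exists_mul_pow (A := S → Z) D fun n hn => ?_
    obtain ⟨h, hh, hz⟩ := hθ n hn
    choose z hzZ hz using hz
    have key : ∀ s : S, (s : G)⁻¹ * θ s * z s ^ n = (s : G)⁻¹ * (h * s * h⁻¹) := by
      intro s
      rw [← hz]
      group
    refine ⟨fun s => ⟨(s : G)⁻¹ * θ s, hθZ s⟩ * ⟨z s, hzZ s⟩ ^ n, ⟨h, hh, fun s => key s⟩,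
      fun s => ⟨z s, hzZ s⟩⁻¹, ?_⟩
    funext s
    simp only [Pi.mul_apply, Pi.pow_apply, inv_pow, mul_inv_cancel_right]
  refine ⟨h, ?_⟩
  have heq : (MulAut.conj h).toMonoidHom = θ.toMonoidHom :=
    MonoidHom.eq_of_eqOn_dense hS fun s hs => (mul_left_cancel (hh ⟨s, hs⟩)).symm
  exact MulEquiv.ext fun x => DFunLike.congr_fun heq x

/-- If a self-map is conjugation modulo `M n` for all `n ≥ 1`, the conjugating elements can be taken
in one coset of the finite-index subgroup `N`. -/
theorem exists_coset_forall_conj_mem {G : Type*} [Group G] (N : Subgroup G) [N.FiniteIndex]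
    (M : ℕ → Subgroup G) (hM : ∀ k l, k ∣ l → M l ≤ M k) (φ : G → G)
    (hφ : ∀ n : ℕ, 1 ≤ n → ∃ g : G, ∀ x : G, (φ x)⁻¹ * (g * x * g⁻¹) ∈ M n) :
    ∃ g : G, ∀ n : ℕ, 1 ≤ n → ∃ h ∈ N,
      ∀ x : G, (φ x)⁻¹ * ((g * h) * x * (g * h)⁻¹) ∈ M n := by
  by_contra! hcon
  choose n hn hcon using hcon
  have := Fintype.ofFinite (G ⧸ N)
  obtain ⟨g, hg⟩ := hφ (∏ c : G ⧸ N, n c.out) 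
    (Nat.one_le_iff_ne_zero.mpr (Finset.prod_ne_zero_iff.mpr fun c _ => Nat.one_le_iff_ne_zero.mp (hn c.out)))
  obtain ⟨x, hx⟩ := hcon (g : G ⧸ N).out ((g : G ⧸ N).out⁻¹ * g)
    (QuotientGroup.eq.mp (QuotientGroup.out_eq' _))
  refine hx (hM _ _ (Finset.dvd_prod_of_mem (fun c : G ⧸ N => n c.out) (Finset.mem_univ _)) ?_)
  simpa using hg x

/-- Criterion for residual finiteness of `Out(G)`: if `N` is a finite-index normal
subgroup of the finitely generated group `G` whose center `Z` (viewed inside `G`)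
is finitely generated, `Out(G/Z)` is residually finite, and for some `m ≥ 1` all
quotients `Out(G/Z^{m·n})` by the congruence subgroups `Z^{m·n} = {z^{m·n} : z ∈ Z}`
have residually finite outer automorphism groups, then `Out(G)` is residually
finite. -/
theorem out_residuallyFinite_criterion
    (G : Type*) [Group G] [Group.FG G]
    (N : Subgroup G) [N.Normal] (hN : N.index ≠ 0)
    (Z : Subgroup G) (hZ : Z = Subgroup.map N.subtype (Subgroup.center N))
    [Z.Normal] (hZfg : Z.FG)
    (Zpow : ℕ → Subgroup G)
    (hZpow : ∀ k : ℕ, (Zpow k : Set G) = {x : G | ∃ z ∈ Z, x = z ^ k})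
    [∀ k, (Zpow k).Normal]
    (hOutZ : ResiduallyFinite (OuterAut (G ⧸ Z)))
    (m : ℕ) (hm : 1 ≤ m)
    (hOutn : ∀ n : ℕ, 1 ≤ n → ResiduallyFinite (OuterAut (G ⧸ Zpow (m * n)))) :
    ResiduallyFinite (OuterAut G) := by
  have : N.FiniteIndex := ⟨hN⟩
  have memZ (x : G) : x ∈ Z ↔ x ∈ N ∧ ∀ h ∈ N, h * x = x * h := by
    subst hZ
    constructor
    · rintro ⟨z, hz, rfl⟩
      exact ⟨z.2, fun h hh => congrArg Subtype.val (Subgroup.mem_center_iff.mp hz ⟨h, hh⟩)⟩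
    · rintro ⟨hx, hc⟩
      exact ⟨⟨x, hx⟩, Subgroup.mem_center_iff.mpr fun h => Subtype.ext (hc h h.2), rfl⟩
  have memZpow (k : ℕ) (x : G) : x ∈ Zpow k ↔ ∃ z ∈ Z, x = z ^ k := by
    rw [← SetLike.mem_coe, hZpow]
    rfl
  have hanti (k l : ℕ) (hkl : k ∣ l) : Zpow l ≤ Zpow k := by
    intro x hx
    obtain ⟨z, hz, rfl⟩ := (memZpow l x).mp hx
    obtain ⟨d, rfl⟩ := hkl
    exact (memZpow k _).mpr ⟨z ^ d, Z.pow_mem hz d, by rw [← pow_mul, mul_comm]⟩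
  have hleZ (k : ℕ) : Zpow k ≤ Z := by
    intro x hx
    obtain ⟨z, hz, rfl⟩ := (memZpow k x).mp hx
    exact Z.pow_mem hz k
  have hstabZ {φ : MulAut G} (hφ : φ ∈ MulAction.stabilizer (MulAut G) N) {z : G} (hz : z ∈ Z) :
      φ z ∈ Z := by
    have hmem (x : G) : φ x ∈ N ↔ x ∈ N := by
      conv_lhs => rw [← MulAction.mem_stabilizer_iff.mp hφ]
      exact Subgroup.smul_mem_pointwise_smul_iff
    obtain ⟨hzN, hzc⟩ := (memZ z).mp hz
    refine (memZ _).mpr ⟨(hmem z).mpr hzN, fun h hh => ?_⟩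
    obtain ⟨h, rfl⟩ := φ.surjective h
    rw [← map_mul, ← map_mul, hzc h ((hmem h).mp hh)]
  have hstab (k : ℕ) : MulAction.stabilizer (MulAut G) N ≤
      MulAction.stabilizer (MulAut G) (Zpow k) := by
    have hle {φ : MulAut G} (hφ : φ ∈ MulAction.stabilizer (MulAut G) N) :
        φ • Zpow k ≤ Zpow k := by
      rintro _ ⟨x, hx, rfl⟩
      obtain ⟨z, hz, rfl⟩ := (memZpow k x).mp hx
      exact (memZpow k _).mpr ⟨φ z, hstabZ hφ hz, map_pow φ z k⟩
    intro φ hφ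
    refine le_antisymm (hle hφ) ?_
    rw [Subgroup.subset_pointwise_smul_iff]
    exact hle (inv_mem hφ)
  have hfinN := MulAut.finiteIndex_stabilizer N
  have hfin (k : ℕ) : (MulAction.stabilizer (MulAut G) (Zpow k)).FiniteIndex :=
    Subgroup.finiteIndex_of_le (hstab k)
  have hsep (φ : MulAut G) (hφ : φ ∉ (MulAut.conj : G →* MulAut G).range) :
      ∃ L : Subgroup (MulAut G), L.FiniteIndex ∧
        (MulAut.conj : G →* MulAut G).range ≤ L ∧ φ ∉ L := by
    by_cases hφN : φ ∈ MulAction.stabilizer (MulAut G) N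
    swap
    · refine ⟨_, hfinN, ?_, hφN⟩
      rintro _ ⟨g, rfl⟩
      exact MulAut.conj_mem_stabilizer N g
    by_contra hL
    have hinner (n : ℕ) (hn : 1 ≤ n) :
        ∃ g : G, ∀ x : G, (φ x)⁻¹ * (g * x * g⁻¹) ∈ Zpow (m * n) := by
      by_contra hne
      exact hL (MulAut.exists_finiteIndex_of_quotient _ (hOutn n hn) (hstab _ hφN) hne)
    obtain ⟨g, hg⟩ := exists_coset_forall_conj_mem N (fun n => Zpow (m * n))
      (fun k l hkl => hanti _ _ (mul_dvd_mul_left m hkl)) φ hinner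
    obtain ⟨h₀, hh₀, hg₀⟩ := hg 1 le_rfl
    have hθ : (MulAut.conj (g * h₀))⁻¹ * φ ∈ (MulAut.conj : G →* MulAut G).range := by
      refine MulAut.mem_range_conj_of_forall_mem N Z hZfg (fun z hz => ((memZ z).mp hz).1)
        (fun h hh z hz => ((memZ z).mp hz).2 h hh) _ (fun x => ?_) (fun n hn => ?_)
      · have h1 := Subgroup.Normal.conj_mem ‹Z.Normal› _ (Z.inv_mem (hleZ _ (hg₀ x))) (g * h₀)⁻¹
        convert h1 using 1
        simp [MulAut.mul_apply, mul_assoc]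
      · obtain ⟨h, hh, hgh⟩ := hg n hn
        refine ⟨h₀⁻¹ * h, N.mul_mem (N.inv_mem hh₀) hh, fun x => ?_⟩
        have h1 := hanti n (m * n) (Dvd.intro_left m rfl) <|
          Subgroup.Normal.conj_mem inferInstance _ (hgh x) (g * h₀)⁻¹
        obtain ⟨z, hz, hzx⟩ := (memZpow n _).mp h1
        refine ⟨z, hz, ?_⟩
        rw [← hzx]
        simp [MulAut.mul_apply, mul_assoc]
    exact hφ ((Subgroup.mul_mem_cancel_left _ (inv_mem (MonoidHom.mem_range.mpr ⟨g * h₀, rfl⟩))).mp hθ)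
  refine ResiduallyFinite.of_finiteIndex fun k hk => ?_
  obtain ⟨φ, rfl⟩ := QuotientGroup.mk_surjective k
  obtain ⟨L, hLfin, hLe, hφL⟩ := hsep φ fun h => hk ((QuotientGroup.eq_one_iff φ).mpr h)
  refine ⟨L.map (QuotientGroup.mk' _), ⟨?_⟩, ?_⟩
  · rw [Subgroup.index_map_eq L (QuotientGroup.mk'_surjective _) (by simpa using hLe)]
    exact hLfin.index_ne_zero
  · rintro ⟨ψ, hψ, hψφ⟩
    have h1 : ψ⁻¹ * φ ∈ L := hLe (QuotientGroup.eq.mp hψφ)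
    exact hφL ((Subgroup.mul_mem_cancel_left _ (inv_mem hψ)).mp h1)
end
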